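/- No triangulation of the polytope P_m (with Q_m a regular m-gon, m even) has more than 7m/2 + 1 tetrahedra. -/

import Mathlib

open Set MeasureTheory
open scoped Classical

noncomputable section

abbrev Pt3 := Fin 3 → ℝ

/-- A (geometric) tetrahedron: 4 affinely independent points. -/
def IsTet (σ : Finset Pt3) : Prop :=
  σ.card = 4 ∧ AffineIndependent ℝ (fun p : (σ : Set Pt3) => (p : Pt3))

/-- A dissection of the convex polytope `conv V` using only vertices in `V`:
tetrahedra with pairwise disjoint interiors covering the polytope. -/
def IsDissection (V : Finset Pt3) (D : Finset (Finset Pt3)) : Prop :=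
  (∀ σ ∈ D, IsTet σ ∧ (σ : Set Pt3) ⊆ (V : Set Pt3)) ∧
  (∀ σ ∈ D, ∀ τ ∈ D, σ ≠ τ →
    interior (convexHull ℝ (σ : Set Pt3)) ∩ interior (convexHull ℝ (τ : Set Pt3)) = ∅) ∧
  (⋃ σ ∈ D, convexHull ℝ (σ : Set Pt3)) = convexHull ℝ (V : Set Pt3)

/-- A triangulation: a dissection in which any two tetrahedra meet in a common
(possibly empty) face. -/
def IsTriangulation (V : Finset Pt3) (D : Finset (Finset Pt3)) : Prop :=
  IsDissection V D ∧
  ∀ σ ∈ D, ∀ τ ∈ D,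
    convexHull ℝ (σ : Set Pt3) ∩ convexHull ℝ (τ : Set Pt3)
      = convexHull ℝ ((σ ∩ τ : Finset Pt3) : Set Pt3)

/-- The vertex set of the standard regular `m`-gon in the plane `z = 0`. -/
def regPoly (m : ℕ) : Finset Pt3 :=
  (Finset.univ : Finset (Fin m)).image
    (fun k => ![Real.cos (2 * Real.pi * k.1 / m), Real.sin (2 * Real.pi * k.1 / m), 0])

/-- The hypotheses describing the polytope `P_m`: the convex hull of a regular
`m`-gon `Q_m` (m even) together with two orthogonal segments `v₁v₂` and `u₁u₂`
parallel to the plane of `Q_m`, on opposite sides of it, each of the four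
segments `vᵢuⱼ` crossing the relative interior of `Q_m`, and with `v₁v₂`, `u₁u₂`
not parallel to any edge or diagonal of `Q_m`. -/
def PmSetup (m : ℕ) (v₁ v₂ u₁ u₂ : Pt3) : Prop :=
  Even m ∧ 3 ≤ m ∧ v₁ ≠ v₂ ∧ u₁ ≠ u₂ ∧
  -- v₁v₂ parallel to the plane of Q_m, above it; u₁u₂ parallel, below it
  v₁ 2 = v₂ 2 ∧ 0 < v₁ 2 ∧ u₁ 2 = u₂ 2 ∧ u₁ 2 < 0 ∧
  -- the two segments are orthogonal to each other
  ((v₂ 0 - v₁ 0) * (u₂ 0 - u₁ 0) + (v₂ 1 - v₁ 1) * (u₂ 1 - u₁ 1) = 0) ∧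
  -- the four segments vᵢuⱼ intersect the relative interior of Q_m
  (∀ v ∈ ({v₁, v₂} : Set Pt3), ∀ u ∈ ({u₁, u₂} : Set Pt3),
    (openSegment ℝ v u ∩ intrinsicInterior ℝ (convexHull ℝ (regPoly m : Set Pt3))).Nonempty) ∧
  -- v₁v₂ and u₁u₂ are not parallel to any edge or diagonal of Q_m
  (∀ a ∈ regPoly m, ∀ b ∈ regPoly m, a ≠ b → ∀ t : ℝ,
    v₂ - v₁ ≠ t • (b - a) ∧ u₂ - u₁ ≠ t • (b - a))

/-- `w` is a convex combination of the points of `S` with all weights positive. -/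
def Pos (S : Finset Pt3) (w : Pt3) : Prop :=
  ∃ c : Pt3 → ℝ, (∀ s ∈ S, 0 < c s) ∧ ∑ s ∈ S, c s = 1 ∧ ∑ s ∈ S, c s • s = w

lemma pos_single (a : Pt3) : Pos {a} a := ⟨fun _ => 1, by simp, by simp, by simp⟩

lemma pos_comb {S S' : Finset Pt3} {a b : Pt3} {t : ℝ} (h1 : Pos S a) (h2 : Pos S' b)
    (t0 : 0 < t) (t1 : t < 1) : Pos (S ∪ S') ((1 - t) • a + t • b) := by
  obtain ⟨c, c0, c1, cw⟩ := h1
  obtain ⟨d, d0, d1, dw⟩ := h2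
  have key1 : ∀ (S S' : Finset Pt3) (c : Pt3 → ℝ),
      ∑ s ∈ S ∪ S', (if s ∈ S then c s else 0) = ∑ s ∈ S, c s := by
    intro S S' c
    rw [← Finset.sum_filter]
    congr 1
    ext s; simp
  have key2 : ∀ (S S' : Finset Pt3) (c : Pt3 → ℝ),
      ∑ s ∈ S ∪ S', (if s ∈ S then c s else 0) • s = ∑ s ∈ S, c s • s := by
    intro S S' c
    have : ∀ s : Pt3, (if s ∈ S then c s else 0) • s = if s ∈ S then c s • s else 0 := by
      intro s; split_ifs <;> simp
    simp_rw [this]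
    rw [← Finset.sum_filter]
    congr 1
    ext s; simp
  refine ⟨fun s => (1 - t) * (if s ∈ S then c s else 0) + t * (if s ∈ S' then d s else 0), ?_, ?_, ?_⟩
  · intro s hs
    have h1t : 0 < 1 - t := by linarith
    rcases Finset.mem_union.1 hs with h | h
    · have := mul_pos h1t (c0 s h)
      simp only [h, if_true]
      split_ifs with h'
      · have := mul_pos t0 (d0 s h'); linarith
      · linarith
    · have := mul_pos t0 (d0 s h)
      simp only [h, if_true]
      split_ifs with h'
      · have := mul_pos h1t (c0 s h'); linarith
      · linarith
  · rw [Finset.sum_add_distrib, ← Finset.mul_sum, ← Finset.mul_sum, key1, Finset.union_comm, key1,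
      c1, d1]
    ring
  · simp_rw [add_smul, mul_smul]
    rw [Finset.sum_add_distrib, ← Finset.smul_sum, ← Finset.smul_sum, key2, Finset.union_comm, key2,
      cw, dw]

lemma pos_mem_hull {S : Finset Pt3} {w : Pt3} (h : Pos S w) : w ∈ convexHull ℝ (S : Set Pt3) := by
  obtain ⟨c, c0, c1, cw⟩ := h
  rw [Finset.mem_convexHull']
  exact ⟨c, fun s hs => (c0 s hs).le, c1, cw⟩

lemma tet_unique {σ : Finset Pt3} (hσ : IsTet σ) {c d : Pt3 → ℝ}
    (h1 : ∑ s ∈ σ, c s = ∑ s ∈ σ, d s) (h2 : ∑ s ∈ σ, c s • s = ∑ s ∈ σ, d s • s) :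
    ∀ s ∈ σ, c s = d s := by
  have h := (affineIndependent_iff.1 hσ.2) Finset.univ (fun p => c p.1 - d p.1) ?_ ?_
  · intro s hs
    have := h ⟨s, hs⟩ (Finset.mem_univ _)
    simp only at this
    linarith
  · have := Finset.sum_coe_sort σ (fun p => c p - d p)
    have e : ∑ i ∈ σ, (c i - d i) = 0 := by rw [Finset.sum_sub_distrib, h1, sub_self]
    rw [e] at this
    exact this
  · have := Finset.sum_coe_sort σ (fun p => (c p - d p) • p)
    have e : ∑ i ∈ σ, (c i - d i) • i = 0 := by
      simp_rw [sub_smul]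
      rw [Finset.sum_sub_distrib, h2, sub_self]
    rw [e] at this
    exact this

/-- extension of a convex combination on a subset -/
lemma extend_comb {σ S : Finset Pt3} (hS : S ⊆ σ) (c : Pt3 → ℝ) :
    ∑ s ∈ σ, (if s ∈ S then c s else 0) = ∑ s ∈ S, c s ∧
    ∑ s ∈ σ, (if s ∈ S then c s else 0) • s = ∑ s ∈ S, c s • s := by
  constructor
  · rw [← Finset.sum_filter]
    congr 1
    ext s; simp; intro h; exact hS h
  · have : ∀ s : Pt3, (if s ∈ S then c s else 0) • s = if s ∈ S then c s • s else 0 := by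
      intro s; split_ifs <;> simp
    simp_rw [this]
    rw [← Finset.sum_filter]
    congr 1
    ext s; simp; intro h; exact hS h

lemma pos_face {σ S S2 : Finset Pt3} (hσ : IsTet σ) (hS : S ⊆ σ) (hS2 : S2 ⊆ σ) {w : Pt3}
    (hp : Pos S w) (hw : w ∈ convexHull ℝ (S2 : Set Pt3)) : S ⊆ S2 := by
  obtain ⟨c, c0, c1, cw⟩ := hp
  rw [Finset.mem_convexHull'] at hw
  obtain ⟨d, d0, d1, dw⟩ := hw
  obtain ⟨e1, e2⟩ := extend_comb hS c
  obtain ⟨f1, f2⟩ := extend_comb hS2 d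
  have := tet_unique hσ (c := fun s => if s ∈ S then c s else 0)
    (d := fun s => if s ∈ S2 then d s else 0) (by rw [e1, f1, c1, d1]) (by rw [e2, f2, cw, dw])
  intro s hs
  by_contra hn
  have h := this s (hS hs)
  simp only [hs, hn, if_true, if_false] at h
  have := c0 s hs
  linarith

/-- a point in the relative interior of a proper face cannot be written using another vertex -/
lemma pos_no_push {σ S : Finset Pt3} (hσ : IsTet σ) (hS : S ⊆ σ) {y b : Pt3}
    (hp : Pos S y) (hb : b ∈ σ) (hbS : b ∉ S) {ε : ℝ} (hε : 0 < ε)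
    (hw : y + ε • (y - b) ∈ convexHull ℝ (σ : Set Pt3)) : False := by
  obtain ⟨c, c0, c1, cw⟩ := hp
  rw [Finset.mem_convexHull'] at hw
  obtain ⟨d, d0, d1, dw⟩ := hw
  obtain ⟨e1, e2⟩ := extend_comb hS c
  have hsum : ∑ s ∈ σ, (d s + ε * (if s = b then 1 else 0)) = 1 + ε := by
    rw [Finset.sum_add_distrib, d1, ← Finset.mul_sum]; simp [hb]
  have hsum2 : ∑ s ∈ σ, (d s + ε * (if s = b then 1 else 0)) • s = (1 + ε) • y := by
    simp_rw [add_smul, mul_smul]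
    rw [Finset.sum_add_distrib, dw, ← Finset.smul_sum]
    simp only [ite_smul, one_smul, zero_smul, Finset.sum_ite_eq', hb, if_true]
    module
  have := tet_unique hσ (c := fun s => (1 + ε) * (if s ∈ S then c s else 0))
    (d := fun s => d s + ε * (if s = b then 1 else 0))
    (by rw [hsum, ← Finset.mul_sum, e1, c1, mul_one])
    (by rw [hsum2]; simp_rw [mul_smul]; rw [← Finset.smul_sum, e2, cw])
  have h := this b hb
  simp only [hbS, if_false, if_true] at h
  have := d0 b hb
  linarith


/-- abstract configuration -/
structure Cfg where
  x : Pt3 →ₗ[ℝ] ℝ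
  y : Pt3 →ₗ[ℝ] ℝ
  z : Pt3 →ₗ[ℝ] ℝ
  inj : ∀ a b, x a = x b → y a = y b → z a = z b → a = b
  Q : Finset Pt3
  v : Fin 2 → Pt3
  u : Fin 2 → Pt3
  hv : v 0 ≠ v 1
  hu : u 0 ≠ u 1
  h : ℝ
  h' : ℝ
  hpos : 0 < h
  hpos' : 0 < h'
  zv : ∀ i, z (v i) = h
  xv : ∀ i, x (v i) = 0
  zu : ∀ j, z (u j) = -h'
  yu : ∀ j, y (u j) = 0
  zQ : ∀ q ∈ Q, z q = 0
  circ : ∀ q ∈ Q, x q ^ 2 + y q ^ 2 = 1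
  negQ : ∀ q ∈ Q, -q ∈ Q
  xinj : ∀ a ∈ Q, ∀ b ∈ Q, x a = x b → a = b
  yinj : ∀ a ∈ Q, ∀ b ∈ Q, y a = y b → a = b
  coset : ∀ a ∈ Q, ∀ b ∈ Q, ∀ c ∈ Q, ∃ d ∈ Q, x c * x d - y c * y d = x a * x b - y a * y b ∧
    x c * y d + y c * x d = x a * y b + y a * x b
  T : Finset (Finset Pt3)
  P : Set Pt3
  Pconv : Convex ℝ P
  vP : ∀ i, v i ∈ P
  uP : ∀ j, u j ∈ P
  QP : ∀ q ∈ Q, q ∈ P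
  OQ : ∀ i j, (h' / (h + h')) • v i + (h / (h + h')) • u j ∈ convexHull ℝ (Q : Set Pt3)
  cover : ∀ w ∈ P, ∃ σ ∈ T, w ∈ convexHull ℝ (σ : Set Pt3)
  int : ∀ i j d, ∀ᶠ ε in nhdsWithin (0 : ℝ) (Ioi 0),
    (h' / (h + h')) • v i + (h / (h + h')) • u j + ε • d ∈ P
  tet : ∀ σ ∈ T, IsTet σ
  vert : ∀ σ ∈ T, ∀ k ∈ σ, k ∈ Q ∨ (∃ i, k = v i) ∨ (∃ j, k = u j)
  meet : ∀ σ ∈ T, ∀ τ ∈ T, convexHull ℝ (σ : Set Pt3) ∩ convexHull ℝ (τ : Set Pt3)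
      = convexHull ℝ ((σ ∩ τ : Finset Pt3) : Set Pt3)

namespace Cfg
variable (c : Cfg)

/-- exchange the two edges -/
def swap : Cfg where
  x := c.y
  y := c.x
  z := -c.z
  inj a b h1 h2 h3 := c.inj a b h2 h1 (by simpa using h3)
  Q := c.Q
  v := c.u
  u := c.v
  hv := c.hu
  hu := c.hv
  h := c.h'
  h' := c.h
  hpos := c.hpos'
  hpos' := c.hpos
  zv i := by simp [c.zu i]
  xv := c.yu
  zu i := by simp [c.zv i]
  yu := c.xv
  zQ q hq := by simp [c.zQ q hq]
  circ q hq := by rw [add_comm]; exact c.circ q hq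
  negQ := c.negQ
  xinj := c.yinj
  yinj := c.xinj
  coset a ha b hb e he := by
    obtain ⟨d, hd, h1, h2⟩ := c.coset a ha b hb e he
    exact ⟨d, hd, by linarith, by linarith⟩
  T := c.T
  P := c.P
  Pconv := c.Pconv
  vP := c.uP
  uP := c.vP
  QP := c.QP
  OQ i j := by
    have := c.OQ j i
    rwa [add_comm, add_comm c.h' c.h]
  cover := c.cover
  int i j d := by
    have := c.int j i d
    rwa [add_comm c.h' c.h, add_comm ((c.h / (c.h + c.h')) • c.u i)]
  tet := c.tet
  vert σ hσ k hk := by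
    rcases c.vert σ hσ k hk with h | h | h <;> tauto
  meet := c.meet

/-- reflect the x direction -/
def negx : Cfg where
  x := -c.x
  y := c.y
  z := c.z
  inj a b h1 h2 h3 := c.inj a b (by simpa using h1) h2 h3
  Q := c.Q
  v := c.v
  u := c.u
  hv := c.hv
  hu := c.hu
  h := c.h
  h' := c.h'
  hpos := c.hpos
  hpos' := c.hpos'
  zv := c.zv
  xv i := by simp [c.xv i]
  zu := c.zu
  yu := c.yu
  zQ := c.zQ
  circ q hq := by simpa using c.circ q hq
  negQ := c.negQ
  xinj a ha b hb h := c.xinj a ha b hb (by simpa using h)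
  yinj := c.yinj
  coset a ha b hb e he := by
    obtain ⟨d, hd, h1, h2⟩ := c.coset a ha b hb e he
    refine ⟨d, hd, ?_, ?_⟩
    · simpa using h1
    · simp; linarith
  T := c.T
  P := c.P
  Pconv := c.Pconv
  vP := c.vP
  uP := c.uP
  QP := c.QP
  OQ := c.OQ
  cover := c.cover
  int := c.int
  tet := c.tet
  vert := c.vert
  meet := c.meet

/-- section point of the edge from `v i` to `u j` -/
def O (i j : Fin 2) : Pt3 := (c.h' / (c.h + c.h')) • c.v i + (c.h / (c.h + c.h')) • c.u j

/-- simplices of the triangulation -/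
def Face (S : Finset Pt3) : Prop := ∃ σ ∈ c.T, S ⊆ σ

lemma Face.mono {c : Cfg} {S S' : Finset Pt3} (h : c.Face S) (hs : S' ⊆ S) : c.Face S' := by
  obtain ⟨σ, h1, h2⟩ := h
  exact ⟨σ, h1, hs.trans h2⟩

lemma faceT {S τ : Finset Pt3} {w : Pt3} (hS : c.Face S) (hp : Pos S w) (hτ : τ ∈ c.T)
    (hw : w ∈ convexHull ℝ (τ : Set Pt3)) : S ⊆ τ := by
  obtain ⟨σ, h1, h2⟩ := hS
  have hwσ : w ∈ convexHull ℝ (σ : Set Pt3) :=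
    convexHull_mono (by exact_mod_cast h2) (pos_mem_hull hp)
  have : w ∈ convexHull ℝ ((σ ∩ τ : Finset Pt3) : Set Pt3) := by
    rw [← c.meet σ h1 τ hτ]; exact ⟨hwσ, hw⟩
  exact (pos_face (c.tet σ h1) h2 Finset.inter_subset_left hp this).trans Finset.inter_subset_right

lemma faceM {S S' : Finset Pt3} {w : Pt3} (hS : c.Face S) (hS' : c.Face S') (hp : Pos S w)
    (hp' : Pos S' w) : S = S' := by
  have key : ∀ {S S' : Finset Pt3}, c.Face S → c.Face S' → Pos S w → Pos S' w → S ⊆ S' := by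
    intro S S' hS hS' hp hp'
    obtain ⟨τ, h1, h2⟩ := hS'
    have hw : w ∈ convexHull ℝ (τ : Set Pt3) :=
      convexHull_mono (by exact_mod_cast h2) (pos_mem_hull hp')
    exact pos_face (c.tet τ h1) (c.faceT hS hp h1 hw) h2 hp (pos_mem_hull hp')
  exact Finset.Subset.antisymm (key hS hS' hp hp') (key hS' hS hp' hp)

lemma cov {S : Finset Pt3} {y0 d : Pt3} (hS : c.Face S) (hp : Pos S y0)
    (hP : ∀ᶠ ε in nhdsWithin (0 : ℝ) (Ioi 0), y0 + ε • d ∈ c.P) :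
    ∃ τ ∈ c.T, S ⊆ τ ∧ ∃ᶠ ε in nhdsWithin (0 : ℝ) (Ioi 0), y0 + ε • d ∈ convexHull ℝ (τ : Set Pt3) := by
  by_contra hcon
  push Not at hcon
  have hall : ∀ τ ∈ c.T, ∀ᶠ ε in nhdsWithin (0 : ℝ) (Ioi 0),
      y0 + ε • d ∉ convexHull ℝ (τ : Set Pt3) := by
    intro τ hτ
    by_cases hs : S ⊆ τ
    · exact hcon τ hτ hs
    · have hy : y0 ∉ convexHull ℝ (τ : Set Pt3) := fun hw => hs (c.faceT hS hp hτ hw)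
      have hcl : IsClosed (convexHull ℝ (τ : Set Pt3)) :=
        (τ.finite_toSet.isCompact_convexHull ℝ).isClosed
      have hcont : ContinuousAt (fun ε : ℝ => y0 + ε • d) 0 := by fun_prop
      have : ∀ᶠ ε in nhds (0 : ℝ), y0 + ε • d ∈ (convexHull ℝ (τ : Set Pt3))ᶜ :=
        hcont.eventually (by
          have h0 : y0 + (0 : ℝ) • d = y0 := by simp
          beta_reduce; rw [h0]; exact hcl.isOpen_compl.mem_nhds hy)
      exact nhdsWithin_le_nhds this
  have h2 := (Filter.eventually_all_finset c.T).2 hall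
  obtain ⟨ε, h3, h4⟩ := (h2.and hP).exists
  obtain ⟨σ, hσ, hm⟩ := c.cover _ h4
  exact h3 σ hσ hm

lemma hh : 0 < c.h + c.h' := add_pos c.hpos c.hpos'

lemma pos_O (i j : Fin 2) : Pos {c.v i, c.u j} (c.O i j) := by
  have := c.hh
  have h1 := pos_comb (t := c.h / (c.h + c.h')) (pos_single (c.v i)) (pos_single (c.u j))
    (div_pos c.hpos c.hh) (by rw [div_lt_one c.hh]; linarith [c.hpos'])
  have h2 : 1 - c.h / (c.h + c.h') = c.h' / (c.h + c.h') := by field_simp; ring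
  rw [h2] at h1
  exact h1

lemma zO (i j : Fin 2) : c.z (c.O i j) = 0 := by
  simp [O, c.zv, c.zu]; ring

lemma xO (i j : Fin 2) : c.x (c.O i j) = c.h / (c.h + c.h') * c.x (c.u j) := by
  simp [O, c.xv]

lemma yO (i j : Fin 2) : c.y (c.O i j) = c.h' / (c.h + c.h') * c.y (c.v i) := by
  simp [O, c.yu]

lemma vu_ne (i j : Fin 2) : c.v i ≠ c.u j := by
  intro h
  have := c.zv i
  rw [h, c.zu] at this
  linarith [c.hpos, c.hpos']

lemma vq_ne (i : Fin 2) {q : Pt3} (hq : q ∈ c.Q) : q ≠ c.v i := by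
  intro h
  have := c.zv i
  rw [← h, c.zQ q hq] at this
  linarith [c.hpos]

lemma uq_ne (j : Fin 2) {q : Pt3} (hq : q ∈ c.Q) : q ≠ c.u j := by
  intro h
  have := c.zu j
  rw [← h, c.zQ q hq] at this
  linarith [c.hpos']

lemma v_inj {i j : Fin 2} (h : c.v i = c.v j) : i = j := by
  have := c.hv
  fin_cases i <;> fin_cases j <;> simp_all [eq_comm]

lemma u_inj {i j : Fin 2} (h : c.u i = c.u j) : i = j := c.swap.v_inj h

lemma vertP {σ : Finset Pt3} (hσ : σ ∈ c.T) {k : Pt3} (hk : k ∈ σ) : k ∈ c.P := by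
  rcases c.vert σ hσ k hk with h | ⟨i, rfl⟩ | ⟨j, rfl⟩
  · exact c.QP k h
  · exact c.vP i
  · exact c.uP j

lemma disk_of_hull {w : Pt3} (hw : w ∈ convexHull ℝ (c.Q : Set Pt3)) : c.x w ^ 2 + c.y w ^ 2 ≤ 1 := by
  have hc : Convex ℝ {w : Pt3 | c.x w ^ 2 + c.y w ^ 2 ≤ 1} := by
    intro a ha b hb s t hs ht hst
    simp only [mem_ofPred_eq, map_add, map_smul, smul_eq_mul] at *
    have ht' : t = 1 - s := by linarith
    subst ht'
    nlinarith [mul_nonneg hs ht, mul_nonneg (mul_nonneg hs ht) (sq_nonneg (c.x a - c.x b)),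
      mul_nonneg (mul_nonneg hs ht) (sq_nonneg (c.y a - c.y b))]
  exact convexHull_min (fun q hq => (c.circ q hq).le) hc hw

lemma triangle {σ : Finset Pt3} (hσ : σ ∈ c.T) {i j : Fin 2} {a b : Pt3}
    (hs : {c.v i, c.u j, a} ⊆ σ) (hb' : b ∉ ({c.v i, c.u j, a} : Finset Pt3)) :
    ∃ τ ∈ c.T, {c.v i, c.u j, a} ⊆ τ ∧ b ∉ τ := by
  have hpos : Pos {c.v i, c.u j, a} ((1 - (1/2 : ℝ)) • c.O i j + (1/2 : ℝ) • a) := by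
    have := pos_comb (t := 1/2) (c.pos_O i j) (pos_single a) (by norm_num) (by norm_num)
    convert this using 1
    ext s; simp
  set y0 := (1 - (1/2 : ℝ)) • c.O i j + (1/2 : ℝ) • a with hy
  have hP : ∀ᶠ ε in nhdsWithin (0 : ℝ) (Ioi 0), y0 + ε • (y0 - b) ∈ c.P := by
    filter_upwards [c.int i j ((2 : ℝ) • (y0 - b))] with ε hε
    have ha : a ∈ c.P := c.vertP hσ (hs (by simp))
    have := c.Pconv hε ha (a := 1/2) (b := 1/2) (by norm_num) (by norm_num) (by norm_num)
    convert this using 1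
    have : (h' c / (c.h + c.h')) • c.v i + (c.h / (c.h + c.h')) • c.u j = c.O i j := rfl
    rw [this]
    generalize y0 - b = d
    rw [hy]
    module
  obtain ⟨τ, h1, h2, h3⟩ := c.cov ⟨σ, hσ, hs⟩ hpos hP
  refine ⟨τ, h1, h2, fun hbt => ?_⟩
  obtain ⟨ε, h4, h5⟩ := (h3.and_eventually self_mem_nhdsWithin).exists
  exact pos_no_push (c.tet τ h1) h2 hpos hbt hb' h5 h4

/-- midpoint of the upper edge -/
def M0 : Pt3 := (1/2 : ℝ) • c.v 0 + (1/2 : ℝ) • c.v 1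

lemma pos_M0 : Pos {c.v 0, c.v 1} c.M0 := by
  have := pos_comb (t := 1/2) (pos_single (c.v 0)) (pos_single (c.v 1)) (by norm_num) (by norm_num)
  have e : c.M0 = (1 - (1/2 : ℝ)) • c.v 0 + (1/2 : ℝ) • c.v 1 := by unfold M0; module
  rw [e]; exact this

lemma cone {S : Finset Pt3} {y0 : Pt3} (hp : Pos S y0) (κ : ℝ) :
    ∀ᶠ ε in nhdsWithin (0 : ℝ) (Ioi 0),
      Pos ({c.v 0, c.v 1} ∪ S) ((1 - ε) • c.M0 + ε • (y0 + κ • (c.v 1 - c.v 0))) := by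
  have h1 : ∀ᶠ ε in nhds (0 : ℝ), |ε * κ| < (1/2) * (1 - ε) := by
    have hc1 : ContinuousAt (fun ε : ℝ => |ε * κ|) 0 := by fun_prop
    have hc2 : ContinuousAt (fun ε : ℝ => (1/2) * (1 - ε)) 0 := by fun_prop
    exact hc1.eventually_lt hc2 (by norm_num)
  have h2 : ∀ᶠ ε in nhds (0 : ℝ), ε < 1 := eventually_lt_nhds (by norm_num)
  filter_upwards [nhdsWithin_le_nhds h1, nhdsWithin_le_nhds h2, self_mem_nhdsWithin] with ε e1 e2 e3
  have e3' : 0 < ε := e3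
  have h1ε : 0 < 1 - ε := by linarith
  set η := ε * κ / (1 - ε) with hη
  have hηε : η * (1 - ε) = ε * κ := by rw [hη]; field_simp
  rw [abs_lt] at e1
  have b1 : 0 < 1/2 + η := by
    have : 0 < (1/2 + η) * (1 - ε) := by rw [add_mul, hηε]; linarith
    exact pos_of_mul_pos_left this h1ε.le
  have b2 : 1/2 + η < 1 := by
    have : 0 < (1/2 - η) * (1 - ε) := by rw [sub_mul, hηε]; linarith
    have := pos_of_mul_pos_left this h1ε.le
    linarith
  have hp1 := pos_comb (t := 1/2 + η) (pos_single (c.v 0)) (pos_single (c.v 1)) b1 b2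
  have hp2 := pos_comb hp1 hp e3' e2
  have e : (1 - ε) • c.M0 + ε • (y0 + κ • (c.v 1 - c.v 0)) =
      (1 - ε) • ((1 - (1 / 2 + η)) • c.v 0 + (1 / 2 + η) • c.v 1) + ε • y0 := by
    rw [smul_add ε, smul_smul, ← hηε]
    unfold M0
    module
  rw [e]; exact hp2

end Cfg


lemma four_of_two {σ : Finset Pt3} (hσ : σ.card = 4) {a b : Pt3} (ha : a ∈ σ) (hb : b ∈ σ)
    (hab : a ≠ b) : ∃ e d, e ≠ d ∧ e ≠ a ∧ e ≠ b ∧ d ≠ a ∧ d ≠ b ∧ σ = {a, b, e, d} := by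
  have h1 : ({a, b} : Finset Pt3) ⊆ σ := by
    intro s; simp; rintro (rfl | rfl) <;> assumption
  have h2 : (σ \ {a, b}).card = 2 := by
    rw [Finset.card_sdiff_of_subset h1, hσ, Finset.card_pair hab]
  obtain ⟨e, d, hed, h3⟩ := Finset.card_eq_two.1 h2
  have he : e ∈ σ \ {a, b} := by rw [h3]; simp
  have hd : d ∈ σ \ {a, b} := by rw [h3]; simp
  simp only [Finset.mem_sdiff, Finset.mem_insert, Finset.mem_singleton, not_or] at he hd
  refine ⟨e, d, hed, he.2.1, he.2.2, hd.2.1, hd.2.2, ?_⟩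
  rw [← Finset.union_sdiff_of_subset h1, h3]
  ext s; simp; tauto

namespace Cfg
variable (c : Cfg)

/-- link of the upper edge -/
def K : Finset Pt3 := (c.T.biUnion id).filter (fun w => w ≠ c.v 0 ∧ w ≠ c.v 1 ∧ c.Face {c.v 0, c.v 1, w})

lemma mem_K {w : Pt3} : w ∈ c.K ↔ w ≠ c.v 0 ∧ w ≠ c.v 1 ∧ c.Face {c.v 0, c.v 1, w} := by
  unfold K
  rw [Finset.mem_filter]
  constructor
  · exact fun h => h.2
  · intro h
    refine ⟨?_, h⟩
    obtain ⟨σ, h1, h2⟩ := h.2.2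
    simp only [Finset.mem_biUnion, id]
    exact ⟨σ, h1, h2 (by simp)⟩

lemma K_vert {w : Pt3} (hw : w ∈ c.K) : w ∈ c.Q ∨ ∃ j, w = c.u j := by
  obtain ⟨h0, h1, σ, h2, h3⟩ := c.mem_K.1 hw
  rcases c.vert σ h2 w (h3 (by simp)) with h | ⟨i, hi⟩ | h
  · exact Or.inl h
  · fin_cases i
    · exact absurd hi h0
    · exact absurd hi h1
  · exact Or.inr h

lemma K_ne_v {w : Pt3} (hw : w ∈ c.K) (i : Fin 2) : w ≠ c.v i := by
  obtain ⟨h0, h1, _⟩ := c.mem_K.1 hw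
  fin_cases i <;> assumption

lemma K_z {w : Pt3} (hw : w ∈ c.K) : c.z w ≤ 0 := by
  rcases c.K_vert hw with h | ⟨j, rfl⟩
  · exact (c.zQ w h).le
  · rw [c.zu]; linarith [c.hpos']

/-- central projection from the edge to the section plane -/
def til (i : Fin 2) (k : Pt3) : Pt3 :=
  (1 - (-c.z k / (c.h - c.z k))) • k + (-c.z k / (c.h - c.z k)) • c.v i

/-- x coordinate of the projection -/
def f (k : Pt3) : ℝ := c.h * c.x k / (c.h - c.z k)

lemma f_Q {q : Pt3} (hq : q ∈ c.Q) : c.f q = c.x q := by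
  have := c.hpos
  unfold f; rw [c.zQ q hq, sub_zero, mul_div_cancel_left₀ _ this.ne']

lemma f_u (i j : Fin 2) : c.f (c.u j) = c.x (c.O i j) := by
  unfold f; rw [c.zu, c.xO]; ring

lemma til_Q (i : Fin 2) {q : Pt3} (hq : q ∈ c.Q) : c.til i q = q := by
  unfold til; rw [c.zQ q hq]; simp

lemma til_u (i j : Fin 2) : c.til i (c.u j) = c.O i j := by
  have := c.hh
  unfold til O; rw [c.zu]
  have e1 : 1 - - -c.h' / (c.h - -c.h') = c.h / (c.h + c.h') := by
    rw [sub_neg_eq_add]; field_simp; ring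
  have e2 : - -c.h' / (c.h - -c.h') = c.h' / (c.h + c.h') := by simp
  rw [e1, e2, add_comm]

lemma x_til (i : Fin 2) {k : Pt3} (hk : k ∈ c.K) : c.x (c.til i k) = c.f k := by
  have h1 := c.K_z hk
  have h2 := c.hpos
  have h3 : c.h - c.z k ≠ 0 := by linarith
  simp only [til, f, map_add, map_smul, smul_eq_mul, c.xv]
  field_simp; ring

lemma z_til (i : Fin 2) {k : Pt3} (hk : k ∈ c.K) : c.z (c.til i k) = 0 := by
  have h1 := c.K_z hk
  have h2 := c.hpos
  have h3 : c.h - c.z k ≠ 0 := by linarith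
  simp only [til, map_add, map_smul, smul_eq_mul, c.zv]
  field_simp; ring

lemma disk_til (i : Fin 2) {k : Pt3} (hk : k ∈ c.K) :
    c.x (c.til i k) ^ 2 + c.y (c.til i k) ^ 2 ≤ 1 := by
  rcases c.K_vert hk with h | ⟨j, rfl⟩
  · rw [c.til_Q i h]; exact (c.circ k h).le
  · rw [c.til_u]; exact c.disk_of_hull (c.OQ i j)

lemma pos_til (i : Fin 2) {k : Pt3} (hk : k ∈ c.K) :
    ∃ S : Finset Pt3, S ⊆ {c.v i, k} ∧ k ∈ S ∧ Pos S (c.til i k) := by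
  rcases c.K_vert hk with h | ⟨j, rfl⟩
  · exact ⟨{k}, by simp, by simp, by rw [c.til_Q i h]; exact pos_single k⟩
  · exact ⟨{c.v i, c.u j}, subset_rfl, by simp, by rw [c.til_u]; exact c.pos_O i j⟩

lemma yv_ne : c.y (c.v 1) - c.y (c.v 0) ≠ 0 := by
  intro h
  exact c.hv (c.inj _ _ (by rw [c.xv, c.xv]) (by linarith) (by rw [c.zv, c.zv]))

/-- two points in the section plane with equal x differ by a multiple of the edge direction -/
lemma eq_shift {a b : Pt3} (hx : c.x a = c.x b) (hz : c.z a = c.z b) :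
    ∃ κ : ℝ, a = b + κ • (c.v 1 - c.v 0) := by
  refine ⟨(c.y a - c.y b) / (c.y (c.v 1) - c.y (c.v 0)), c.inj _ _ ?_ ?_ ?_⟩
  · simp [c.xv, hx]
  · have := c.yv_ne
    simp only [map_add, map_smul, map_sub, smul_eq_mul]
    field_simp; ring
  · simp [c.zv, hz]

lemma cone_M {S S' : Finset Pt3} {a b : Pt3} (hp : Pos S a) (hp' : Pos S' b)
    (hS : c.Face ({c.v 0, c.v 1} ∪ S)) (hS' : c.Face ({c.v 0, c.v 1} ∪ S'))
    (hx : c.x a = c.x b) (hz : c.z a = c.z b) :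
    ({c.v 0, c.v 1} ∪ S : Finset Pt3) = {c.v 0, c.v 1} ∪ S' := by
  obtain ⟨κ, hκ⟩ := c.eq_shift hx hz
  obtain ⟨ε, h1, h2⟩ := ((c.cone hp 0).and (c.cone hp' κ)).exists
  rw [← hκ] at h2
  simp only [zero_smul, add_zero] at h1
  exact c.faceM hS hS' h1 h2

lemma union_til (i : Fin 2) {k : Pt3} {S : Finset Pt3} (h1 : S ⊆ {c.v i, k}) (h2 : k ∈ S) :
    ({c.v 0, c.v 1} ∪ S : Finset Pt3) = {c.v 0, c.v 1, k} := by
  ext s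
  simp only [Finset.mem_union, Finset.mem_insert, Finset.mem_singleton]
  constructor
  · rintro (h | h)
    · tauto
    · have := h1 h
      simp only [Finset.mem_insert, Finset.mem_singleton] at this
      fin_cases i <;> simp at this <;> tauto
  · rintro (h | h | rfl) <;> tauto

lemma L1 {a b : Pt3} (ha : a ∈ c.K) (hb : b ∈ c.K) (h : c.f a = c.f b) : a = b := by
  obtain ⟨S, s1, s2, s3⟩ := c.pos_til 0 ha
  obtain ⟨S', s1', s2', s3'⟩ := c.pos_til 0 hb
  have e1 := c.union_til 0 s1 s2
  have e2 := c.union_til 0 s1' s2'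
  have := c.cone_M s3 s3' (by rw [e1]; exact (c.mem_K.1 ha).2.2)
    (by rw [e2]; exact (c.mem_K.1 hb).2.2) (by rw [c.x_til 0 ha, c.x_til 0 hb, h])
    (by rw [c.z_til 0 ha, c.z_til 0 hb])
  rw [e1, e2] at this
  have h3 : a ∈ ({c.v 0, c.v 1, b} : Finset Pt3) := by rw [← this]; simp
  simp only [Finset.mem_insert, Finset.mem_singleton] at h3
  rcases h3 with h3 | h3 | h3
  · exact absurd h3 (c.K_ne_v ha 0)
  · exact absurd h3 (c.K_ne_v ha 1)
  · exact h3

lemma seg_param {p q r : ℝ} (h1 : p < q) (h2 : q < r) : ∃ t, 0 < t ∧ t < 1 ∧ (1 - t) * p + t * r = q := by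
  have : 0 < r - p := by linarith
  refine ⟨(q - p) / (r - p), div_pos (by linarith) this, ?_, ?_⟩
  · rw [div_lt_one this]; linarith
  · field_simp; ring

lemma L3 {a b k : Pt3} (ha : a ∈ c.K) (hb : b ∈ c.K) (hk : k ∈ c.K)
    (hF : c.Face {c.v 0, c.v 1, a, b}) (h1 : c.f a < c.f k) (h2 : c.f k < c.f b) : False := by
  obtain ⟨S, s1, s2, s3⟩ := c.pos_til 0 ha
  obtain ⟨S', s1', s2', s3'⟩ := c.pos_til 0 hb
  obtain ⟨R, r1, r2, r3⟩ := c.pos_til 0 hk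
  obtain ⟨t, t0, t1, ht⟩ := seg_param h1 h2
  have hp := pos_comb s3 s3' t0 t1
  have e1 := c.union_til 0 s1 s2
  have e2 := c.union_til 0 s1' s2'
  have e3 := c.union_til 0 r1 r2
  have e4 : ({c.v 0, c.v 1} ∪ (S ∪ S') : Finset Pt3) = {c.v 0, c.v 1, a, b} := by
    rw [Finset.union_union_distrib_left, e1, e2]
    ext s; simp
  have := c.cone_M hp r3 (by rw [e4]; exact hF)
    (by rw [e3]; exact (c.mem_K.1 hk).2.2)
    (by simp only [map_add, map_smul, smul_eq_mul, c.x_til 0 ha, c.x_til 0 hb, c.x_til 0 hk, ht])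
    (by simp only [map_add, map_smul, smul_eq_mul, c.z_til 0 ha, c.z_til 0 hb, c.z_til 0 hk]; ring)
  rw [e4, e3] at this
  have h3 : a ∈ ({c.v 0, c.v 1, k} : Finset Pt3) := by rw [← this]; simp
  simp only [Finset.mem_insert, Finset.mem_singleton] at h3
  rcases h3 with h3 | h3 | h3
  · exact absurd h3 (c.K_ne_v ha 0)
  · exact absurd h3 (c.K_ne_v ha 1)
  · subst h3; exact lt_irrefl _ h1

lemma tilP (i : Fin 2) {k : Pt3} (hk : k ∈ c.K) : c.til i k ∈ c.P := by
  rcases c.K_vert hk with h | ⟨j, rfl⟩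
  · rw [c.til_Q i h]; exact c.QP k h
  · rw [c.til_u]
    have := c.hh
    exact c.Pconv (c.vP i) (c.uP j) (div_pos c.hpos' c.hh).le (div_pos c.hpos c.hh).le
      (by field_simp; ring)

lemma L2 {a b : Pt3} (ha : a ∈ c.K) (hb : b ∈ c.K) (hab : c.f a < c.f b)
    (hn : ∀ k ∈ c.K, ¬ (c.f a < c.f k ∧ c.f k < c.f b)) : c.Face {c.v 0, c.v 1, a, b} := by
  have hpos := c.hpos
  set y0 := (1/2 : ℝ) • c.til 0 a + (1/2 : ℝ) • c.til 0 b with hy0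
  have hyP : y0 ∈ c.P := c.Pconv (c.tilP 0 ha) (c.tilP 0 hb) (by norm_num) (by norm_num) (by norm_num)
  have hxy : c.x y0 = (c.f a + c.f b) / 2 := by
    simp only [hy0, map_add, map_smul, smul_eq_mul, c.x_til 0 ha, c.x_til 0 hb]; ring
  have hzy : c.z y0 = 0 := by
    simp only [hy0, map_add, map_smul, smul_eq_mul, c.z_til 0 ha, c.z_til 0 hb]; ring
  have hMP : c.M0 ∈ c.P := c.Pconv (c.vP 0) (c.vP 1) (by norm_num) (by norm_num) (by norm_num)
  have hP : ∀ᶠ ε in nhdsWithin (0 : ℝ) (Ioi 0), c.M0 + ε • (y0 - c.M0) ∈ c.P := by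
    have h2 : ∀ᶠ ε in nhds (0 : ℝ), ε < 1 := eventually_lt_nhds (by norm_num)
    filter_upwards [nhdsWithin_le_nhds h2, self_mem_nhdsWithin] with ε e2 e3
    have e3' : 0 < ε := e3
    have := c.Pconv hMP hyP (a := 1 - ε) (b := ε) (by linarith) e3'.le (by ring)
    convert this using 1
    module
  have hF2 : c.Face {c.v 0, c.v 1} := (c.mem_K.1 ha).2.2.mono (by intro s; simp; tauto)
  obtain ⟨τ, h1, h2, h3⟩ := c.cov hF2 c.pos_M0 hP
  obtain ⟨ε, h5, h4⟩ := (h3.and_eventually self_mem_nhdsWithin).exists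
  have hε : 0 < ε := h4
  obtain ⟨e, d, hed, e0, e1, d0, d1, hτ⟩ := four_of_two (c.tet τ h1).1 (h2 (by simp : c.v 0 ∈ _))
    (h2 (by simp : c.v 1 ∈ _)) c.hv
  have heK : e ∈ c.K := c.mem_K.2 ⟨e0, e1, τ, h1, by rw [hτ]; intro s; simp; tauto⟩
  have hdK : d ∈ c.K := c.mem_K.2 ⟨d0, d1, τ, h1, by rw [hτ]; intro s; simp; tauto⟩
  rw [Finset.mem_convexHull'] at h5
  obtain ⟨w, w0, w1, w2⟩ := h5
  rw [hτ] at w0 w1 w2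
  have n1 : c.v 0 ∉ ({c.v 1, e, d} : Finset Pt3) := by
    simp only [Finset.mem_insert, Finset.mem_singleton, not_or]; exact ⟨c.hv, e0.symm, d0.symm⟩
  have n2 : c.v 1 ∉ ({e, d} : Finset Pt3) := by
    simp only [Finset.mem_insert, Finset.mem_singleton, not_or]; exact ⟨e1.symm, d1.symm⟩
  have n3 : e ∉ ({d} : Finset Pt3) := by simpa using hed
  rw [Finset.sum_insert n1, Finset.sum_insert n2, Finset.sum_insert n3, Finset.sum_singleton] at w1 w2
  have we := w0 e (by simp)
  have wd := w0 d (by simp)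
  have X := congrArg c.x w2
  have Z := congrArg c.z w2
  have hM0x : c.x c.M0 = 0 := by simp [M0, c.xv]
  have hM0z : c.z c.M0 = c.h := by simp [M0, c.zv]; ring
  simp only [map_add, map_smul, smul_eq_mul, map_sub, c.xv, c.zv, hM0x, hM0z, hxy, hzy] at X Z
  set t := (c.f a + c.f b) / 2 with ht
  have hze := c.K_z heK
  have hzd := c.K_z hdK
  have fe : c.h * c.x e = c.f e * (c.h - c.z e) := by
    have : c.h - c.z e ≠ 0 := by linarith
    unfold f; field_simp
  have fd : c.h * c.x d = c.f d * (c.h - c.z d) := by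
    have : c.h - c.z d ≠ 0 := by linarith
    unfold f; field_simp
  set A := w e * (c.h - c.z e) with hA
  set B := w d * (c.h - c.z d) with hB
  have A0 : 0 ≤ A := mul_nonneg we (by linarith)
  have B0 : 0 ≤ B := mul_nonneg wd (by linarith)
  have hAB : A + B = ε * c.h := by
    have : w (c.v 0) + w (c.v 1) = 1 - w e - w d := by linarith
    linear_combination c.h * w1 - Z
  have hABf : A * c.f e + B * c.f d = (A + B) * t := by
    rw [hAB]
    linear_combination c.h * X - w e * fe - w d * fd
  have hABp : 0 < A + B := by rw [hAB]; positivity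
  have key : ∀ k ∈ c.K, c.f k ≠ t := by
    intro k hk hh
    exact hn k hk ⟨by rw [hh, ht]; linarith, by rw [hh, ht]; linarith⟩
  have hAp : 0 < A := by
    rcases A0.lt_or_eq with h | h
    · exact h
    · exfalso
      rw [← h] at hABf hABp
      refine key d hdK ?_
      have : B ≠ 0 := by linarith
      apply mul_left_cancel₀ this; linarith
  have hBp : 0 < B := by
    rcases B0.lt_or_eq with h | h
    · exact h
    · exfalso
      rw [← h] at hABf hABp
      refine key e heK ?_
      have : A ≠ 0 := by linarith
      apply mul_left_cancel₀ this; linarith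
  have hfin : ∀ p q : Pt3, p ∈ c.K → q ∈ c.K → c.Face {c.v 0, c.v 1, p, q} → c.f p < t → t < c.f q →
      c.Face {c.v 0, c.v 1, a, b} := by
    intro p q hp hq hF h1 h2
    have i1 : c.f p ≤ c.f a := by
      by_contra hh; push Not at hh
      exact hn p hp ⟨hh, by linarith⟩
    have i2 : c.f b ≤ c.f q := by
      by_contra hh; push Not at hh
      exact hn q hq ⟨by linarith, hh⟩
    have j1 : c.f p = c.f a := by
      by_contra hh
      exact c.L3 hp hq ha hF (lt_of_le_of_ne i1 hh) (by linarith)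
    have j2 : c.f q = c.f b := by
      by_contra hh
      exact c.L3 hp hq hb hF (by linarith) (lt_of_le_of_ne i2 (Ne.symm hh))
    rw [← c.L1 hp ha j1, ← c.L1 hq hb j2]; exact hF
  rcases lt_or_gt_of_ne (key e heK) with hlt | hgt
  · refine hfin e d heK hdK ⟨τ, h1, by rw [hτ]⟩ hlt ?_
    by_contra hh; push Not at hh
    nlinarith [mul_pos hAp (sub_pos.2 hlt), mul_nonneg B0 (sub_nonneg.2 hh)]
  · refine hfin d e hdK heK ⟨τ, h1, by rw [hτ]; intro s; simp; tauto⟩ ?_ hgt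
    by_contra hh; push Not at hh
    nlinarith [mul_pos hAp (sub_pos.2 hgt), mul_nonneg B0 (sub_nonneg.2 hh)]

end Cfg


namespace Cfg
variable (c : Cfg)

/-- x-coordinate of section points -/
def X (j : Fin 2) : ℝ := c.h / (c.h + c.h') * c.x (c.u j)
/-- y-coordinate of section points -/
def Y (i : Fin 2) : ℝ := c.h' / (c.h + c.h') * c.y (c.v i)

lemma xO' (i j : Fin 2) : c.x (c.O i j) = c.X j := c.xO i j
lemma yO' (i j : Fin 2) : c.y (c.O i j) = c.Y i := c.yO i j
lemma fu (j : Fin 2) : c.f (c.u j) = c.X j := by rw [c.f_u 0 j, c.xO']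
lemma swap_X (j : Fin 2) : c.swap.X j = c.Y j := by
  simp only [X, Y, swap]; rw [add_comm]
lemma swap_Y (j : Fin 2) : c.swap.Y j = c.X j := by
  simp only [X, Y, swap]; rw [add_comm]
lemma swap_O (i j : Fin 2) : c.swap.O j i = c.O i j := by
  simp only [O, swap]; rw [add_comm, add_comm c.h]

lemma yQ_ne {q : Pt3} (hq : q ∈ c.Q) : c.y q ≠ 0 := by
  intro h
  have h1 := c.yinj q hq (-q) (c.negQ q hq) (by rw [map_neg, h, neg_zero])
  have h2 : q = 0 := self_eq_neg.1 h1
  have := c.circ q hq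
  rw [h2] at this; simp at this

lemma xQ_ne {q : Pt3} (hq : q ∈ c.Q) : c.x q ≠ 0 := c.swap.yQ_ne hq

lemma link_count (hK : c.K.Nonempty) :
    (c.T.filter (fun σ => c.v 0 ∈ σ ∧ c.v 1 ∈ σ)).card + 1 ≤ c.K.card := by
  obtain ⟨M, hM, hmax⟩ := Finset.exists_max_image c.K c.f hK
  have h1 : (c.T.filter (fun σ => c.v 0 ∈ σ ∧ c.v 1 ∈ σ)).card ≤ (c.K.erase M).card := by
    refine Finset.card_le_card_of_forall_subsingleton
      (fun σ e => ∃ d ∈ c.K, c.f e < c.f d ∧ σ = {c.v 0, c.v 1, e, d}) ?_ ?_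
    · intro τ hτ'
      rw [Finset.mem_filter] at hτ'
      obtain ⟨h1, hv0, hv1⟩ := hτ'
      obtain ⟨e, d, hed, e0, e1, d0, d1, hτ⟩ := four_of_two (c.tet τ h1).1 hv0 hv1 c.hv
      have heK : e ∈ c.K := c.mem_K.2 ⟨e0, e1, τ, h1, by rw [hτ]; intro s; simp; tauto⟩
      have hdK : d ∈ c.K := c.mem_K.2 ⟨d0, d1, τ, h1, by rw [hτ]; intro s; simp; tauto⟩
      rcases lt_trichotomy (c.f e) (c.f d) with h | h | h
      · refine ⟨e, Finset.mem_erase.2 ⟨?_, heK⟩, d, hdK, h, hτ⟩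
        rintro rfl
        linarith [hmax d hdK]
      · exact absurd (c.L1 heK hdK h) hed
      · refine ⟨d, Finset.mem_erase.2 ⟨?_, hdK⟩, e, heK, h, ?_⟩
        · rintro rfl
          linarith [hmax e heK]
        · rw [hτ]; ext s; simp; tauto
    · intro e he σ hσ τ hτ
      have heK := (Finset.mem_erase.1 he).2
      obtain ⟨hσ1, d, hd, h1, h2⟩ := hσ
      obtain ⟨hτ1, d', hd', h1', h2'⟩ := hτ
      have hσT := (Finset.mem_filter.1 hσ1).1
      have hτT := (Finset.mem_filter.1 hτ1).1
      have : d = d' := by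
        rcases lt_trichotomy (c.f d) (c.f d') with h | h | h
        · exact (c.L3 heK hd' hd ⟨τ, hτT, by rw [h2']⟩ h1 h).elim
        · exact c.L1 hd hd' h
        · exact (c.L3 heK hd hd' ⟨σ, hσT, by rw [h2]⟩ h1' h).elim
      rw [h2, h2', this]
  rw [Finset.card_erase_of_mem hM] at h1
  have := Finset.card_pos.2 hK
  omega

lemma ivt_aux (i : Fin 2) {a b : Pt3} (ha : a ∈ c.K) (haQ : a ∈ c.Q) (hb : b ∈ c.K) (hbQ : b ∈ c.Q)
    (hab : c.x a < c.x b) (α β γ : ℝ) (hla : α * c.x a + β * c.y a + γ < 0)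
    (hlb : 0 < α * c.x b + β * c.y b + γ) :
    ∃ S w, c.Face S ∧ Pos S w ∧ c.z w = 0 ∧ α * c.x w + β * c.y w + γ = 0 ∧ c.x a ≤ c.x w ∧
      c.x w ≤ c.x b ∧ c.x w ^ 2 + c.y w ^ 2 ≤ 1 ∧
      ∀ k ∈ S, k = c.v i ∨ (k ∈ c.K ∧ c.x a ≤ c.f k ∧ c.f k ≤ c.x b) := by
  set ℓ : Pt3 → ℝ := fun w => α * c.x w + β * c.y w + γ with hℓ
  obtain ⟨k', hk'1, hk'2⟩ := Finset.exists_min_image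
    (c.K.filter (fun k => c.x a ≤ c.f k ∧ c.f k ≤ c.x b ∧ 0 ≤ ℓ (c.til i k))) c.f
    ⟨b, by
      rw [Finset.mem_filter, c.f_Q hbQ, c.til_Q i hbQ]
      exact ⟨hb, hab.le, le_rfl, hlb.le⟩⟩
  obtain ⟨hk'K, k'a, k'b, k'l⟩ := Finset.mem_filter.1 hk'1
  have hak' : c.x a < c.f k' := by
    refine lt_of_le_of_ne k'a (fun h => ?_)
    have : a = k' := c.L1 ha hk'K (by rw [c.f_Q haQ, h])
    rw [← this, c.til_Q i haQ] at k'l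
    linarith
  obtain ⟨k, hk1, hk2⟩ := Finset.exists_max_image
    (c.K.filter (fun k => c.x a ≤ c.f k ∧ c.f k < c.f k')) c.f
    ⟨a, by
      rw [Finset.mem_filter, c.f_Q haQ]
      exact ⟨ha, le_rfl, hak'⟩⟩
  obtain ⟨hkK, ka, kk'⟩ := Finset.mem_filter.1 hk1
  have hkl : ℓ (c.til i k) < 0 := by
    by_contra h
    push Not at h
    have := hk'2 k (Finset.mem_filter.2 ⟨hkK, ka, by linarith, h⟩)
    linarith
  have hF : c.Face {c.v 0, c.v 1, k, k'} := by
    refine c.L2 hkK hk'K kk' ?_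
    intro e he hh
    have := hk2 e (Finset.mem_filter.2 ⟨he, by linarith [hh.1], hh.2⟩)
    linarith [hh.1]
  obtain ⟨S, s1, s2, s3⟩ := c.pos_til i hkK
  obtain ⟨S', s1', s2', s3'⟩ := c.pos_til i hk'K
  have hvi : c.v i = c.v 0 ∨ c.v i = c.v 1 := by fin_cases i <;> simp
  have hS : S ⊆ {c.v 0, c.v 1, k, k'} := by
    intro s hs
    have := s1 hs
    simp only [Finset.mem_insert, Finset.mem_singleton] at this ⊢
    rcases this with h | h
    · rw [h]; tauto
    · tauto
  have hS' : S' ⊆ {c.v 0, c.v 1, k, k'} := by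
    intro s hs
    have := s1' hs
    simp only [Finset.mem_insert, Finset.mem_singleton] at this ⊢
    rcases this with h | h
    · rw [h]; tauto
    · tauto
  have hmS : ∀ s ∈ S, s = c.v i ∨ (s ∈ c.K ∧ c.x a ≤ c.f s ∧ c.f s ≤ c.x b) := by
    intro s hs
    have := s1 hs
    simp only [Finset.mem_insert, Finset.mem_singleton] at this
    rcases this with h | rfl
    · exact Or.inl h
    · exact Or.inr ⟨hkK, ka, by linarith⟩
  have hmS' : ∀ s ∈ S', s = c.v i ∨ (s ∈ c.K ∧ c.x a ≤ c.f s ∧ c.f s ≤ c.x b) := by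
    intro s hs
    have := s1' hs
    simp only [Finset.mem_insert, Finset.mem_singleton] at this
    rcases this with h | rfl
    · exact Or.inl h
    · exact Or.inr ⟨hk'K, k'a, k'b⟩
  rcases k'l.eq_or_lt with h0 | h0
  · exact ⟨S', c.til i k', hF.mono hS', s3', c.z_til i hk'K, h0.symm, by rw [c.x_til i hk'K]; exact k'a,
      by rw [c.x_til i hk'K]; exact k'b, c.disk_til i hk'K, hmS'⟩
  · obtain ⟨t, t0, t1, ht⟩ := seg_param hkl h0
    refine ⟨S ∪ S', (1 - t) • c.til i k + t • c.til i k', hF.mono (Finset.union_subset hS hS'),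
      pos_comb s3 s3' t0 t1, ?_, ?_, ?_, ?_, ?_, ?_⟩
    · simp [c.z_til i hkK, c.z_til i hk'K]
    · simp only [hℓ] at ht
      simp only [map_add, map_smul, smul_eq_mul]
      linear_combination ht
    · simp only [map_add, map_smul, smul_eq_mul, c.x_til i hkK, c.x_til i hk'K]
      nlinarith
    · simp only [map_add, map_smul, smul_eq_mul, c.x_til i hkK, c.x_til i hk'K]
      nlinarith
    · have d1 := c.disk_til i hkK
      have d2 := c.disk_til i hk'K
      simp only [map_add, map_smul, smul_eq_mul]
      have hst := mul_nonneg (sub_nonneg.2 t1.le) t0.le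
      nlinarith [mul_nonneg hst (sq_nonneg (c.x (c.til i k) - c.x (c.til i k'))),
        mul_nonneg hst (sq_nonneg (c.y (c.til i k) - c.y (c.til i k'))),
        mul_le_mul_of_nonneg_left d1 (sub_nonneg.2 t1.le), mul_le_mul_of_nonneg_left d2 t0.le]
    · intro s hs
      rcases Finset.mem_union.1 hs with h | h
      · exact hmS s h
      · exact hmS' s h

lemma ivt (i : Fin 2) {a b : Pt3} (ha : a ∈ c.K) (haQ : a ∈ c.Q) (hb : b ∈ c.K) (hbQ : b ∈ c.Q)
    (hab : c.x a < c.x b) (α β γ : ℝ)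
    (hl : (α * c.x a + β * c.y a + γ) * (α * c.x b + β * c.y b + γ) < 0) :
    ∃ S w, c.Face S ∧ Pos S w ∧ c.z w = 0 ∧ α * c.x w + β * c.y w + γ = 0 ∧ c.x a ≤ c.x w ∧
      c.x w ≤ c.x b ∧ c.x w ^ 2 + c.y w ^ 2 ≤ 1 ∧
      ∀ k ∈ S, k = c.v i ∨ (k ∈ c.K ∧ c.x a ≤ c.f k ∧ c.f k ≤ c.x b) := by
  rcases mul_neg_iff.1 hl with ⟨h1, h2⟩ | ⟨h1, h2⟩
  · obtain ⟨S, w, e1, e2, e3, e4, e5⟩ := c.ivt_aux i ha haQ hb hbQ hab (-α) (-β) (-γ) (by linarith)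
      (by linarith)
    exact ⟨S, w, e1, e2, e3, by linarith, e5⟩
  · exact c.ivt_aux i ha haQ hb hbQ hab α β γ h1 h2

lemma Z {i j : Fin 2} {a b d : Pt3} (ha : a ∈ c.K) (haQ : a ∈ c.Q) (hb : b ∈ c.K) (hbQ : b ∈ c.Q)
    (hab : c.x a < c.x b) (hd : d ∈ c.Q) (hF : c.Face {c.u 0, c.u 1, d, c.v i})
    (hside : (c.X j < c.x a ∧ c.X j < c.x d) ∨ (c.x b < c.X j ∧ c.x d < c.X j))
    (hl : ((c.x a - c.X j) * (c.y d - c.Y i) - (c.y a - c.Y i) * (c.x d - c.X j)) *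
      ((c.x b - c.X j) * (c.y d - c.Y i) - (c.y b - c.Y i) * (c.x d - c.X j)) < 0) :
    d ∈ c.K ∧ c.x a ≤ c.x d ∧ c.x d ≤ c.x b := by
  obtain ⟨S, w, hS, hp, hz, hlw, xa, xb, hdisk, hm⟩ := c.ivt i ha haQ hb hbQ hab (c.y d - c.Y i)
    (-(c.x d - c.X j)) (- c.X j * (c.y d - c.Y i) + c.Y i * (c.x d - c.X j)) (by
      convert hl using 1; ring)
  have hne : c.x d - c.X j ≠ 0 := by
    rcases hside with h | h
    · linarith [h.2]
    · linarith [h.2]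
  obtain ⟨t, ht⟩ : ∃ t, c.x w - c.X j = t * (c.x d - c.X j) :=
    ⟨(c.x w - c.X j) / (c.x d - c.X j), by field_simp⟩
  have ht0 : 0 < t := by
    rcases hside with h | h
    · have : 0 < t * (c.x d - c.X j) := by rw [← ht]; linarith [h.1]
      exact pos_of_mul_pos_left this (by linarith [h.2])
    · have : 0 < t * (c.X j - c.x d) := by
        have : t * (c.X j - c.x d) = c.X j - c.x w := by linarith
        rw [this]; linarith [h.1]
      exact pos_of_mul_pos_left this (by linarith [h.2])
  have hty : c.y w - c.Y i = t * (c.y d - c.Y i) := by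
    apply mul_left_cancel₀ hne
    linear_combination (-1) * hlw + (c.y d - c.Y i) * ht
  have hw : w = (1 - t) • c.O i j + t • d := by
    apply c.inj
    · simp only [map_add, map_smul, smul_eq_mul, c.xO']; linarith
    · simp only [map_add, map_smul, smul_eq_mul, c.yO']; linarith
    · simp only [map_add, map_smul, smul_eq_mul, c.zO, hz, c.zQ d hd]; ring
  have hO := c.disk_of_hull (c.OQ i j)
  change c.x (c.O i j) ^ 2 + c.y (c.O i j) ^ 2 ≤ 1 at hO
  rw [c.xO', c.yO'] at hO
  have hcd := c.circ d hd
  have ht1 : t ≤ 1 := by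
    by_contra h
    push Not at h
    have e1 : c.x w = c.X j + t * (c.x d - c.X j) := by linarith
    have e2 : c.y w = c.Y i + t * (c.y d - c.Y i) := by linarith
    rw [e1, e2] at hdisk
    have hsq : 0 < (c.x d - c.X j) ^ 2 := by positivity
    nlinarith [mul_pos (mul_pos (sub_pos.2 h) ht0) hsq,
      mul_nonneg (mul_nonneg (sub_pos.2 h).le ht0.le) (sq_nonneg (c.y d - c.Y i)),
      mul_le_mul_of_nonneg_left hO (sub_pos.2 h).le]
  obtain ⟨S', hd', hS', hp'⟩ : ∃ S' : Finset Pt3, d ∈ S' ∧ S' ⊆ {c.u 0, c.u 1, d, c.v i} ∧ Pos S' w := by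
    rcases ht1.eq_or_lt with h | h
    · refine ⟨{d}, by simp, by intro s; simp; tauto, ?_⟩
      rw [hw, h]; simpa using pos_single d
    · refine ⟨{c.v i, c.u j} ∪ {d}, by simp, ?_, ?_⟩
      · intro s
        have hj : c.u j = c.u 0 ∨ c.u j = c.u 1 := by fin_cases j <;> simp
        simp only [Finset.mem_union, Finset.mem_insert, Finset.mem_singleton]
        rintro ((h | h) | h)
        · tauto
        · rw [h]; tauto
        · tauto
      · rw [hw]; exact pos_comb (c.pos_O i j) (pos_single d) ht0 h
  have hSS := c.faceM hS (hF.mono hS') hp hp'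
  rw [← hSS] at hd'
  rcases hm d hd' with h | ⟨h1, h2, h3⟩
  · exact absurd h (c.vq_ne i hd)
  · rw [c.f_Q hd] at h2 h3; exact ⟨h1, h2, h3⟩

/-- a direct edge cannot be crossed -/
lemma Z0 {a b c1 c2 : Pt3} (ha : a ∈ c.swap.K) (haQ : a ∈ c.Q) (hb : b ∈ c.swap.K) (hbQ : b ∈ c.Q)
    (hab : c.y a < c.y b) (h1Q : c1 ∈ c.Q) (h2Q : c2 ∈ c.Q) (hF : c.Face {c1, c2})
    (h1 : c.y c1 < c.y a) (h2 : c.y b < c.y c2)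
    (hl : ((c.x a - c.x c1) * (c.y c2 - c.y c1) - (c.y a - c.y c1) * (c.x c2 - c.x c1)) *
      ((c.x b - c.x c1) * (c.y c2 - c.y c1) - (c.y b - c.y c1) * (c.x c2 - c.x c1)) < 0) : False := by
  obtain ⟨S, w, hS, hp, hz, hlw, ya, yb, hdisk, hm⟩ := c.swap.ivt 0 ha haQ hb hbQ hab
    (-(c.x c2 - c.x c1)) (c.y c2 - c.y c1)
    (c.y c1 * (c.x c2 - c.x c1) - c.x c1 * (c.y c2 - c.y c1)) (by
      convert hl using 1
      simp only [swap]; ring)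
  simp only [swap] at hz hlw ya yb hdisk
  have hz' : c.z w = 0 := by simpa using hz
  obtain ⟨t, t0, t1, ht⟩ := seg_param (p := c.y c1) (q := c.y w) (r := c.y c2) (by linarith) (by linarith)
  have hw : w = (1 - t) • c1 + t • c2 := by
    apply c.inj
    · simp only [map_add, map_smul, smul_eq_mul]
      have : c.y c2 - c.y c1 ≠ 0 := by linarith
      apply mul_left_cancel₀ this
      linear_combination hlw - (c.x c2 - c.x c1) * ht
    · simp only [map_add, map_smul, smul_eq_mul]; linarith
    · simp [hz', c.zQ c1 h1Q, c.zQ c2 h2Q]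
  have hp' : Pos {c1, c2} w := by rw [hw]; exact pos_comb (pos_single c1) (pos_single c2) t0 t1
  have hSS := c.faceM hS hF hp hp'
  have hc1 : c1 ∈ S := by rw [hSS]; simp
  rcases hm c1 hc1 with h | ⟨_, h3, h4⟩
  · exact absurd h (c.uq_ne 0 h1Q)
  · have : c.swap.f c1 = c.y c1 := c.swap.f_Q h1Q
    rw [this] at h3
    have h3' : c.y a ≤ c.y c1 := h3
    linarith

lemma S1 {p q : Pt3} (hp : p ∈ c.K) (hpQ : p ∈ c.Q) (hq : q ∈ c.K) (hqQ : q ∈ c.Q)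
    (hpq : c.x p < c.x q) (hy : c.y p * c.y q < 0) :
    ∃ c1 c2, c1 ∈ c.K ∧ c1 ∈ c.Q ∧ c2 ∈ c.K ∧ c2 ∈ c.Q ∧ c.x p ≤ c.x c1 ∧ c.x c1 < c.x c2 ∧
      c.x c2 ≤ c.x q ∧ c.y c1 * c.y c2 < 0 ∧
      (∀ k ∈ c.K, k ∈ c.Q → c.x k ≤ c.x c1 ∨ c.x c2 ≤ c.x k) ∧
      (c.Face {c1, c2} ∨ ∃ j j', c.Face {c.v 0, c.v 1, c1, c.u j} ∧
        c.Face {c.v 0, c.v 1, c2, c.u j'} ∧ c.u j ∈ c.K ∧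
        c.x c1 < c.X j ∧ c.X j ≤ c.X j' ∧ c.X j' < c.x c2) := by
  obtain ⟨c2, hc2, hc2m⟩ := Finset.exists_min_image
    (c.K.filter (fun k => k ∈ c.Q ∧ c.x p ≤ c.x k ∧ c.x k ≤ c.x q ∧ c.y p * c.y k < 0)) c.x
    ⟨q, Finset.mem_filter.2 ⟨hq, hqQ, hpq.le, le_rfl, hy⟩⟩
  obtain ⟨c2K, c2Q, pc2, c2q, yc2⟩ := Finset.mem_filter.1 hc2
  have pc2' : c.x p < c.x c2 := by
    refine lt_of_le_of_ne pc2 (fun h => ?_)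
    have := c.xinj _ hpQ _ c2Q h
    rw [← this] at yc2
    nlinarith [sq_nonneg (c.y p)]
  obtain ⟨c1, hc1, hc1m⟩ := Finset.exists_max_image
    (c.K.filter (fun k => k ∈ c.Q ∧ c.x p ≤ c.x k ∧ c.x k < c.x c2)) c.x
    ⟨p, Finset.mem_filter.2 ⟨hp, hpQ, le_rfl, pc2'⟩⟩
  obtain ⟨c1K, c1Q, pc1, c12⟩ := Finset.mem_filter.1 hc1
  have yp := c.yQ_ne hpQ
  have yc1 : 0 < c.y p * c.y c1 := by
    have hne : c.y p * c.y c1 ≠ 0 := mul_ne_zero yp (c.yQ_ne c1Q)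
    by_contra h
    push Not at h
    have := hc2m c1 (Finset.mem_filter.2 ⟨c1K, c1Q, pc1, by linarith, lt_of_le_of_ne h hne⟩)
    linarith
  have hbet : ∀ k ∈ c.K, k ∈ c.Q → c.x k ≤ c.x c1 ∨ c.x c2 ≤ c.x k := by
    intro k hk hkQ
    by_contra h
    push Not at h
    have := hc1m k (Finset.mem_filter.2 ⟨hk, hkQ, by linarith [h.1], h.2⟩)
    linarith [h.1]
  refine ⟨c1, c2, c1K, c1Q, c2K, c2Q, pc1, c12, c2q, ?_, hbet, ?_⟩
  · have h3 : 0 < c.y p ^ 2 := by positivity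
    have h4 : c.y p ^ 2 * (c.y c1 * c.y c2) < 0 := by
      have := mul_neg_of_pos_of_neg yc1 yc2
      nlinarith
    by_contra h
    push Not at h
    have := mul_nonneg h3.le h
    linarith
  · by_cases hU : (c.K.filter (fun k => c.x c1 < c.f k ∧ c.f k < c.x c2)).Nonempty
    · right
      have hu : ∀ k ∈ c.K.filter (fun k => c.x c1 < c.f k ∧ c.f k < c.x c2), ∃ j, k = c.u j := by
        intro k hk
        obtain ⟨k1, k2, k3⟩ := Finset.mem_filter.1 hk
        rcases c.K_vert k1 with h | h
        · rw [c.f_Q h] at k2 k3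
          rcases hbet k k1 h with h | h <;> linarith
        · exact h
      obtain ⟨k, hk, hkm⟩ := Finset.exists_min_image _ c.f hU
      obtain ⟨k', hk', hkm'⟩ := Finset.exists_max_image _ c.f hU
      obtain ⟨j, rfl⟩ := hu k hk
      obtain ⟨j', rfl⟩ := hu k' hk'
      obtain ⟨k1, k2, k3⟩ := Finset.mem_filter.1 hk
      obtain ⟨k1', k2', k3'⟩ := Finset.mem_filter.1 hk'
      refine ⟨j, j', ?_, ?_, k1, by rw [← c.fu]; exact k2, by rw [← c.fu, ← c.fu]; exact hkm _ hk',
        by rw [← c.fu]; exact k3'⟩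
      · refine c.L2 c1K k1 (by rw [c.f_Q c1Q]; exact k2) ?_
        intro e he hh
        rw [c.f_Q c1Q] at hh
        have := hkm e (Finset.mem_filter.2 ⟨he, hh.1, by linarith [hh.2]⟩)
        linarith [hh.2]
      · have := c.L2 k1' c2K (by rw [c.f_Q c2Q]; exact k3') (by
          intro e he hh
          rw [c.f_Q c2Q] at hh
          have := hkm' e (Finset.mem_filter.2 ⟨he, by linarith [hh.1], hh.2⟩)
          linarith [hh.1])
        exact this.mono (by intro s; simp; tauto)
    · left
      refine (c.L2 c1K c2K (by rw [c.f_Q c1Q, c.f_Q c2Q]; exact c12) ?_).mono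
        (by intro s; simp; tauto)
      intro k hk hh
      rw [c.f_Q c1Q, c.f_Q c2Q] at hh
      exact hU ⟨k, Finset.mem_filter.2 ⟨hk, hh⟩⟩

end Cfg


lemma im_neg {a b a' b' : ℝ} (h1 : a ^ 2 + b ^ 2 = 1) (h2 : a' ^ 2 + b' ^ 2 = 1) (h3 : a < a')
    (h4 : b < b') : a * b' + b * a' < 0 := by
  have e : 2 * ((a' - a) * (b' - b)) = (a * b' + b * a') * (2 * (a * a' + b * b') - 2) := by
    linear_combination (-2 * a' * b') * h1 + (-2 * a * b) * h2
  have hp : 0 < (a' - a) * (b' - b) := mul_pos (by linarith) (by linarith)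
  have hd : 2 * (a * a' + b * b') - 2 ≤ 0 := by nlinarith [sq_nonneg (a - a'), sq_nonneg (b - b')]
  by_contra h
  push Not at h
  nlinarith [mul_nonneg h (neg_nonneg.2 hd)]

lemma unit_cross {a b a' b' : ℝ} (h1 : a ^ 2 + b ^ 2 = 1) (h2 : a' ^ 2 + b' ^ 2 = 1) (hb : b < 0)
    (hb' : b' < 0) : a ≤ a' ↔ 0 ≤ a * b' - b * a' := by
  have e : (a * b' - b * a') * (b + b') = (a - a') * (1 + a * a' + b * b') := by
    linear_combination (-a') * h1 + a * h2
  have hp : 0 < 1 + a * a' + b * b' := by nlinarith [sq_nonneg (a + a'), mul_pos_of_neg_of_neg hb hb']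
  constructor
  · intro h
    by_contra hn
    push Not at hn
    nlinarith [mul_pos_of_neg_of_neg hn (add_neg hb hb'), mul_nonneg (sub_nonneg.2 h) hp.le]
  · intro h
    by_contra hn
    push Not at hn
    nlinarith [mul_nonneg h (neg_nonneg.2 (add_neg hb hb').le), mul_pos (sub_pos.2 hn) hp]

namespace Cfg
variable (c : Cfg)

/-- real part of a product -/
def Re (a b : Pt3) : ℝ := c.x a * c.x b - c.y a * c.y b
/-- imaginary part of a product -/
def Im (a b : Pt3) : ℝ := c.x a * c.y b + c.y a * c.x b

lemma ReIm {a b : Pt3} (ha : a ∈ c.Q) (hb : b ∈ c.Q) : c.Re a b ^ 2 + c.Im a b ^ 2 = 1 := by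
  have h1 := c.circ a ha
  have h2 := c.circ b hb
  unfold Re Im
  linear_combination (c.x b ^ 2 + c.y b ^ 2) * h1 + h2

lemma Re_inj {a a' b : Pt3} (ha : a ∈ c.Q) (ha' : a' ∈ c.Q) (hb : b ∈ c.Q)
    (h1 : c.Im a b < 0) (h2 : c.Im a' b < 0) (h : c.Re a b = c.Re a' b) : a = a' := by
  have e1 := c.ReIm ha hb
  have e2 := c.ReIm ha' hb
  have e3 : c.Im a b = c.Im a' b := by
    have : (c.Im a b - c.Im a' b) * (c.Im a b + c.Im a' b) = 0 := by
      rw [h] at e1; linear_combination e1 - e2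
    rcases mul_eq_zero.1 this with h | h
    · linarith
    · linarith
  refine c.xinj a ha a' ha' ?_
  have hb1 := c.circ b hb
  unfold Re at h
  unfold Im at e3
  linear_combination c.x b * h + c.y b * e3 - (c.x a - c.x a') * hb1

lemma Re_comm (a b : Pt3) : c.Re a b = c.Re b a := by unfold Re; ring
lemma Im_comm (a b : Pt3) : c.Im a b = c.Im b a := by unfold Im; ring

lemma products {S N : Finset Pt3} (hS : S ⊆ c.Q) (hN : N ⊆ c.Q) (hS0 : S.Nonempty) (hN0 : N.Nonempty)
    (hlt : ∀ s ∈ S, ∀ n ∈ N, c.x s < c.x n ∧ c.y s < c.y n) : 2 * (S.card + N.card) ≤ c.Q.card + 2 := by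
  have him : ∀ s ∈ S, ∀ n ∈ N, c.Im s n < 0 := by
    intro s hs n hn
    have := im_neg (c.circ s (hS hs)) (c.circ n (hN hn)) (hlt s hs n hn).1 (hlt s hs n hn).2
    unfold Im; exact this
  obtain ⟨n1, hn1⟩ := hN0
  obtain ⟨s0, hs0, hmin⟩ := Finset.exists_min_image S (fun s => c.Re s n1) hS0
  have hord : ∀ s ∈ S, ∀ n ∈ N, c.Re s0 n ≤ c.Re s n := by
    intro s hs n hn
    have key : ∀ n ∈ N, (c.Re s0 n ≤ c.Re s n ↔ 0 ≤ c.x s0 * c.y s - c.y s0 * c.x s) := by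
      intro n hn
      rw [unit_cross (c.ReIm (hS hs0) (hN hn)) (c.ReIm (hS hs) (hN hn)) (him s0 hs0 n hn) (him s hs n hn)]
      have e : c.Re s0 n * c.Im s n - c.Im s0 n * c.Re s n = c.x s0 * c.y s - c.y s0 * c.x s := by
        have := c.circ n (hN hn)
        unfold Re Im
        linear_combination (c.x s0 * c.y s - c.y s0 * c.x s) * this
      rw [e]
    exact (key n hn).2 ((key n1 hn1).1 (hmin s hs))
  obtain ⟨n0, hn0, hmax⟩ := Finset.exists_max_image N (fun n => c.Re s0 n) ⟨n1, hn1⟩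
  set D := c.Q.filter (fun d => c.Im s0 d < 0) with hD
  have hD2 : 2 * D.card ≤ c.Q.card := by
    have h1 : (D.image (fun d => -d)).card = D.card :=
      Finset.card_image_of_injective _ neg_injective
    have h2 : Disjoint D (D.image (fun d => -d)) := by
      rw [Finset.disjoint_left]
      intro d hd hd'
      obtain ⟨e, he, rfl⟩ := Finset.mem_image.1 hd'
      have i1 := (Finset.mem_filter.1 hd).2
      have i2 := (Finset.mem_filter.1 he).2
      unfold Im at i1 i2
      simp only [map_neg] at i1
      linarith
    have h3 : D ∪ D.image (fun d => -d) ⊆ c.Q := by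
      intro d hd
      rcases Finset.mem_union.1 hd with h | h
      · exact (Finset.mem_filter.1 h).1
      · obtain ⟨e, he, rfl⟩ := Finset.mem_image.1 h
        exact c.negQ e (Finset.mem_filter.1 he).1
    have := Finset.card_le_card h3
    rw [Finset.card_union_of_disjoint h2, h1] at this
    omega
  set A := S.image (fun s => c.Re s n0) with hA
  set B := N.image (fun n => c.Re s0 n) with hB
  have hAc : A.card = S.card := by
    apply Finset.card_image_of_injOn
    intro s hs s' hs' h
    exact c.Re_inj (hS hs) (hS hs') (hN hn0) (him s hs n0 hn0) (him s' hs' n0 hn0) h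
  have hBc : B.card = N.card := by
    apply Finset.card_image_of_injOn
    intro n hn n' hn' h
    refine c.Re_inj (b := s0) (hN hn) (hN hn') (hS hs0) ?_ ?_ ?_
    · rw [c.Im_comm]; exact him s0 hs0 n hn
    · rw [c.Im_comm]; exact him s0 hs0 n' hn'
    · rw [c.Re_comm n, c.Re_comm n']; exact h
  have hI : (A ∩ B).card ≤ 1 := by
    have : A ∩ B ⊆ {c.Re s0 n0} := by
      intro r hr
      obtain ⟨h1, h2⟩ := Finset.mem_inter.1 hr
      obtain ⟨s, hs, rfl⟩ := Finset.mem_image.1 h1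
      obtain ⟨n, hn, hh⟩ := Finset.mem_image.1 h2
      have i1 := hord s hs n0 hn0
      have i2 : c.Re s0 n ≤ c.Re s0 n0 := hmax n hn
      simp only [Finset.mem_singleton]
      linarith
    simpa using Finset.card_le_card this
  have hU : A ∪ B ⊆ D.image (fun d => c.Re s0 d) := by
    have key : ∀ s ∈ S, ∀ n ∈ N, c.Re s n ∈ D.image (fun d => c.Re s0 d) := by
      intro s hs n hn
      obtain ⟨d, hd, e1, e2⟩ := c.coset s (hS hs) n (hN hn) s0 (hS hs0)
      refine Finset.mem_image.2 ⟨d, Finset.mem_filter.2 ⟨hd, ?_⟩, e1⟩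
      have := him s hs n hn
      unfold Im at this ⊢
      rw [e2]; exact this
    intro r hr
    rcases Finset.mem_union.1 hr with h | h
    · obtain ⟨s, hs, rfl⟩ := Finset.mem_image.1 h
      exact key s hs n0 hn0
    · obtain ⟨n, hn, rfl⟩ := Finset.mem_image.1 h
      exact key s0 hs0 n hn
  have h1 := Finset.card_le_card hU
  have h2 : (D.image (fun d => c.Re s0 d)).card ≤ D.card := Finset.card_image_le
  have h3 := Finset.card_union_add_card_inter A B
  omega

/-- data of an upper path crossing -/
structure Dat (c : Cfg) (c1 c2 : Pt3) (j j' : Fin 2) (r : ℝ) : Prop where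
  k1 : c1 ∈ c.K
  q1 : c1 ∈ c.Q
  k2 : c2 ∈ c.K
  q2 : c2 ∈ c.Q
  l1 : -r ≤ c.x c1
  l2 : c.x c2 ≤ r
  i1 : c.x c1 < c.X j
  i2 : c.X j ≤ c.X j'
  i3 : c.X j' < c.x c2
  bet : ∀ k ∈ c.K, k ∈ c.Q → c.x k ≤ c.x c1 ∨ c.x c2 ≤ c.x k
  F1 : c.Face {c.v 0, c.v 1, c1, c.u j}
  F2 : c.Face {c.v 0, c.v 1, c2, c.u j'}

/-- rotation by a quarter turn -/
def rho : Cfg := c.swap.negx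

lemma negx_X (j : Fin 2) : c.negx.X j = - c.X j := by
  simp [X, negx]

variable {c}

lemma Dat.negx {c1 c2 : Pt3} {j j' : Fin 2} {r : ℝ} (D : Dat c c1 c2 j j' r) :
    Dat c.negx c2 c1 j' j r where
  k1 := D.k2
  q1 := D.q2
  k2 := D.k1
  q2 := D.q1
  l1 := neg_le_neg D.l2
  l2 := neg_le.1 D.l1
  i1 := by rw [negx_X]; exact neg_lt_neg D.i3
  i2 := by rw [negx_X, negx_X]; exact neg_le_neg D.i2
  i3 := by rw [negx_X]; exact neg_lt_neg D.i1
  bet k hk hq := by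
    rcases D.bet k hk hq with h | h
    · exact Or.inr (neg_le_neg h)
    · exact Or.inl (neg_le_neg h)
  F1 := D.F2
  F2 := D.F1

lemma Dat.rho_swap {c1 c2 : Pt3} {j j' : Fin 2} {r : ℝ} (D : Dat c c1 c2 j j' r) :
    Dat c.rho.swap c1 c2 j j' r := by
  have hX : ∀ j, c.rho.swap.X j = c.X j := by
    intro j
    rw [swap_X]
    exact c.swap_Y j
  exact ⟨D.k1, D.q1, D.k2, D.q2, D.l1, D.l2, by rw [hX]; exact D.i1, by rw [hX, hX]; exact D.i2,
    by rw [hX]; exact D.i3, D.bet, D.F1, D.F2⟩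

lemma Dat.negx_swap {c1 c2 : Pt3} {j j' : Fin 2} {r : ℝ} (D : Dat c.swap c1 c2 j j' r) :
    Dat c.negx.swap c1 c2 j j' r :=
  ⟨D.k1, D.q1, D.k2, D.q2, D.l1, D.l2, D.i1, D.i2, D.i3, D.bet, D.F1, D.F2⟩

lemma Dat.rho {d1 d2 : Pt3} {j j' : Fin 2} {r : ℝ} (D : Dat c.swap d1 d2 j j' r) :
    Dat c.rho d2 d1 j' j r := D.negx

/-- basic size estimate -/
lemma Dat.big {c1 c2 : Pt3} {j j' : Fin 2} {r r' : ℝ} (D : Dat c c1 c2 j j' r)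
    (hr' : 0 ≤ r') (hrr : r ^ 2 + r' ^ 2 < 1) :
    1 - r ^ 2 ≤ c.y c1 ^ 2 ∧ 1 - r ^ 2 ≤ c.y c2 ^ 2 ∧ r' < |c.y c1| ∧ r' < |c.y c2| := by
  have h1 := D.l1
  have h2 := D.l2
  have h3 := D.i1
  have h4 := D.i2
  have h5 := D.i3
  have e1 := c.circ c1 D.q1
  have e2 := c.circ c2 D.q2
  have b1 : 1 - r ^ 2 ≤ c.y c1 ^ 2 := by nlinarith
  have b2 : 1 - r ^ 2 ≤ c.y c2 ^ 2 := by nlinarith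
  refine ⟨b1, b2, ?_, ?_⟩
  · apply lt_of_pow_lt_pow_left₀ 2 (abs_nonneg _); rw [sq_abs]; linarith
  · apply lt_of_pow_lt_pow_left₀ 2 (abs_nonneg _); rw [sq_abs]; linarith

/-- no common vertex in the north-west region (type I) -/
lemma typeI_NW {c1 c2 d1 d2 v : Pt3} {j j' i i' : Fin 2} {r r' : ℝ} (D : Dat c c1 c2 j j' r)
    (E : Dat c.swap d1 d2 i i' r') (hr : 0 ≤ r) (hr' : 0 ≤ r') (hrr : r ^ 2 + r' ^ 2 < 1)
    (hc1 : c.y c1 < 0) (hc2 : 0 < c.y c2) (hd1 : c.x d1 < 0) (hd2 : 0 < c.x d2)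
    (hv : v ∈ c.K) (hv' : v ∈ c.swap.K) (hvQ : v ∈ c.Q) (h1 : c.x v ≤ c.x c1) (h2 : c.y d2 ≤ c.y v) :
    False := by
  obtain ⟨s1, s2, s3, s4⟩ := D.big hr' hrr
  obtain ⟨t1, t2, t3, t4⟩ := E.big hr (by linarith)
  change 1 - r' ^ 2 ≤ c.x d1 ^ 2 at t1
  change 1 - r' ^ 2 ≤ c.x d2 ^ 2 at t2
  change r < |c.x d1| at t3
  change r < |c.x d2| at t4
  rw [abs_of_neg hc1] at s3
  rw [abs_of_pos hc2] at s4
  rw [abs_of_neg hd1] at t3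
  rw [abs_of_pos hd2] at t4
  have Dl1 := D.l1
  have Dl2 := D.l2
  have Di1 := D.i1
  have Di2 := D.i2
  have Di3 := D.i3
  have El1 : -r' ≤ c.y d1 := E.l1
  have El2 : c.y d2 ≤ r' := E.l2
  have Ei1 := E.i1
  have Ei2 := E.i2
  have Ei3 := E.i3
  rw [swap_X] at Ei1 Ei3
  rw [swap_X, swap_X] at Ei2
  change c.y d1 < c.Y i at Ei1
  change c.Y i' < c.y d2 at Ei3
  have d1Q : d1 ∈ c.Q := E.q1
  have d2Q : d2 ∈ c.Q := E.q2
  have hvc : c.x v < c.x c1 := by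
    refine lt_of_le_of_ne h1 (fun h => ?_)
    have := c.xinj v hvQ c1 D.q1 h
    rw [this] at h2
    linarith
  have z1 := c.Z (i := i) (j := j) hv hvQ D.k1 D.q1 hvc d1Q E.F1 (Or.inr ⟨Di1, by linarith⟩) (by
    apply mul_neg_of_pos_of_neg
    · have a1 : 0 < (c.X j - c.x v) * (c.Y i - c.y d1) := mul_pos (by linarith) (by linarith)
      have a2 : 0 < (c.y v - c.Y i) * (c.X j - c.x d1) := mul_pos (by linarith) (by linarith)
      linarith
    · have a1 : (c.X j - c.x c1) * (c.Y i - c.y d1) < (c.X j - c.x d1) * (c.Y i - c.y c1) :=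
        mul_lt_mul'' (by linarith) (by linarith) (by linarith) (by linarith)
      linarith)
  have hdv : c.y d2 < c.y v := by
    refine lt_of_le_of_ne h2 (fun h => ?_)
    have := c.yinj d2 d2Q v hvQ h
    rw [← this] at h1
    linarith
  have z2 := c.swap.Z (i := j') (j := i') E.k2 E.q2 hv' hvQ hdv D.q2 D.F2
    (Or.inl ⟨by rw [swap_X]; exact Ei3, by rw [swap_X]; change c.Y i' < c.y c2; linarith⟩) (by
    rw [swap_X, swap_Y]
    change ((c.y d2 - c.Y i') * (c.x c2 - c.X j') - (c.x d2 - c.X j') * (c.y c2 - c.Y i')) *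
      ((c.y v - c.Y i') * (c.x c2 - c.X j') - (c.x v - c.X j') * (c.y c2 - c.Y i')) < 0
    apply mul_neg_of_neg_of_pos
    · have a1 : (c.y d2 - c.Y i') * (c.x c2 - c.X j') < (c.y c2 - c.Y i') * (c.x d2 - c.X j') :=
        mul_lt_mul'' (by linarith) (by linarith) (by linarith) (by linarith)
      linarith
    · have a1 : 0 < (c.y v - c.Y i') * (c.x c2 - c.X j') := mul_pos (by linarith) (by linarith)
      have a2 : 0 < (c.X j' - c.x v) * (c.y c2 - c.Y i') := mul_pos (by linarith) (by linarith)
      linarith)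
  have y1 : c.x v ≤ c.x d1 := z1.2.1
  have y2 : c.y c2 ≤ c.y v := z2.2.2
  have := c.circ v hvQ
  nlinarith

/-- common vertices in the south-west region (type II) -/
lemma typeII_SW {c1 c2 d1 d2 v : Pt3} {j j' i i' : Fin 2} {r r' : ℝ} (D : Dat c c1 c2 j j' r)
    (E : Dat c.swap d1 d2 i i' r') (hr : 0 ≤ r) (hr' : 0 ≤ r') (hrr : r ^ 2 + r' ^ 2 < 1)
    (hc1 : c.y c1 < 0) (hd1 : 0 < c.x d1)
    (hv' : v ∈ c.swap.K) (hvQ : v ∈ c.Q) (h1 : c.x v ≤ c.x c1) (h2 : c.y v ≤ c.y d1) :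
    c.x v ^ 2 ≤ r ^ 2 := by
  obtain ⟨s1, s2, s3, s4⟩ := D.big hr' hrr
  obtain ⟨t1, t2, t3, t4⟩ := E.big hr (by linarith)
  change r < |c.x d1| at t3
  rw [abs_of_neg hc1] at s3
  rw [abs_of_pos hd1] at t3
  have Dl1 := D.l1
  have Dl2 := D.l2
  have Di1 := D.i1
  have Di2 := D.i2
  have Di3 := D.i3
  have El1 : -r' ≤ c.y d1 := E.l1
  have El2 : c.y d2 ≤ r' := E.l2
  have Ei1 := E.i1
  rw [swap_X] at Ei1
  change c.y d1 < c.Y i at Ei1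
  have d1Q : d1 ∈ c.Q := E.q1
  have hdv : c.y v < c.y d1 := by
    refine lt_of_le_of_ne h2 (fun h => ?_)
    have := c.yinj v hvQ d1 d1Q h
    rw [this] at h1
    linarith
  have hyv : c.y v ≤ c.y c1 := by
    by_cases hl : (c.y v - c.Y i) * (c.x c1 - c.X j) - (c.x v - c.X j) * (c.y c1 - c.Y i) < 0
    · have z2 := c.swap.Z (i := j) (j := i) hv' hvQ E.k1 E.q1 hdv D.q1 D.F1
        (Or.inr ⟨by rw [swap_X]; exact Ei1, by rw [swap_X]; change c.y c1 < c.Y i; linarith⟩) (by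
        rw [swap_X, swap_Y]
        change ((c.y v - c.Y i) * (c.x c1 - c.X j) - (c.x v - c.X j) * (c.y c1 - c.Y i)) *
          ((c.y d1 - c.Y i) * (c.x c1 - c.X j) - (c.x d1 - c.X j) * (c.y c1 - c.Y i)) < 0
        apply mul_neg_of_neg_of_pos hl
        have a1 : 0 < (c.Y i - c.y d1) * (c.X j - c.x c1) := mul_pos (by linarith) (by linarith)
        have a2 : 0 < (c.x d1 - c.X j) * (c.Y i - c.y c1) := mul_pos (by linarith) (by linarith)
        linarith)
      exact z2.2.1
    · push Not at hl
      by_contra hn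
      push Not at hn
      have a1 : (c.Y i - c.y v) * (c.X j - c.x c1) < (c.Y i - c.y c1) * (c.X j - c.x c1) :=
        mul_lt_mul_of_pos_right (by linarith) (by linarith)
      have a2 : (c.Y i - c.y c1) * (c.X j - c.x c1) ≤ (c.Y i - c.y c1) * (c.X j - c.x v) :=
        mul_le_mul_of_nonneg_left (by linarith) (by linarith)
      linarith
  have := c.circ v hvQ
  nlinarith

end Cfg


namespace Cfg
variable (c : Cfg)

/-- common vertices of the two paths -/
def CS : Finset Pt3 := c.Q.filter (fun q => q ∈ c.K ∧ q ∈ c.swap.K)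

variable {c}

lemma mem_CS {q : Pt3} : q ∈ c.CS ↔ q ∈ c.Q ∧ q ∈ c.K ∧ q ∈ c.swap.K := Finset.mem_filter

lemma typeI {c1 c2 d1 d2 p : Pt3} {j j' i i' : Fin 2} {r r' : ℝ} (D : Dat c c1 c2 j j' r)
    (E : Dat c.swap d1 d2 i i' r') (hr : 0 ≤ r) (hr' : 0 ≤ r') (hrr : r ^ 2 + r' ^ 2 < 1)
    (hc1 : c.y c1 < 0) (hc2 : 0 < c.y c2) (hd1 : c.x d1 < 0) (hd2 : 0 < c.x d2)
    (hp : p ∈ c.CS) (hp' : -p ∈ c.CS) (hpy : r' < |c.y p|) :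
    2 * c.CS.card ≤ c.Q.card + 2 := by
  have El1 : -r' ≤ c.y d1 := E.l1
  have El2 : c.y d2 ≤ r' := E.l2
  have Ei1 := E.i1
  have Ei2 := E.i2
  have Ei3 := E.i3
  rw [swap_X] at Ei1 Ei3
  rw [swap_X, swap_X] at Ei2
  change c.y d1 < c.Y i at Ei1
  change c.Y i' < c.y d2 at Ei3
  have Di1 := D.i1
  have Di2 := D.i2
  have Di3 := D.i3
  set S := c.CS.filter (fun v => c.x v ≤ c.x c1 ∧ c.y v ≤ c.y d1) with hS
  set N := c.CS.filter (fun v => c.x c2 ≤ c.x v ∧ c.y d2 ≤ c.y v) with hN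
  have hmem : ∀ v ∈ c.CS, v ∈ S ∨ v ∈ N := by
    intro v hv
    obtain ⟨vQ, vK, vK'⟩ := mem_CS.1 hv
    have b1 := D.bet v vK vQ
    have b2 : c.y v ≤ c.y d1 ∨ c.y d2 ≤ c.y v := E.bet v vK' vQ
    rcases b1 with b1 | b1
    · rcases b2 with b2 | b2
      · exact Or.inl (Finset.mem_filter.2 ⟨hv, b1, b2⟩)
      · exact (typeI_NW D E hr hr' hrr hc1 hc2 hd1 hd2 vK vK' vQ b1 b2).elim
    · rcases b2 with b2 | b2
      · refine (typeI_NW (c := c.rho.rho) (v := v) D.rho_swap.rho E.rho.rho_swap hr hr' hrr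
          (neg_lt_zero.2 hc2) (neg_pos.2 hc1) (neg_lt_zero.2 hd2) (neg_pos.2 hd1) vK vK' vQ
          (neg_le_neg b1) (neg_le_neg b2)).elim
      · exact Or.inr (Finset.mem_filter.2 ⟨hv, b1, b2⟩)
  have hcard : c.CS.card ≤ S.card + N.card := by
    have : c.CS ⊆ S ∪ N := fun v hv => Finset.mem_union.2 (hmem v hv)
    exact (Finset.card_le_card this).trans (Finset.card_union_le _ _)
  have hne : S.Nonempty ∧ N.Nonempty := by
    rcases hmem p hp with h1 | h1 <;> rcases hmem (-p) hp' with h2 | h2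
    · exfalso
      have a1 := (Finset.mem_filter.1 h1).2.2
      have a2 := (Finset.mem_filter.1 h2).2.2
      rw [map_neg] at a2
      rcases abs_cases (c.y p) with ⟨e, _⟩ | ⟨e, _⟩ <;> linarith
    · exact ⟨⟨p, h1⟩, ⟨-p, h2⟩⟩
    · exact ⟨⟨-p, h2⟩, ⟨p, h1⟩⟩
    · exfalso
      have a1 := (Finset.mem_filter.1 h1).2.2
      have a2 := (Finset.mem_filter.1 h2).2.2
      rw [map_neg] at a2
      rcases abs_cases (c.y p) with ⟨e, _⟩ | ⟨e, _⟩ <;> linarith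
  have := c.products (S := S) (N := N)
    (fun v hv => (mem_CS.1 (Finset.mem_filter.1 hv).1).1)
    (fun v hv => (mem_CS.1 (Finset.mem_filter.1 hv).1).1) hne.1 hne.2 (by
      intro s hs n hn
      obtain ⟨_, a1, a2⟩ := Finset.mem_filter.1 hs
      obtain ⟨_, b1, b2⟩ := Finset.mem_filter.1 hn
      constructor <;> linarith)
  omega

lemma typeII {c1 c2 d1 d2 v : Pt3} {j j' i i' : Fin 2} {r r' : ℝ} (D : Dat c c1 c2 j j' r)
    (E : Dat c.swap d1 d2 i i' r') (hr : 0 ≤ r) (hr' : 0 ≤ r') (hrr : r ^ 2 + r' ^ 2 < 1)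
    (hc1 : c.y c1 < 0) (hc2 : 0 < c.y c2) (hd1 : 0 < c.x d1) (hd2 : c.x d2 < 0)
    (hv : v ∈ c.CS) : c.x v ^ 2 ≤ r ^ 2 ∨ c.y v ^ 2 ≤ r' ^ 2 := by
  obtain ⟨vQ, vK, vK'⟩ := mem_CS.1 hv
  have hrr' : r' ^ 2 + r ^ 2 < 1 := by linarith
  have b1 := D.bet v vK vQ
  have b2 : c.y v ≤ c.y d1 ∨ c.y d2 ≤ c.y v := E.bet v vK' vQ
  rcases b1 with b1 | b1
  · rcases b2 with b2 | b2
    · exact Or.inl (typeII_SW D E hr hr' hrr hc1 hd1 vK' vQ b1 b2)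
    · right
      have := typeII_SW (c := c.rho) (v := v) E.rho D.rho_swap hr' hr hrr' hd2 (neg_pos.2 hc1) vK vQ
        (neg_le_neg b2) b1
      change (-(c.y v)) ^ 2 ≤ r' ^ 2 at this
      rwa [neg_sq] at this
  · rcases b2 with b2 | b2
    · right
      have := typeII_SW (c := c.rho.rho.rho) (v := v) E.rho.rho_swap.rho D.rho_swap.rho.rho_swap
        hr' hr hrr' (neg_lt_zero.2 hd1) (by
          change 0 < - -(c.y c2); linarith) vK vQ
        (by change - -(c.y v) ≤ - -(c.y d1); linarith) (neg_le_neg b1)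
      change (- -(c.y v)) ^ 2 ≤ r' ^ 2 at this
      rwa [neg_sq, neg_sq] at this
    · left
      have := typeII_SW (c := c.rho.rho) (v := v) D.rho_swap.rho E.rho.rho_swap hr hr' hrr
        (neg_lt_zero.2 hc2) (neg_pos.2 hd2) vK' vQ (neg_le_neg b1) (neg_le_neg b2)
      change (-(c.x v)) ^ 2 ≤ r ^ 2 at this
      rwa [neg_sq] at this

/-- both types together, without sign normalisation -/
lemma types {c1 c2 d1 d2 p : Pt3} {j j' i i' : Fin 2} {r r' : ℝ} (D : Dat c c1 c2 j j' r)
    (E : Dat c.swap d1 d2 i i' r') (hr : 0 ≤ r) (hr' : 0 ≤ r') (hrr : r ^ 2 + r' ^ 2 < 1)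
    (hc : c.y c1 * c.y c2 < 0) (hd : c.x d1 * c.x d2 < 0)
    (hp : p ∈ c.CS) (hp' : -p ∈ c.CS) (hpy : r' < |c.y p|) :
    2 * c.CS.card ≤ c.Q.card + 2 ∨ ∀ v ∈ c.CS, c.x v ^ 2 ≤ r ^ 2 ∨ c.y v ^ 2 ≤ r' ^ 2 := by
  rcases mul_neg_iff.1 hc with ⟨h1, h2⟩ | ⟨h1, h2⟩
  · rcases mul_neg_iff.1 hd with ⟨h3, h4⟩ | ⟨h3, h4⟩
    · left
      exact typeI (c := c.negx) D.negx E.negx_swap hr hr' hrr h2 h1 (neg_lt_zero.2 h3) (neg_pos.2 h4)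
        hp hp' hpy
    · right
      intro v hv
      have := typeII (c := c.negx) (v := v) D.negx E.negx_swap hr hr' hrr h2 h1 (neg_pos.2 h3)
        (neg_lt_zero.2 h4) hv
      change (-(c.x v)) ^ 2 ≤ r ^ 2 ∨ c.y v ^ 2 ≤ r' ^ 2 at this
      rwa [neg_sq] at this
  · rcases mul_neg_iff.1 hd with ⟨h3, h4⟩ | ⟨h3, h4⟩
    · right
      intro v hv
      exact typeII D E hr hr' hrr h1 h2 h3 h4 hv
    · left
      exact typeI D E hr hr' hrr h1 h2 h3 h4 hp hp' hpy

lemma sep {xd yd x1 y1 x2 y2 r : ℝ} (h1 : y1 < yd) (h2 : yd < y2) (a1 : |x1| ≤ r) (a2 : |x2| ≤ r) :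
    (r < xd → 0 < (xd - x1) * (y2 - y1) - (yd - y1) * (x2 - x1)) ∧
    (xd < -r → (xd - x1) * (y2 - y1) - (yd - y1) * (x2 - x1) < 0) := by
  have e : (xd - x1) * (y2 - y1) - (yd - y1) * (x2 - x1) = (y2 - yd) * (xd - x1) + (yd - y1) * (xd - x2) := by
    ring
  rw [abs_le] at a1 a2
  rw [e]
  constructor
  · intro h
    have b1 := mul_pos (sub_pos.2 h2) (by linarith : 0 < xd - x1)
    have b2 := mul_pos (sub_pos.2 h1) (by linarith : 0 < xd - x2)
    linarith
  · intro h
    have b1 := mul_pos (sub_pos.2 h2) (by linarith : 0 < x1 - xd)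
    have b2 := mul_pos (sub_pos.2 h1) (by linarith : 0 < x2 - xd)
    linarith

/-- a direct edge on one path is impossible -/
lemma no_direct {c1 c2 d1 d2 : Pt3} {r r' : ℝ} (q1 : c1 ∈ c.Q) (q2 : c2 ∈ c.Q)
    (e1 : d1 ∈ c.Q) (e2 : d2 ∈ c.Q) (f1 : d1 ∈ c.swap.K) (f2 : d2 ∈ c.swap.K)
    (a1 : |c.x c1| ≤ r) (a2 : |c.x c2| ≤ r) (b1 : |c.y d1| ≤ r') (b2 : |c.y d2| ≤ r')
    (a3 : r' < |c.y c1|) (a4 : r' < |c.y c2|) (b3 : r < |c.x d1|) (b4 : r < |c.x d2|)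
    (hc : c.y c1 * c.y c2 < 0) (hd : c.x d1 * c.x d2 < 0) (hdd : c.y d1 < c.y d2)
    (hF : c.Face {c1, c2}) : False := by
  have key : ∀ c1 c2, c1 ∈ c.Q → c2 ∈ c.Q → |c.x c1| ≤ r → |c.x c2| ≤ r → r' < |c.y c1| →
      r' < |c.y c2| → c.y c1 < 0 → 0 < c.y c2 → c.Face {c1, c2} → False := by
    intro c1 c2 q1 q2 a1 a2 a3 a4 h1 h2 hF
    rw [abs_of_neg h1] at a3
    rw [abs_of_pos h2] at a4
    rw [abs_le] at b1 b2
    have s1 := sep (xd := c.x d1) (yd := c.y d1) (y1 := c.y c1) (y2 := c.y c2)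
      (by linarith) (by linarith) a1 a2
    have s2 := sep (xd := c.x d2) (yd := c.y d2) (y1 := c.y c1) (y2 := c.y c2)
      (by linarith) (by linarith) a1 a2
    refine c.Z0 f1 e1 f2 e2 hdd q1 q2 hF (by linarith) (by linarith) ?_
    rcases mul_neg_iff.1 hd with ⟨h3, h4⟩ | ⟨h3, h4⟩
    · rw [abs_of_pos h3] at b3
      rw [abs_of_neg h4] at b4
      exact mul_neg_of_pos_of_neg (s1.1 b3) (s2.2 (by linarith))
    · rw [abs_of_neg h3] at b3
      rw [abs_of_pos h4] at b4
      exact mul_neg_of_neg_of_pos (s1.2 (by linarith)) (s2.1 b4)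
  rcases mul_neg_iff.1 hc with ⟨h1, h2⟩ | ⟨h1, h2⟩
  · exact key c2 c1 q2 q1 a2 a1 a4 a3 h2 h1 (hF.mono (by intro s; simp; tauto))
  · exact key c1 c2 q1 q2 a1 a2 a3 a4 h1 h2 hF

variable (c)

/-- symmetric part of the common vertices -/
def CC : Finset Pt3 := c.CS.filter (fun q => -q ∈ c.CS)

variable {c}

lemma CC_neg {p : Pt3} (hp : p ∈ c.CC) : -p ∈ c.CC := by
  obtain ⟨h1, h2⟩ := Finset.mem_filter.1 hp
  exact Finset.mem_filter.2 ⟨h2, by rwa [neg_neg]⟩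

lemma CC_Q {p : Pt3} (hp : p ∈ c.CC) : p ∈ c.Q := (mem_CS.1 (Finset.mem_filter.1 hp).1).1

lemma eq_or_neg_x {p q : Pt3} (hp : p ∈ c.Q) (hq : q ∈ c.Q) (h : c.x p ^ 2 = c.x q ^ 2) :
    p = q ∨ p = -q := by
  rcases sq_eq_sq_iff_eq_or_eq_neg.1 h with h | h
  · exact Or.inl (c.xinj p hp q hq h)
  · exact Or.inr (c.xinj p hp (-q) (c.negQ q hq) (by rw [h, map_neg]))

lemma CC_cases : c.CC.card ≤ 2 ∨ ((∃ j, c.u j ∈ c.K) ∧ (∃ i, c.v i ∈ c.swap.K) ∧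
    (2 * c.CS.card ≤ c.Q.card + 2 ∨ c.CC.card ≤ 4)) := by
  by_cases hcard : c.CC.card ≤ 2
  · exact Or.inl hcard
  right
  have hne : c.CC.Nonempty := by
    rw [← Finset.card_pos]; omega
  obtain ⟨p, hp, hpm⟩ := Finset.exists_min_image c.CC (fun q => c.x q ^ 2) hne
  obtain ⟨p', hp', hpm'⟩ := Finset.exists_max_image c.CC (fun q => c.x q ^ 2) hne
  have hlt : c.x p ^ 2 < c.x p' ^ 2 := by
    by_contra hn
    push Not at hn
    apply hcard
    have : c.CC ⊆ {p, -p} := by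
      intro q hq
      have a1 := hpm q hq
      have a2 := hpm' q hq
      have := eq_or_neg_x (CC_Q hq) (CC_Q hp) (by linarith)
      simpa using this
    exact (Finset.card_le_card this).trans Finset.card_le_two
  -- normalise signs
  obtain ⟨p, hp, hpm, hlt, hpx⟩ : ∃ p ∈ c.CC, (∀ q ∈ c.CC, c.x p ^ 2 ≤ c.x q ^ 2) ∧
      c.x p ^ 2 < c.x p' ^ 2 ∧ c.x p < 0 := by
    rcases lt_or_gt_of_ne (c.xQ_ne (CC_Q hp)) with h | h
    · exact ⟨p, hp, hpm, hlt, h⟩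
    · exact ⟨-p, CC_neg hp, by simpa using hpm, by simpa using hlt, by simpa using h⟩
  obtain ⟨p', hp', hpm', hlt, hpy⟩ : ∃ p' ∈ c.CC, (∀ q ∈ c.CC, c.x q ^ 2 ≤ c.x p' ^ 2) ∧
      c.x p ^ 2 < c.x p' ^ 2 ∧ c.y p' < 0 := by
    rcases lt_or_gt_of_ne (c.yQ_ne (CC_Q hp')) with h | h
    · exact ⟨p', hp', hpm', hlt, h⟩
    · exact ⟨-p', CC_neg hp', by simpa using hpm', by simpa using hlt, by simpa using h⟩
  have hpQ := CC_Q hp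
  have hpQ' := CC_Q hp'
  have hpS : p ∈ c.CS := (Finset.mem_filter.1 hp).1
  have hpSn : -p ∈ c.CS := (Finset.mem_filter.1 hp).2
  have hpS' : p' ∈ c.CS := (Finset.mem_filter.1 hp').1
  have hpSn' : -p' ∈ c.CS := (Finset.mem_filter.1 hp').2
  have ypne := c.yQ_ne hpQ
  have xpne := c.xQ_ne hpQ'
  obtain ⟨c1, c2, k1, q1, k2, q2, l1, l12, l2, hyc, bet, hor⟩ := c.S1 (mem_CS.1 hpS).2.1 hpQ
    (mem_CS.1 hpSn).2.1 (c.negQ p hpQ) (by rw [map_neg]; linarith)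
    (by rw [map_neg]; have : 0 < c.y p ^ 2 := by positivity
        linarith [sq (c.y p)])
  obtain ⟨d1, d2, m1, e1, m2, e2, n1, n12, n2, hxd, bet', hor'⟩ := c.swap.S1 (mem_CS.1 hpS').2.2 hpQ'
    (mem_CS.1 hpSn').2.2 (c.negQ p' hpQ') (by change c.y p' < c.y (-p'); rw [map_neg]; linarith)
    (by change c.x p' * c.x (-p') < 0
        rw [map_neg]; have : 0 < c.x p' ^ 2 := by positivity
        linarith [sq (c.x p')])
  change c.y p' ≤ c.y d1 at n1
  change c.y d1 < c.y d2 at n12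
  change c.y d2 ≤ c.y (-p') at n2
  change c.x d1 * c.x d2 < 0 at hxd
  change d1 ∈ c.Q at e1
  change d2 ∈ c.Q at e2
  rw [map_neg] at l2 n2
  set r := - c.x p with hr
  set r' := - c.y p' with hr'
  have r0 : 0 ≤ r := by linarith
  have r0' : 0 ≤ r' := by linarith
  have hrr : r ^ 2 + r' ^ 2 < 1 := by
    have := c.circ p' hpQ'
    rw [hr, hr', neg_sq, neg_sq]; linarith
  have big : ∀ q ∈ c.Q, |c.x q| ≤ r → r' < |c.y q| := by
    intro q hq h
    have h1 : c.x q ^ 2 ≤ r ^ 2 := by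
      rw [← sq_abs]; exact pow_le_pow_left₀ (abs_nonneg _) h 2
    have := c.circ q hq
    apply lt_of_pow_lt_pow_left₀ 2 (abs_nonneg _); rw [sq_abs]; linarith
  have big' : ∀ q ∈ c.Q, |c.y q| ≤ r' → r < |c.x q| := by
    intro q hq h
    have h1 : c.y q ^ 2 ≤ r' ^ 2 := by
      rw [← sq_abs]; exact pow_le_pow_left₀ (abs_nonneg _) h 2
    have := c.circ q hq
    apply lt_of_pow_lt_pow_left₀ 2 (abs_nonneg _); rw [sq_abs]; linarith
  have A1 : |c.x c1| ≤ r := abs_le.2 ⟨by linarith, by linarith⟩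
  have A2 : |c.x c2| ≤ r := abs_le.2 ⟨by linarith, by linarith⟩
  have B1 : |c.y d1| ≤ r' := abs_le.2 ⟨by linarith, by linarith⟩
  have B2 : |c.y d2| ≤ r' := abs_le.2 ⟨by linarith, by linarith⟩
  rcases hor with hF | ⟨j, j', hF1, hF2, uK, i1, i2, i3⟩
  · exact (no_direct q1 q2 e1 e2 m1 m2 A1 A2 B1 B2 (big c1 q1 A1) (big c2 q2 A2) (big' d1 e1 B1)
      (big' d2 e2 B2) hyc hxd n12 hF).elim
  rcases hor' with hF | ⟨i, i', hG1, hG2, vK, o1, o2, o3⟩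
  · exact (no_direct (c := c.swap) e1 e2 q1 q2 k1 k2 B1 B2 A1 A2 (big' d1 e1 B1)
      (big' d2 e2 B2) (big c1 q1 A1) (big c2 q2 A2) hxd hyc l12 hF).elim
  refine ⟨⟨j, uK⟩, ⟨i, vK⟩, ?_⟩
  have D : Dat c c1 c2 j j' r := ⟨k1, q1, k2, q2, by linarith, l2, i1, i2, i3, bet, hF1, hF2⟩
  have E : Dat c.swap d1 d2 i i' r' := ⟨m1, e1, m2, e2, by change - r' ≤ c.y d1; linarith, n2, o1, o2, o3, bet', hG1, hG2⟩
  rcases types D E r0 r0' hrr hyc hxd hpS hpSn (big p hpQ (by rw [abs_of_neg hpx])) with h | h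
  · exact Or.inl h
  · right
    have : c.CC ⊆ {p, -p, p', -p'} := by
      intro q hq
      have hqQ := CC_Q hq
      have a1 := hpm q hq
      have a2 := hpm' q hq
      have e0 := c.circ q hqQ
      have e1 := c.circ p' hpQ'
      simp only [Finset.mem_insert, Finset.mem_singleton]
      rcases h q (Finset.mem_filter.1 hq).1 with h | h
      · rw [hr, neg_sq] at h
        have := eq_or_neg_x hqQ hpQ (le_antisymm h a1)
        tauto
      · rw [hr', neg_sq] at h
        have := eq_or_neg_x hqQ hpQ' (by linarith)
        tauto
    exact (Finset.card_le_card this).trans Finset.card_le_four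

lemma planar : 2 * ((c.Q.filter (· ∈ c.K)).card + (c.Q.filter (· ∈ c.swap.K)).card) ≤ 3 * c.Q.card + 4 ∧
    (((∀ j, c.u j ∉ c.K) ∨ (∀ i, c.v i ∉ c.swap.K)) →
      2 * ((c.Q.filter (· ∈ c.K)).card + (c.Q.filter (· ∈ c.swap.K)).card) ≤ 3 * c.Q.card + 2) := by
  have h1 : (c.Q.filter (· ∈ c.K)).card + (c.Q.filter (· ∈ c.swap.K)).card ≤ c.Q.card + c.CS.card := by
    rw [← Finset.card_union_add_card_inter]
    have : c.Q.filter (· ∈ c.K) ∩ c.Q.filter (· ∈ c.swap.K) = c.CS := by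
      ext q; simp only [Finset.mem_inter, Finset.mem_filter, mem_CS]; tauto
    rw [this]
    have : (c.Q.filter (· ∈ c.K) ∪ c.Q.filter (· ∈ c.swap.K)).card ≤ c.Q.card := by
      apply Finset.card_le_card
      exact Finset.union_subset (Finset.filter_subset _ _) (Finset.filter_subset _ _)
    omega
  have h2 : 2 * c.CS.card ≤ c.Q.card + c.CC.card := by
    have e1 : (c.CS.image (fun d => -d)).card = c.CS.card :=
      Finset.card_image_of_injective _ neg_injective
    have e2 := Finset.card_union_add_card_inter c.CS (c.CS.image (fun d => -d))
    have e3 : c.CS ∩ c.CS.image (fun d => -d) ⊆ c.CC := by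
      intro q hq
      obtain ⟨a1, a2⟩ := Finset.mem_inter.1 hq
      obtain ⟨b, hb, rfl⟩ := Finset.mem_image.1 a2
      exact Finset.mem_filter.2 ⟨a1, by rwa [neg_neg]⟩
    have e4 : c.CS ∪ c.CS.image (fun d => -d) ⊆ c.Q := by
      intro q hq
      rcases Finset.mem_union.1 hq with h | h
      · exact (mem_CS.1 h).1
      · obtain ⟨b, hb, rfl⟩ := Finset.mem_image.1 h
        exact c.negQ b (mem_CS.1 hb).1
    have e5 := Finset.card_le_card e3
    have e6 := Finset.card_le_card e4
    omega
  rcases c.CC_cases with h | ⟨⟨j, hj⟩, ⟨i, hi⟩, h⟩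
  · constructor
    · omega
    · intro; omega
  · constructor
    · omega
    · rintro (h | h)
      · exact absurd hj (h j)
      · exact absurd hi (h i)

end Cfg


namespace Cfg

/-- section points with their supports -/
def Site (c : Cfg) (A : Finset Pt3) (a : Pt3) : Prop :=
  (A = {a} ∧ a ∈ c.Q) ∨ ∃ i j, A = {c.v i, c.u j} ∧ a = c.O i j

lemma Site.pos {c : Cfg} {A : Finset Pt3} {a : Pt3} (h : c.Site A a) : Pos A a := by
  rcases h with ⟨rfl, -⟩ | ⟨i, j, rfl, rfl⟩
  · exact pos_single a
  · exact c.pos_O i j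

lemma Site.z {c : Cfg} {A : Finset Pt3} {a : Pt3} (h : c.Site A a) : c.z a = 0 := by
  rcases h with ⟨-, h⟩ | ⟨i, j, -, rfl⟩
  · exact c.zQ a h
  · exact c.zO i j

lemma Site.hull {c : Cfg} {A : Finset Pt3} {a : Pt3} (h : c.Site A a) :
    a ∈ convexHull ℝ (c.Q : Set Pt3) := by
  rcases h with ⟨-, h⟩ | ⟨i, j, -, rfl⟩
  · exact subset_convexHull ℝ _ h
  · exact c.OQ i j

lemma exists_slope (c : Cfg) : ∃ l : ℝ, ∀ A a B b, c.Site A a → c.Site B b → a ≠ b →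
    (c.x + l • c.y) a ≠ (c.x + l • c.y) b := by
  let W : Finset Pt3 := c.Q ∪ Finset.univ.image (fun p : Fin 2 × Fin 2 => c.O p.1 p.2)
  obtain ⟨l, hl⟩ := Infinite.exists_notMem_finset
    ((W ×ˢ W).image (fun p => -(c.x p.1 - c.x p.2) / (c.y p.1 - c.y p.2)))
  have hW : ∀ A a, c.Site A a → a ∈ W := by
    intro A a h
    rcases h with ⟨-, h⟩ | ⟨i, j, -, rfl⟩
    · exact Finset.mem_union_left _ h
    · exact Finset.mem_union_right _ (Finset.mem_image.2 ⟨(i, j), by simp, rfl⟩)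
  refine ⟨l, fun A a B b ha hb hne heq => ?_⟩
  simp only [LinearMap.add_apply, LinearMap.smul_apply, smul_eq_mul] at heq
  by_cases hy : c.y a = c.y b
  · exact hne (c.inj a b (by rw [hy] at heq; linarith) hy (by rw [ha.z, hb.z]))
  · apply hl
    refine Finset.mem_image.2 ⟨(a, b), Finset.mem_product.2 ⟨hW A a ha, hW B b hb⟩, ?_⟩
    have : c.y a - c.y b ≠ 0 := sub_ne_zero.2 hy
    simp only
    field_simp
    linarith

lemma site_union {c : Cfg} {A B C : Finset Pt3} {a b e : Pt3} (hA : c.Site A a) (hB : c.Site B b)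
    (hC : c.Site C e) (h : A ∪ C = B) : A = B ∧ C = B := by
  have h1 : A ⊆ B := h ▸ Finset.subset_union_left
  have h2 : C ⊆ B := h ▸ Finset.subset_union_right
  have key : ∀ {A a}, c.Site A a → A ⊆ B → A = B := by
    intro A a hA h1
    rcases hA with ⟨rfl, ha⟩ | ⟨i, j, rfl, rfl⟩ <;> rcases hB with ⟨rfl, hb⟩ | ⟨i', j', rfl, rfl⟩
    · have := Finset.singleton_subset_singleton.1 h1
      rw [this]
    · have := h1 (Finset.mem_singleton_self a)
      simp only [Finset.mem_insert, Finset.mem_singleton] at this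
      rcases this with h | h
      · exact (c.vq_ne i' ha h).elim
      · exact (c.uq_ne j' ha h).elim
    · have := h1 (Finset.mem_insert_self _ _)
      exact (c.vq_ne i hb (Finset.mem_singleton.1 this).symm).elim
    · apply Finset.eq_of_subset_of_card_le h1
      rw [Finset.card_pair (c.vu_ne _ _), Finset.card_pair (c.vu_ne _ _)]
  exact ⟨key hA h1, key hC h2⟩

/-- triangle in the section plane with middle vertex `b`; `pos` records the side of the
opposite edge -/
def Tri (c : Cfg) (l : ℝ) (S B : Finset Pt3) (b : Pt3) (pos : Bool) : Prop :=
  c.Face S ∧ c.Site B b ∧ ∃ (R : Finset Pt3) (r : Pt3) (t : ℝ) (A : Finset Pt3) (a : Pt3)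
    (C : Finset Pt3) (e : Pt3), S = B ∪ R ∧ Pos R r ∧ c.Site A a ∧ c.Site C e ∧
    R = A ∪ C ∧ 0 < t ∧ t < 1 ∧ r = (1 - t) • a + t • e ∧
    (c.x + l • c.y) a < (c.x + l • c.y) b ∧ (c.x + l • c.y) b < (c.x + l • c.y) e ∧
    (c.x + l • c.y) r = (c.x + l • c.y) b ∧ c.y r ≠ c.y b ∧ (pos = true ↔ c.y b < c.y r)

lemma tri_exists {c : Cfg} {l : ℝ} {A B C : Finset Pt3} {a b e : Pt3} (hF : c.Face (B ∪ (A ∪ C)))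
    (hA : c.Site A a) (hB : c.Site B b) (hC : c.Site C e)
    (h1 : (c.x + l • c.y) a < (c.x + l • c.y) b) (h2 : (c.x + l • c.y) b < (c.x + l • c.y) e) :
    ∃ pos, c.Tri l (B ∪ (A ∪ C)) B b pos := by
  set s := c.x + l • c.y with hs
  set t := (s b - s a) / (s e - s a) with ht
  have hd : 0 < s e - s a := by linarith
  have t0 : 0 < t := div_pos (by linarith) hd
  have t1 : t < 1 := by rw [ht, div_lt_one hd]; linarith
  have htm : t * (s e - s a) = s b - s a := by rw [ht]; field_simp
  set r := (1 - t) • a + t • e with hr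
  have hsr : s r = s b := by
    rw [hr]; simp only [map_add, map_smul, smul_eq_mul]; linarith
  have hR : Pos (A ∪ C) r := pos_comb hA.pos hC.pos t0 t1
  have hzr : c.z r = 0 := by rw [hr]; simp [hA.z, hC.z]
  have hy : c.y r ≠ c.y b := by
    intro hy
    have hx : c.x r = c.x b := by
      have := hsr
      simp only [hs, LinearMap.add_apply, LinearMap.smul_apply, smul_eq_mul, hy] at this
      linarith
    have hrb : r = b := c.inj r b hx hy (by rw [hzr, hB.z])
    rw [hrb] at hR
    have := c.faceM (hF.mono Finset.subset_union_right) (hF.mono Finset.subset_union_left) hR hB.pos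
    obtain ⟨hAB, hCB⟩ := site_union hA hB hC this
    subst hAB
    have hab : a = b := by
      rcases hA with ⟨h3, h4⟩ | ⟨i, j, h3, rfl⟩ <;> rcases hB with ⟨h5, h6⟩ | ⟨i', j', h5, rfl⟩
      · rw [h3] at h5; exact Finset.singleton_injective h5
      · exfalso
        rw [h3] at h5
        have := congrArg Finset.card h5
        rw [Finset.card_pair (c.vu_ne _ _)] at this
        simp at this
      · exfalso
        rw [h3] at h5
        have := congrArg Finset.card h5
        rw [Finset.card_pair (c.vu_ne _ _)] at this
        simp at this
      · rw [h3] at h5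
        have e1 : c.v i ∈ ({c.v i', c.u j'} : Finset Pt3) := by rw [← h5]; simp
        have e2 : c.u j ∈ ({c.v i', c.u j'} : Finset Pt3) := by rw [← h5]; simp
        simp only [Finset.mem_insert, Finset.mem_singleton] at e1 e2
        have f1 : i = i' := c.v_inj (e1.resolve_right (c.vu_ne _ _))
        have f2 : j = j' := c.u_inj (e2.resolve_left (c.vu_ne _ _).symm)
        rw [f1, f2]
    rw [hab] at h1
    exact lt_irrefl _ h1
  exact ⟨decide (c.y b < c.y r), hF, hB, A ∪ C, r, t, A, a, C, e, rfl, hR, hA, hC, rfl, t0, t1, rfl,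
    h1, h2, hsr, hy, by simp⟩

lemma tri_unique {c : Cfg} {l : ℝ} {S S' B : Finset Pt3} {b : Pt3} {pos : Bool}
    (h : c.Tri l S B b pos) (h' : c.Tri l S' B b pos) : S = S' := by
  obtain ⟨hF, hB, R, r, t, A, a, C, e, hS, hR, hA, hC, -, -, -, hr, -, -, hsr, hyr, hp⟩ := h
  obtain ⟨hF', -, R', r', t', A', a', C', e', hS', hR', hA', hC', -, -, -, hr', -, -, hsr', hyr',
    hp'⟩ := h'
  have hz : c.z r = 0 := by rw [hr]; simp [hA.z, hC.z]
  have hz' : c.z r' = 0 := by rw [hr']; simp [hA'.z, hC'.z]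
  set k := (c.y r' - c.y b) / (c.y r - c.y b) with hk
  have hne : c.y r - c.y b ≠ 0 := sub_ne_zero.2 hyr
  have hk0 : 0 < k := by
    have hiff := hp.symm.trans hp'
    rcases lt_or_gt_of_ne hyr with h1 | h1
    · have : c.y r' < c.y b := by
        rcases lt_or_gt_of_ne hyr' with h2 | h2
        · exact h2
        · have := hiff.2 h2; linarith
      exact div_pos_of_neg_of_neg (by linarith) (by linarith)
    · have := hiff.1 h1
      exact div_pos (by linarith) (by linarith)
  have hky : k * (c.y r - c.y b) = c.y r' - c.y b := by rw [hk]; field_simp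
  simp only [LinearMap.add_apply, LinearMap.smul_apply, smul_eq_mul] at hsr hsr'
  have hv : r' = b + k • (r - b) := by
    apply c.inj
    · simp only [map_add, map_smul, map_sub, smul_eq_mul]
      linear_combination hsr' - k * hsr + l * hky
    · simp only [map_add, map_smul, map_sub, smul_eq_mul]
      linarith
    · simp [hz, hz', hB.z]
  set ε := 1 / (2 * (1 + k)) with hε
  have h1k : 0 < 1 + k := by linarith
  have e0 : 0 < ε := by positivity
  have e3 : ε * (1 + k) = 1 / 2 := by rw [hε]; field_simp
  have e1 : ε < 1 := by nlinarith
  have e2 : ε * k < 1 := by nlinarith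
  have p1 := pos_comb hB.pos hR (mul_pos e0 hk0) e2
  have p2 := pos_comb hB.pos hR' e0 e1
  have : (1 - ε) • b + ε • r' = (1 - ε * k) • b + (ε * k) • r := by
    rw [hv]; module
  rw [this] at p2
  rw [← hS] at p1
  rw [← hS'] at p2
  exact c.faceM hF hF' p1 p2

lemma tri_side {c : Cfg} {l : ℝ} {S S' B : Finset Pt3} {b : Pt3} {pos pos' : Bool} (hb : b ∈ c.Q)
    (h : c.Tri l S B b pos) (h' : c.Tri l S' B b pos') : pos = pos' := by
  obtain ⟨hF, hB, R, r, t, A, a, C, e, hS, hR, hA, hC, -, t0, t1, hr, -, -, hsr, hyr, hp⟩ := h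
  obtain ⟨hF', -, R', r', t', A', a', C', e', hS', hR', hA', hC', -, t0', t1', hr', -, -, hsr',
    hyr', hp'⟩ := h'
  have d1 : c.x r ^ 2 + c.y r ^ 2 ≤ 1 := by
    apply c.disk_of_hull
    rw [hr]
    exact convex_convexHull ℝ _ hA.hull hC.hull (by linarith) t0.le (by ring)
  have d2 : c.x r' ^ 2 + c.y r' ^ 2 ≤ 1 := by
    apply c.disk_of_hull
    rw [hr']
    exact convex_convexHull ℝ _ hA'.hull hC'.hull (by linarith) t0'.le (by ring)
  have d3 := c.circ b hb
  simp only [LinearMap.add_apply, LinearMap.smul_apply, smul_eq_mul] at hsr hsr'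
  have g1 : c.x r = c.x b - l * (c.y r - c.y b) := by linarith
  have g2 : c.x r' = c.x b - l * (c.y r' - c.y b) := by linarith
  -- quadratic in the displacement
  have q1 : (1 + l ^ 2) * (c.y r - c.y b) ^ 2 + 2 * (c.y b - l * c.x b) * (c.y r - c.y b) ≤ 0 := by
    rw [g1] at d1; nlinarith
  have q2 : (1 + l ^ 2) * (c.y r' - c.y b) ^ 2 + 2 * (c.y b - l * c.x b) * (c.y r' - c.y b) ≤ 0 := by
    rw [g2] at d2; nlinarith
  have n1 : 0 < (1 + l ^ 2) * (c.y r - c.y b) ^ 2 := by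
    have : c.y r - c.y b ≠ 0 := sub_ne_zero.2 hyr
    positivity
  have n2 : 0 < (1 + l ^ 2) * (c.y r' - c.y b) ^ 2 := by
    have : c.y r' - c.y b ≠ 0 := sub_ne_zero.2 hyr'
    positivity
  have m1 : (c.y b - l * c.x b) * (c.y r - c.y b) < 0 := by linarith
  have m2 : (c.y b - l * c.x b) * (c.y r' - c.y b) < 0 := by linarith
  have hiff : c.y b < c.y r ↔ c.y b < c.y r' := by
    constructor
    · intro hh
      have : c.y b - l * c.x b < 0 := by
        by_contra hn
        push Not at hn
        nlinarith
      by_contra hn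
      push Not at hn
      nlinarith
    · intro hh
      have : c.y b - l * c.x b < 0 := by
        by_contra hn
        push Not at hn
        nlinarith
      by_contra hn
      push Not at hn
      nlinarith
  have := hp.trans (hiff.trans hp'.symm)
  exact Bool.eq_iff_iff.2 this

/-- two tetrahedra over the same horizontal triangle on the same side coincide -/
lemma cap_unique {c : Cfg} {S σ τ : Finset Pt3} (hσ : σ ∈ c.T) (hτ : τ ∈ c.T) (hS : S ⊆ c.Q)
    (hne : S.Nonempty)
    {i j : Fin 2} (h1 : σ = insert (c.v i) S) (h2 : τ = insert (c.v j) S) : σ = τ := by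
  have hi : c.v i ∉ S := fun h => c.vq_ne i (hS h) rfl
  have hj : c.v j ∉ S := fun h => c.vq_ne j (hS h) rfl
  have htop : c.v j ∈ affineSpan ℝ (σ : Set Pt3) := by
    have := (c.tet σ hσ).2
    have h3 := (this.affineSpan_eq_top_iff_card_eq_finrank_add_one).2 (by
      simp [(c.tet σ hσ).1])
    rw [Subtype.range_coe_subtype] at h3
    have h4 : {x | x ∈ (σ : Set Pt3)} = (σ : Set Pt3) := rfl
    rw [h4] at h3
    rw [h3]; trivial
  obtain ⟨w, hw1, hw2⟩ : ∃ w : Pt3 → ℝ, ∑ s ∈ σ, w s = 1 ∧ ∑ s ∈ σ, w s • s = c.v j := by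
    have h5 : (σ : Set Pt3) = Set.range (fun p : σ => (p : Pt3)) := by simp
    rw [h5] at htop
    obtain ⟨w, hw, he⟩ := eq_affineCombination_of_mem_affineSpan_of_fintype htop
    rw [Finset.affineCombination_eq_linear_combination _ _ _ hw] at he
    refine ⟨fun s => if h : s ∈ σ then w ⟨s, h⟩ else 0, ?_, ?_⟩
    · rw [← Finset.sum_coe_sort]
      rw [← hw]
      apply Finset.sum_congr rfl
      intro s _
      simp
    · rw [he, ← Finset.sum_coe_sort]
      apply Finset.sum_congr rfl
      intro s _
      simp
  subst h1
  rw [Finset.sum_insert hi] at hw1 hw2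
  have hwi : w (c.v i) = 1 := by
    have := congrArg c.z hw2
    rw [map_add, map_sum, map_smul, c.zv, c.zv, Finset.sum_eq_zero, add_zero, smul_eq_mul] at this
    · have hp := c.hpos
      exact mul_right_cancel₀ hp.ne' (by rw [this, one_mul])
    · intro s hs; rw [map_smul, c.zQ s (hS hs), smul_zero]
  rw [hwi] at hw1 hw2
  have hn : (0 : ℝ) < S.card := by exact_mod_cast hne.card_pos
  -- common interior point
  have hev : ∀ᶠ ε in nhdsWithin (0 : ℝ) (Ioi 0), ∀ s ∈ S, 0 < (1 - ε) / S.card + ε * w s := by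
    rw [Filter.eventually_all_finset]
    intro s hs
    apply nhdsWithin_le_nhds
    have hc : ContinuousAt (fun ε : ℝ => (1 - ε) / S.card + ε * w s) 0 := by fun_prop
    apply hc.eventually (lt_mem_nhds _)
    simp [hne.card_pos]
  have h1ev : ∀ᶠ ε in nhdsWithin (0 : ℝ) (Ioi 0), ε < 1 :=
    nhdsWithin_le_nhds (eventually_lt_nhds (by norm_num))
  obtain ⟨ε, ⟨e1, e2⟩, e3⟩ := ((hev.and h1ev).and self_mem_nhdsWithin).exists
  have e3 : 0 < ε := e3
  have key : ∀ (k : Fin 2) (f : Pt3 → ℝ), (∀ s ∈ S, 0 < f s) → ∑ s ∈ S, f s = 1 - ε →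
      Pos (insert (c.v k) S) (ε • c.v k + ∑ s ∈ S, f s • s) := by
    intro k f f0 f1
    have hk : c.v k ∉ S := fun h => c.vq_ne k (hS h) rfl
    have hs : ∀ s ∈ S, (if s = c.v k then ε else f s) = f s := by
      intro s hs
      rw [if_neg]; rintro rfl; exact hk hs
    refine ⟨fun s => if s = c.v k then ε else f s, ?_, ?_, ?_⟩
    · intro s hs'
      dsimp only
      split_ifs with h
      · exact e3
      · exact f0 s ((Finset.mem_insert.1 hs').resolve_left h)
    · rw [Finset.sum_insert hk, Finset.sum_congr rfl hs, f1]; simp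
    · rw [Finset.sum_insert hk]
      beta_reduce
      rw [if_pos rfl]
      congr 1
      apply Finset.sum_congr rfl
      intro s h; rw [hs s h]
  have p1 := key i (fun s => (1 - ε) / S.card + ε * w s) e1 (by
    rw [Finset.sum_add_distrib, ← Finset.mul_sum]
    have : ∑ s ∈ S, w s = 0 := by linarith
    rw [this]; simp; field_simp)
  have p2 := key j (fun s => (1 - ε) / S.card) (fun s _ => div_pos (by linarith) hn) (by
    simp; field_simp)
  have e : ε • c.v i + ∑ s ∈ S, ((1 - ε) / S.card + ε * w s) • s =
      ε • c.v j + ∑ s ∈ S, ((1 - ε) / S.card) • s := by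
    rw [← hw2]
    simp_rw [add_smul, mul_smul]
    rw [Finset.sum_add_distrib, ← Finset.smul_sum (r := ε)]
    module
  rw [e] at p1
  rw [h2]
  exact c.faceM ⟨_, hσ, subset_rfl⟩ ⟨_, hτ, h2 ▸ subset_rfl⟩ p1 p2

end Cfg


namespace Cfg

/-- number of upper apices in `σ` -/
def nv (c : Cfg) (σ : Finset Pt3) : ℕ :=
  (if c.v 0 ∈ σ then 1 else 0) + (if c.v 1 ∈ σ then 1 else 0)

/-- number of lower apices in `σ` -/
def nu (c : Cfg) (σ : Finset Pt3) : ℕ :=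
  (if c.u 0 ∈ σ then 1 else 0) + (if c.u 1 ∈ σ then 1 else 0)

lemma nv0 {c : Cfg} {σ : Finset Pt3} (h : c.nv σ = 0) : ∀ i, c.v i ∉ σ := by
  unfold nv at h
  intro i
  split_ifs at h <;> fin_cases i <;> simp_all

lemma nv1 {c : Cfg} {σ : Finset Pt3} (h : c.nv σ = 1) :
    ∃ i, c.v i ∈ σ ∧ ∀ i', c.v i' ∈ σ → i' = i := by
  unfold nv at h
  split_ifs at h with h1 h2 h2
  · simp at h
  · refine ⟨0, h1, fun i' hi => ?_⟩
    fin_cases i'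
    · rfl
    · exact (h2 hi).elim
  · refine ⟨1, h2, fun i' hi => ?_⟩
    fin_cases i'
    · exact (h1 hi).elim
    · rfl
  · simp at h

lemma nv2 {c : Cfg} {σ : Finset Pt3} (h : c.nv σ = 2) : ∀ i, c.v i ∈ σ := by
  unfold nv at h
  intro i
  split_ifs at h <;> fin_cases i <;> simp_all

lemma nu0 {c : Cfg} {σ : Finset Pt3} (h : c.nu σ = 0) : ∀ i, c.u i ∉ σ := nv0 (c := c.swap) h

lemma nu1 {c : Cfg} {σ : Finset Pt3} (h : c.nu σ = 1) :
    ∃ i, c.u i ∈ σ ∧ ∀ i', c.u i' ∈ σ → i' = i := nv1 (c := c.swap) h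

lemma nu2 {c : Cfg} {σ : Finset Pt3} (h : c.nu σ = 2) : ∀ i, c.u i ∈ σ := nv2 (c := c.swap) h

lemma nv_le (c : Cfg) (σ : Finset Pt3) : c.nv σ ≤ 2 := by
  unfold nv; split_ifs <;> simp

lemma nu_le (c : Cfg) (σ : Finset Pt3) : c.nu σ ≤ 2 := c.swap.nv_le σ

lemma card_split (c : Cfg) {σ : Finset Pt3} (hσ : σ ∈ c.T) :
    (σ.filter (· ∈ c.Q)).card + c.nv σ + c.nu σ = 4 := by
  have h1 := Finset.card_filter_add_card_filter_not (s := σ) (· ∈ c.Q)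
  rw [(c.tet σ hσ).1] at h1
  have h2 : σ.filter (¬ · ∈ c.Q) = ({c.v 0, c.v 1, c.u 0, c.u 1} : Finset Pt3).filter (· ∈ σ) := by
    ext k
    simp only [Finset.mem_filter, Finset.mem_insert, Finset.mem_singleton]
    constructor
    · rintro ⟨h, h'⟩
      refine ⟨?_, h⟩
      rcases c.vert σ hσ k h with h3 | ⟨i, rfl⟩ | ⟨i, rfl⟩
      · exact (h' h3).elim
      · fin_cases i <;> simp
      · fin_cases i <;> simp
    · rintro ⟨h, h'⟩
      refine ⟨h', fun hq => ?_⟩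
      rcases h with h | h | h | h
      · exact c.vq_ne 0 hq h
      · exact c.vq_ne 1 hq h
      · exact c.uq_ne 0 hq h
      · exact c.uq_ne 1 hq h
  rw [h2, Finset.card_filter (fun x => x ∈ σ)] at h1
  rw [Finset.sum_insert, Finset.sum_insert, Finset.sum_insert, Finset.sum_singleton] at h1
  · unfold nv nu
    omega
  · simp [c.hu]
  · simp [c.vu_ne]
  · simp [c.vu_ne, c.hv]

/-- the triangle `S` is the section of `σ` -/
def Good (c : Cfg) (σ S : Finset Pt3) : Prop :=
  S = σ ∨ ∃ i, σ = insert (c.v i) S ∧ S ⊆ c.Q ∧ S.Nonempty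

lemma Good.sub {c : Cfg} {σ S : Finset Pt3} (h : c.Good σ S) : S ⊆ σ := by
  rcases h with rfl | ⟨i, rfl, -⟩
  · exact subset_rfl
  · exact Finset.subset_insert _ _

lemma good_unique {c : Cfg} {σ τ S : Finset Pt3} (hσ : σ ∈ c.T) (hτ : τ ∈ c.T) (h1 : c.Good σ S)
    (h2 : c.Good τ S) : σ = τ := by
  have key : ∀ {σ S : Finset Pt3}, σ ∈ c.T → S ∈ c.T → ∀ i, σ = insert (c.v i) S → S ⊆ c.Q →
      False := by
    intro σ S hσ hS i h h'
    have hc := (c.tet σ hσ).1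
    rw [h, Finset.card_insert_of_notMem (fun hh => c.vq_ne i (h' hh) rfl), (c.tet S hS).1] at hc
    omega
  rcases h1 with rfl | ⟨i, h3, h4, h5⟩ <;> rcases h2 with rfl | ⟨j, h6, h7, h8⟩
  · rfl
  · exact (key hτ hσ j h6 h7).elim
  · exact (key hσ hτ i h3 h4).elim
  · exact cap_unique hσ hτ h4 h5 h3 h6

/-- targets -/
abbrev Tg := Pt3 ⊕ ((Fin 2 × Fin 2) × Bool)

/-- support of the middle vertex of a target -/
def tag (c : Cfg) : Tg → Finset Pt3
  | Sum.inl b => {b}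
  | Sum.inr p => {c.v p.1.1, c.u p.1.2}

/-- incidence between tetrahedra and targets -/
def Rel (c : Cfg) (l : ℝ) (σ : Finset Pt3) : Tg → Prop
  | Sum.inl b => b ∈ c.Q ∧ ∃ S pos, c.Good σ S ∧ c.Tri l S {b} b pos
  | Sum.inr p => ∃ S, c.Good σ S ∧ c.Tri l S {c.v p.1.1, c.u p.1.2} (c.O p.1.1 p.1.2) p.2

lemma rel_unique {c : Cfg} {l : ℝ} {σ τ : Finset Pt3} (hσ : σ ∈ c.T) (hτ : τ ∈ c.T) {t : Tg}
    (h1 : c.Rel l σ t) (h2 : c.Rel l τ t) : σ = τ := by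
  rcases t with b | p
  · obtain ⟨hb, S, pos, hS, ht⟩ := h1
    obtain ⟨-, S', pos', hS', ht'⟩ := h2
    have := tri_side hb ht ht'
    subst this
    have := tri_unique ht ht'
    subst this
    exact good_unique hσ hτ hS hS'
  · obtain ⟨S, hS, ht⟩ := h1
    obtain ⟨S', hS', ht'⟩ := h2
    have := tri_unique ht ht'
    subst this
    exact good_unique hσ hτ hS hS'

/-- number of edges from an upper to a lower apex -/
def XX (c : Cfg) : ℕ :=
  ((Finset.univ : Finset (Fin 2 × Fin 2)).filter (fun p => c.Face {c.v p.1, c.u p.2})).card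

lemma exists_targets (c : Cfg) (hQ : 2 ≤ c.Q.card) {l : ℝ}
    (hl : ∀ A a B b, c.Site A a → c.Site B b → a ≠ b →
      (c.x + l • c.y) a ≠ (c.x + l • c.y) b) :
    ∃ G : Finset Tg, G.card + 2 = c.Q.card + 2 * c.XX ∧
      ∀ σ S B b pos, c.Good σ S → c.Tri l S B b pos → ∃ t ∈ G, c.Rel l σ t ∧ c.tag t = B := by
  set s := c.x + l • c.y with hs
  have hne : c.Q.Nonempty := Finset.card_pos.1 (by omega)
  obtain ⟨q1, hq1, h1⟩ := Finset.exists_min_image c.Q s hne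
  obtain ⟨q2, hq2, h2⟩ := Finset.exists_max_image c.Q s hne
  have h12 : q1 ≠ q2 := by
    rintro rfl
    obtain ⟨a, ha, b, hb, hab⟩ := Finset.one_lt_card.1 (by omega : 1 < c.Q.card)
    have := hl {a} a {b} b (Or.inl ⟨rfl, ha⟩) (Or.inl ⟨rfl, hb⟩) hab
    apply this
    apply le_antisymm
    · exact (h2 a ha).trans (h1 b hb)
    · exact (h2 b hb).trans (h1 a ha)
  have hullmin : ∀ w ∈ convexHull ℝ (c.Q : Set Pt3), s q1 ≤ s w := by
    intro w hw
    have hc : Convex ℝ {w | s q1 ≤ s w} := convex_halfSpace_ge s.isLinear _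
    exact convexHull_min (fun q hq => h1 q hq) hc hw
  have hullmax : ∀ w ∈ convexHull ℝ (c.Q : Set Pt3), s w ≤ s q2 := by
    intro w hw
    have hc : Convex ℝ {w | s w ≤ s q2} := convex_halfSpace_le s.isLinear _
    exact convexHull_min (fun q hq => h2 q hq) hc hw
  refine ⟨((c.Q.erase q1).erase q2).disjSum
    (((Finset.univ : Finset (Fin 2 × Fin 2)).filter (fun p => c.Face {c.v p.1, c.u p.2})) ×ˢ
      (Finset.univ : Finset Bool)), ?_, ?_⟩
  · rw [Finset.card_disjSum, Finset.card_product, Finset.card_erase_of_mem, Finset.card_erase_of_mem hq1]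
    · simp only [XX, Finset.card_univ, Fintype.card_bool]
      omega
    · exact Finset.mem_erase.2 ⟨h12.symm, hq2⟩
  · intro σ S B b pos hg ht
    have ht' := ht
    obtain ⟨hF, hB, R, r, t, A, a, C, e, hS, hR, hA, hC, -, -, -, hr, hab, hbe, -⟩ := ht
    rcases hB with ⟨rfl, hb⟩ | ⟨i, j, rfl, rfl⟩
    · refine ⟨Sum.inl b, ?_, ⟨hb, S, pos, hg, ht'⟩, rfl⟩
      rw [Finset.inl_mem_disjSum, Finset.mem_erase, Finset.mem_erase]
      refine ⟨?_, ?_, hb⟩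
      · rintro rfl
        exact absurd hbe (not_lt.2 (hullmax e hC.hull))
      · rintro rfl
        exact absurd hab (not_lt.2 (hullmin a hA.hull))
    · refine ⟨Sum.inr ((i, j), pos), ?_, ⟨S, hg, ht'⟩, rfl⟩
      rw [Finset.inr_mem_disjSum]
      simp only [Finset.mem_product, Finset.mem_filter, Finset.mem_univ, true_and, and_true]
      exact hF.mono (hS ▸ Finset.subset_union_left)

/-- the section weight of a tetrahedron -/
def wt (c : Cfg) (σ : Finset Pt3) : ℕ :=
  if c.nu σ = 0 then (if c.nv σ = 1 then 1 else 0) else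
    if c.nv σ = 0 then 0 else if c.nv σ = 2 ∧ c.nu σ = 2 then 2 else 1

lemma site_ne {c : Cfg} {A B S : Finset Pt3} {a b : Pt3} (hS : c.Face S) (hA : c.Site A a)
    (hB : c.Site B b) (h1 : A ⊆ S) (h2 : B ⊆ S) (hne : A ≠ B) : a ≠ b := by
  rintro rfl
  exact hne (c.faceM (hS.mono h1) (hS.mono h2) hA.pos hB.pos)

lemma three_sites {c : Cfg} {l : ℝ}
    (hl : ∀ A a B b, c.Site A a → c.Site B b → a ≠ b →
      (c.x + l • c.y) a ≠ (c.x + l • c.y) b) {A B C S : Finset Pt3} {a b e : Pt3}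
    (hF : c.Face S) (hS : S = A ∪ (B ∪ C)) (hA : c.Site A a) (hB : c.Site B b) (hC : c.Site C e)
    (hAB : A ≠ B) (hBC : B ≠ C) (hAC : A ≠ C) : ∃ B' b' pos, c.Tri l S B' b' pos := by
  set s := c.x + l • c.y with hs
  have sA : A ⊆ S := hS ▸ Finset.subset_union_left
  have sB : B ⊆ S := hS ▸ (Finset.subset_union_left.trans Finset.subset_union_right)
  have sC : C ⊆ S := hS ▸ (Finset.subset_union_right.trans Finset.subset_union_right)
  have n1 := hl _ _ _ _ hA hB (site_ne hF hA hB sA sB hAB)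
  have n2 := hl _ _ _ _ hB hC (site_ne hF hB hC sB sC hBC)
  have n3 := hl _ _ _ _ hA hC (site_ne hF hA hC sA sC hAC)
  have go : ∀ {A B C : Finset Pt3} {a b e : Pt3}, S = B ∪ (A ∪ C) → c.Site A a → c.Site B b →
      c.Site C e → s a < s b → s b < s e → ∃ B' b' pos, c.Tri l S B' b' pos := by
    intro A B C a b e hS hA hB hC h1 h2
    subst hS
    obtain ⟨pos, h⟩ := tri_exists hF hA hB hC h1 h2
    exact ⟨B, b, pos, h⟩
  have eB : S = B ∪ (A ∪ C) := by rw [hS]; ext; simp; tauto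
  have eB' : S = B ∪ (C ∪ A) := by rw [hS]; ext; simp; tauto
  have eA' : S = A ∪ (C ∪ B) := by rw [hS]; ext; simp; tauto
  have eC : S = C ∪ (A ∪ B) := by rw [hS]; ext; simp; tauto
  have eC' : S = C ∪ (B ∪ A) := by rw [hS]; ext; simp; tauto
  rcases lt_or_gt_of_ne n1 with m1 | m1 <;> rcases lt_or_gt_of_ne n2 with m2 | m2 <;>
    rcases lt_or_gt_of_ne n3 with m3 | m3
  · exact go eB hA hB hC m1 m2
  · exact absurd (m1.trans m2) (not_lt.2 m3.le)
  · exact go eC hA hC hB m3 m2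
  · exact go eA' hC hA hB m3 m1
  · exact go hS hB hA hC m1 m3
  · exact go eC' hB hC hA m2 m3
  · exact absurd (m2.trans m1) (not_lt.2 m3.le)
  · exact go eB' hC hB hA m2 m1

lemma pair_inj {c : Cfg} {i j i' j' : Fin 2}
    (h : ({c.v i, c.u j} : Finset Pt3) = {c.v i', c.u j'}) : i = i' ∧ j = j' := by
  have e1 : c.v i ∈ ({c.v i', c.u j'} : Finset Pt3) := by rw [← h]; simp
  have e2 : c.u j ∈ ({c.v i', c.u j'} : Finset Pt3) := by rw [← h]; simp
  simp only [Finset.mem_insert, Finset.mem_singleton] at e1 e2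
  exact ⟨c.v_inj (e1.resolve_right (c.vu_ne _ _)), c.u_inj (e2.resolve_left (c.vu_ne _ _).symm)⟩

lemma pair_single {c : Cfg} {i j : Fin 2} {q : Pt3} :
    ({q} : Finset Pt3) ≠ {c.v i, c.u j} := by
  intro h
  have := congrArg Finset.card h
  rw [Finset.card_pair (c.vu_ne _ _)] at this
  simp at this

lemma section_one {c : Cfg} {l : ℝ}
    (hl : ∀ A a B b, c.Site A a → c.Site B b → a ≠ b →
      (c.x + l • c.y) a ≠ (c.x + l • c.y) b) {σ : Finset Pt3} (hσ : σ ∈ c.T) (h : c.wt σ = 1) :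
    ∃ S B b pos, c.Good σ S ∧ c.Tri l S B b pos := by
  have hcard := c.card_split hσ
  have l1 := c.nv_le σ
  have l2 := c.nu_le σ
  have hQs : ∀ k ∈ σ.filter (· ∈ c.Q), k ∈ σ ∧ k ∈ c.Q := fun k hk => Finset.mem_filter.1 hk
  have hsplit : ∀ k ∈ σ, k ∈ σ.filter (· ∈ c.Q) ∨ (∃ i, k = c.v i) ∨ (∃ j, k = c.u j) := by
    intro k hk
    rcases c.vert σ hσ k hk with h | h
    · exact Or.inl (Finset.mem_filter.2 ⟨hk, h⟩)
    · exact Or.inr h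
  set qs := σ.filter (· ∈ c.Q) with hqs
  have hFσ : c.Face σ := ⟨σ, hσ, subset_rfl⟩
  unfold wt at h
  split_ifs at h with a1 a2 a3 a4 <;> try omega
  · -- three base vertices
    have h3 : qs.card = 3 := by omega
    obtain ⟨q1, q2, q3, n12, n13, n23, hq⟩ := Finset.card_eq_three.1 h3
    obtain ⟨i, hi, hi'⟩ := nv1 a2
    have hu := nu0 a1
    have hg : c.Good σ qs := by
      refine Or.inr ⟨i, ?_, fun k hk => (hQs k hk).2, Finset.card_pos.1 (by omega)⟩
      ext k
      rw [Finset.mem_insert]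
      constructor
      · intro hk
        rcases hsplit k hk with h | ⟨i', rfl⟩ | ⟨j, rfl⟩
        · exact Or.inr h
        · exact Or.inl (by rw [hi' i' hk])
        · exact (hu j hk).elim
      · rintro (rfl | hk)
        · exact hi
        · exact (hQs k hk).1
    have hm : ∀ k ∈ ({q1, q2, q3} : Finset Pt3), c.Site {k} k := by
      intro k hk; rw [← hq] at hk; exact Or.inl ⟨rfl, (hQs k hk).2⟩
    obtain ⟨B, b, pos, ht⟩ := three_sites hl (S := qs) (hFσ.mono hg.sub)
      (A := {q1}) (B := {q2}) (C := {q3}) (by rw [hq]; rfl) (hm q1 (by simp)) (hm q2 (by simp))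
      (hm q3 (by simp)) (by simpa using n12) (by simpa using n23) (by simpa using n13)
    exact ⟨qs, B, b, pos, hg, ht⟩
  · have hv0 := c.nv σ
    have : c.nv σ = 1 ∧ c.nu σ = 1 ∨ c.nv σ = 2 ∧ c.nu σ = 1 ∨ c.nv σ = 1 ∧ c.nu σ = 2 := by omega
    rcases this with ⟨b1, b2⟩ | ⟨b1, b2⟩ | ⟨b1, b2⟩
    · obtain ⟨i, hi, hi'⟩ := nv1 b1
      obtain ⟨j, hj, hj'⟩ := nu1 b2
      obtain ⟨q1, q2, n12, hq⟩ := Finset.card_eq_two.1 (by omega : qs.card = 2)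
      have hm : ∀ k ∈ ({q1, q2} : Finset Pt3), c.Site {k} k := by
        intro k hk; rw [← hq] at hk; exact Or.inl ⟨rfl, (hQs k hk).2⟩
      have hS : σ = {q1} ∪ ({q2} ∪ {c.v i, c.u j}) := by
        ext k
        constructor
        · intro hk
          rcases hsplit k hk with h | ⟨i', rfl⟩ | ⟨j', rfl⟩
          · rw [hq] at h; simp at h ⊢; tauto
          · rw [hi' i' hk]; simp
          · rw [hj' j' hk]; simp
        · intro hk
          have : k ∈ qs ∨ k = c.v i ∨ k = c.u j := by rw [hq]; simp at hk ⊢; tauto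
          rcases this with h | rfl | rfl
          · exact (hQs k h).1
          · exact hi
          · exact hj
      obtain ⟨B, b, pos, ht⟩ := three_sites hl hFσ hS (hm q1 (by simp)) (hm q2 (by simp))
        (Or.inr ⟨i, j, rfl, rfl⟩) (by simpa using n12) pair_single pair_single
      exact ⟨σ, B, b, pos, Or.inl rfl, ht⟩
    · have hi := nv2 b1
      obtain ⟨j, hj, hj'⟩ := nu1 b2
      obtain ⟨q1, hq⟩ := Finset.card_eq_one.1 (by omega : qs.card = 1)
      have hm : ∀ k ∈ ({q1} : Finset Pt3), c.Site {k} k := by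
        intro k hk; rw [← hq] at hk; exact Or.inl ⟨rfl, (hQs k hk).2⟩
      have hS : σ = {q1} ∪ ({c.v 0, c.u j} ∪ {c.v 1, c.u j}) := by
        ext k
        constructor
        · intro hk
          rcases hsplit k hk with h | ⟨i', rfl⟩ | ⟨j', rfl⟩
          · rw [hq] at h; simp at h ⊢; tauto
          · fin_cases i' <;> simp
          · rw [hj' j' hk]; simp
        · intro hk
          have : k ∈ qs ∨ k = c.v 0 ∨ k = c.v 1 ∨ k = c.u j := by rw [hq]; simp at hk ⊢; tauto
          rcases this with h | rfl | rfl | rfl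
          · exact (hQs k h).1
          · exact hi 0
          · exact hi 1
          · exact hj
      obtain ⟨B, b, pos, ht⟩ := three_sites hl hFσ hS (hm q1 (by simp))
        (Or.inr ⟨0, j, rfl, rfl⟩) (Or.inr ⟨1, j, rfl, rfl⟩) pair_single
        (fun h => by simpa using (pair_inj h).1) pair_single
      exact ⟨σ, B, b, pos, Or.inl rfl, ht⟩
    · have hj := nu2 b2
      obtain ⟨i, hi, hi'⟩ := nv1 b1
      obtain ⟨q1, hq⟩ := Finset.card_eq_one.1 (by omega : qs.card = 1)
      have hm : ∀ k ∈ ({q1} : Finset Pt3), c.Site {k} k := by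
        intro k hk; rw [← hq] at hk; exact Or.inl ⟨rfl, (hQs k hk).2⟩
      have hS : σ = {q1} ∪ ({c.v i, c.u 0} ∪ {c.v i, c.u 1}) := by
        ext k
        constructor
        · intro hk
          rcases hsplit k hk with h | ⟨i', rfl⟩ | ⟨j', rfl⟩
          · rw [hq] at h; simp at h ⊢; tauto
          · rw [hi' i' hk]; simp
          · fin_cases j' <;> simp
        · intro hk
          have : k ∈ qs ∨ k = c.u 0 ∨ k = c.u 1 ∨ k = c.v i := by rw [hq]; simp at hk ⊢; tauto
          rcases this with h | rfl | rfl | rfl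
          · exact (hQs k h).1
          · exact hj 0
          · exact hj 1
          · exact hi
      obtain ⟨B, b, pos, ht⟩ := three_sites hl hFσ hS (hm q1 (by simp))
        (Or.inr ⟨i, 0, rfl, rfl⟩) (Or.inr ⟨i, 1, rfl, rfl⟩) pair_single
        (fun h => by simpa using (pair_inj h).2) pair_single
      exact ⟨σ, B, b, pos, Or.inl rfl, ht⟩

lemma section_two {c : Cfg} {l : ℝ}
    (hl : ∀ A a B b, c.Site A a → c.Site B b → a ≠ b →
      (c.x + l • c.y) a ≠ (c.x + l • c.y) b) {σ : Finset Pt3} (hσ : σ ∈ c.T) (h : c.wt σ = 2) :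
    ∃ B b pos B' b' pos', B ≠ B' ∧ c.Tri l σ B b pos ∧ c.Tri l σ B' b' pos' := by
  have hcard := c.card_split hσ
  have hFσ : c.Face σ := ⟨σ, hσ, subset_rfl⟩
  have h22 : c.nv σ = 2 ∧ c.nu σ = 2 := by
    unfold wt at h
    split_ifs at h with h1 h2 h3 h4 <;> try omega
  have hv := nv2 h22.1
  have hu := nu2 h22.2
  have hq0 : σ.filter (· ∈ c.Q) = ∅ := Finset.card_eq_zero.1 (by omega)
  have hσ4 : ∀ k ∈ σ, (∃ i, k = c.v i) ∨ ∃ j, k = c.u j := by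
    intro k hk
    rcases c.vert σ hσ k hk with h | h
    · have : k ∈ σ.filter (· ∈ c.Q) := Finset.mem_filter.2 ⟨hk, h⟩
      rw [hq0] at this; simp at this
    · exact h
  set s := c.x + l • c.y with hs
  let g : Fin 2 × Fin 2 → ℝ := fun p => s (c.O p.1 p.2)
  have site : ∀ p : Fin 2 × Fin 2, c.Site {c.v p.1, c.u p.2} (c.O p.1 p.2) :=
    fun p => Or.inr ⟨p.1, p.2, rfl, rfl⟩
  have sub : ∀ p : Fin 2 × Fin 2, {c.v p.1, c.u p.2} ⊆ σ := by
    intro p k hk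
    simp only [Finset.mem_insert, Finset.mem_singleton] at hk
    rcases hk with rfl | rfl
    · exact hv _
    · exact hu _
  have ginj : ∀ p p', g p = g p' → p = p' := by
    intro p p' hpp
    by_contra hne
    refine hl _ _ _ _ (site p) (site p') (site_ne hFσ (site p) (site p') (sub p) (sub p') ?_) hpp
    intro h
    obtain ⟨h1, h2⟩ := pair_inj h
    exact hne (Prod.ext h1 h2)
  obtain ⟨p1, -, hp1⟩ := Finset.exists_min_image (Finset.univ : Finset (Fin 2 × Fin 2)) g ⟨0, by simp⟩
  obtain ⟨p2, -, hp2⟩ := Finset.exists_max_image (Finset.univ : Finset (Fin 2 × Fin 2)) g ⟨0, by simp⟩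
  have h12 : p1 ≠ p2 := by
    rintro rfl
    have := ginj (0, 0) (1, 1) (le_antisymm ((hp2 _ (by simp)).trans (hp1 _ (by simp)))
      ((hp2 _ (by simp)).trans (hp1 _ (by simp))))
    simp at this
  have hc : (((Finset.univ : Finset (Fin 2 × Fin 2)).erase p1).erase p2).card = 2 := by
    rw [Finset.card_erase_of_mem (Finset.mem_erase.2 ⟨h12.symm, by simp⟩),
      Finset.card_erase_of_mem (by simp)]
    simp
  obtain ⟨b1, b2, hb12, hb⟩ := Finset.card_eq_two.1 hc
  have hbm : ∀ b ∈ ({b1, b2} : Finset (Fin 2 × Fin 2)), ∃ pos,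
      c.Tri l σ {c.v b.1, c.u b.2} (c.O b.1 b.2) pos := by
    intro b hbb
    rw [← hb] at hbb
    simp only [Finset.mem_erase, Finset.mem_univ, and_true] at hbb
    have cov3 : ∀ p1 p2 b : Fin 2 × Fin 2, p1 ≠ p2 → b ≠ p1 → b ≠ p2 →
        (∀ i : Fin 2, i = b.1 ∨ i = p1.1 ∨ i = p2.1) ∧ (∀ i : Fin 2, i = b.2 ∨ i = p1.2 ∨ i = p2.2) := by
      decide
    obtain ⟨c1, c2⟩ := cov3 p1 p2 b h12 hbb.2 hbb.1
    have hS : σ = {c.v b.1, c.u b.2} ∪ ({c.v p1.1, c.u p1.2} ∪ {c.v p2.1, c.u p2.2}) := by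
      apply Finset.Subset.antisymm
      · intro k hk
        rcases hσ4 k hk with ⟨i, rfl⟩ | ⟨j, rfl⟩
        · rcases c1 i with h | h | h <;> rw [h] <;> simp
        · rcases c2 j with h | h | h <;> rw [h] <;> simp
      · exact Finset.union_subset (sub b) (Finset.union_subset (sub p1) (sub p2))
    have := tri_exists (l := l) (hS ▸ hFσ) (site p1) (site b) (site p2)
      (lt_of_le_of_ne (hp1 b (by simp)) (fun h => hbb.2 (ginj _ _ h).symm))
      (lt_of_le_of_ne (hp2 b (by simp)) (fun h => hbb.1 (ginj _ _ h)))
    rwa [← hS] at this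
  obtain ⟨pos, t1⟩ := hbm b1 (by simp)
  obtain ⟨pos', t2⟩ := hbm b2 (by simp)
  refine ⟨_, _, pos, _, _, pos', ?_, t1, t2⟩
  intro h
  obtain ⟨h1, h2⟩ := pair_inj h
  exact hb12 (Prod.ext h1 h2)

lemma sweep (c : Cfg) (hQ : 2 ≤ c.Q.card) : ∑ σ ∈ c.T, c.wt σ + 2 ≤ c.Q.card + 2 * c.XX := by
  obtain ⟨l, hl⟩ := c.exists_slope
  obtain ⟨G, hG, hGt⟩ := c.exists_targets hQ hl
  rw [← hG]
  have h1 : ∑ σ ∈ c.T, c.wt σ ≤ ∑ σ ∈ c.T, (G.filter (fun t => c.Rel l σ t)).card := by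
    apply Finset.sum_le_sum
    intro σ hσ
    have hw : c.wt σ = 0 ∨ c.wt σ = 1 ∨ c.wt σ = 2 := by
      unfold wt; split_ifs <;> simp
    rcases hw with h | h | h
    · omega
    · rw [h]
      obtain ⟨S, B, b, pos, hg, ht⟩ := section_one hl hσ h
      obtain ⟨t, htG, hr, -⟩ := hGt σ S B b pos hg ht
      exact Finset.card_pos.2 ⟨t, Finset.mem_filter.2 ⟨htG, hr⟩⟩
    · rw [h]
      obtain ⟨B, b, pos, B', b', pos', hne, ht, ht'⟩ := section_two hl hσ h
      obtain ⟨t, htG, hr, htag⟩ := hGt σ σ B b pos (Or.inl rfl) ht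
      obtain ⟨t', htG', hr', htag'⟩ := hGt σ σ B' b' pos' (Or.inl rfl) ht'
      apply Finset.one_lt_card.2
      exact ⟨t, Finset.mem_filter.2 ⟨htG, hr⟩, t', Finset.mem_filter.2 ⟨htG', hr'⟩,
        fun h => hne (by rw [← htag, ← htag', h])⟩
  have h2 : ∑ σ ∈ c.T, (G.filter (fun t => c.Rel l σ t)).card =
      ∑ t ∈ G, (c.T.filter (fun σ => c.Rel l σ t)).card :=
    Finset.sum_card_bipartiteAbove_eq_sum_card_bipartiteBelow (c.Rel l)
  have h3 : ∑ t ∈ G, (c.T.filter (fun σ => c.Rel l σ t)).card ≤ ∑ t ∈ G, 1 := by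
    apply Finset.sum_le_sum
    intro t _
    rw [Finset.card_le_one]
    intro σ hσ τ hτ
    rw [Finset.mem_filter] at hσ hτ
    exact rel_unique hσ.1 hτ.1 hσ.2 hτ.2
  simp at h3
  omega

end Cfg


namespace Cfg

/-- tetrahedra with two upper apices only -/
def cB (c : Cfg) : ℕ := (c.T.filter (fun σ => c.nv σ = 2 ∧ c.nu σ = 0)).card
/-- tetrahedra with one upper and one lower apex -/
def cC (c : Cfg) (i j : Fin 2) : ℕ :=
  (c.T.filter (fun σ => c.v i ∈ σ ∧ c.u j ∈ σ ∧ c.nv σ = 1 ∧ c.nu σ = 1)).card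
/-- tetrahedra with two upper and one lower apex -/
def cD (c : Cfg) (j : Fin 2) : ℕ :=
  (c.T.filter (fun σ => c.nv σ = 2 ∧ c.nu σ = 1 ∧ c.u j ∈ σ)).card
/-- tetrahedra with all four apices -/
def cE (c : Cfg) : ℕ := (c.T.filter (fun σ => c.nv σ = 2 ∧ c.nu σ = 2)).card

lemma swap_nv (c : Cfg) (σ : Finset Pt3) : c.swap.nv σ = c.nu σ := rfl
lemma swap_nu (c : Cfg) (σ : Finset Pt3) : c.swap.nu σ = c.nv σ := rfl
lemma swap_cE (c : Cfg) : c.swap.cE = c.cE := by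
  unfold cE
  congr 1
  apply Finset.filter_congr
  intro σ _
  rw [swap_nv, swap_nu, and_comm]

lemma not_flat (c : Cfg) {σ : Finset Pt3} (hσ : σ ∈ c.T) : ¬ (c.nv σ = 0 ∧ c.nu σ = 0) := by
  rintro ⟨h1, h2⟩
  have hQ : ∀ k ∈ σ, k ∈ c.Q := by
    intro k hk
    rcases c.vert σ hσ k hk with h | ⟨i, rfl⟩ | ⟨j, rfl⟩
    · exact h
    · exact (nv0 h1 i hk).elim
    · exact (nu0 h2 j hk).elim
  have h3 := ((c.tet σ hσ).2.affineSpan_eq_top_iff_card_eq_finrank_add_one).2 (by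
      simp [(c.tet σ hσ).1])
  rw [Subtype.range_coe_subtype] at h3
  have h4 : {x | x ∈ (σ : Set Pt3)} = (σ : Set Pt3) := rfl
  rw [h4] at h3
  have h5 : affineSpan ℝ (σ : Set Pt3) ≤ (LinearMap.ker c.z).toAffineSubspace := by
    rw [affineSpan_le]
    intro k hk
    exact c.zQ k (hQ k hk)
  rw [h3] at h5
  have h6 : c.v 0 ∈ (LinearMap.ker c.z).toAffineSubspace := h5 (AffineSubspace.mem_top ℝ Pt3 _)
  have h7 : c.z (c.v 0) = 0 := h6
  rw [c.zv] at h7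
  linarith [c.hpos]

lemma count1 (c : Cfg) : c.T.card + (c.cC 0 0 + c.cC 0 1 + c.cC 1 0 + c.cC 1 1) + (c.cD 0 + c.cD 1) +
    (c.swap.cD 0 + c.swap.cD 1) + 3 * c.cE =
    ∑ σ ∈ c.T, c.wt σ + ∑ σ ∈ c.T, c.swap.wt σ + c.cB + c.swap.cB := by
  have e1 : c.T.card = ∑ σ ∈ c.T, 1 := by simp
  have e2 : c.swap.T = c.T := rfl
  unfold cC cD cE cB
  rw [e1, e2]
  simp only [Finset.card_filter, Finset.mul_sum, ← Finset.sum_add_distrib]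
  apply Finset.sum_congr rfl
  intro σ hσ
  have h0 := c.not_flat hσ
  have f0 : c.swap.u = c.v := rfl
  unfold wt
  simp only [swap_nv, swap_nu, f0]
  unfold nv nu at *
  by_cases a1 : c.v 0 ∈ σ <;> by_cases a2 : c.v 1 ∈ σ <;> by_cases a3 : c.u 0 ∈ σ <;>
    by_cases a4 : c.u 1 ∈ σ <;> simp [a1, a2, a3, a4] at h0 ⊢

lemma count2 (c : Cfg) : (c.T.filter (fun σ => c.v 0 ∈ σ ∧ c.v 1 ∈ σ)).card =
    c.cB + c.cD 0 + c.cD 1 + c.cE := by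
  unfold cD cE cB
  simp only [Finset.card_filter, ← Finset.sum_add_distrib]
  apply Finset.sum_congr rfl
  intro σ hσ
  unfold nv nu
  by_cases a1 : c.v 0 ∈ σ <;> by_cases a2 : c.v 1 ∈ σ <;> by_cases a3 : c.u 0 ∈ σ <;>
    by_cases a4 : c.u 1 ∈ σ <;> simp [a1, a2, a3, a4]

lemma count3 (c : Cfg) (i j : Fin 2) : (c.T.filter (fun σ => c.v i ∈ σ ∧ c.u j ∈ σ)).card =
    c.cC i j + c.cD j + c.swap.cD i + c.cE := by
  have e2 : c.swap.T = c.T := rfl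
  have f0 : c.swap.u = c.v := rfl
  unfold cC cD cE
  rw [e2]
  simp only [Finset.card_filter, ← Finset.sum_add_distrib]
  apply Finset.sum_congr rfl
  intro σ hσ
  simp only [swap_nv, swap_nu, f0]
  unfold nv nu
  by_cases a1 : c.v 0 ∈ σ <;> by_cases a2 : c.v 1 ∈ σ <;> by_cases a3 : c.u 0 ∈ σ <;>
    by_cases a4 : c.u 1 ∈ σ <;> fin_cases i <;> fin_cases j <;> simp [a1, a2, a3, a4]

lemma count4 (c : Cfg) (j : Fin 2) :
    (c.T.filter (fun σ => c.v 0 ∈ σ ∧ c.v 1 ∈ σ ∧ c.u j ∈ σ)).card = c.cD j + c.cE := by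
  unfold cD cE
  simp only [Finset.card_filter, ← Finset.sum_add_distrib]
  apply Finset.sum_congr rfl
  intro σ hσ
  unfold nv nu
  by_cases a1 : c.v 0 ∈ σ <;> by_cases a2 : c.v 1 ∈ σ <;> by_cases a3 : c.u 0 ∈ σ <;>
    by_cases a4 : c.u 1 ∈ σ <;> fin_cases j <;> simp [a1, a2, a3, a4]

lemma edge_three (c : Cfg) {i j : Fin 2} (h : c.Face {c.v i, c.u j}) :
    3 ≤ c.cC i j + c.cD j + c.swap.cD i + c.cE := by
  rw [← count3]
  obtain ⟨σ, hσ, hs⟩ := h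
  have hv : c.v i ∈ σ := hs (by simp)
  have hu : c.u j ∈ σ := hs (by simp)
  obtain ⟨a, b, hab, ha1, ha2, hb1, hb2, rfl⟩ := four_of_two (c.tet σ hσ).1 hv hu (c.vu_ne i j)
  obtain ⟨τ, hτ, t1, t2⟩ := c.triangle hσ (i := i) (j := j) (a := a) (b := b)
    (by intro k; simp; tauto) (by simp [hb1, hb2, hab.symm])
  obtain ⟨ρ, hρ, r1, r2⟩ := c.triangle hσ (i := i) (j := j) (a := b) (b := a)
    (by intro k; simp; tauto) (by simp [ha1, ha2, hab])
  apply Finset.two_lt_card.2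
  refine ⟨_, Finset.mem_filter.2 ⟨hσ, by simp⟩, τ, Finset.mem_filter.2 ⟨hτ, t1 (by simp), t1 (by simp)⟩,
    ρ, Finset.mem_filter.2 ⟨hρ, r1 (by simp), r1 (by simp)⟩, ?_, ?_, ?_⟩
  · rintro rfl; exact t2 (by simp)
  · rintro rfl; exact r2 (by simp)
  · rintro rfl; exact r2 (t1 (by simp))

lemma edge_zero (c : Cfg) {i j : Fin 2} (h : ¬ c.Face {c.v i, c.u j}) :
    c.cC i j = 0 ∧ c.cD j = 0 ∧ c.swap.cD i = 0 ∧ c.cE = 0 := by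
  have := c.count3 i j
  rw [Finset.filter_false_of_mem] at this
  · simp at this; omega
  · rintro σ hσ ⟨h1, h2⟩
    apply h
    refine ⟨σ, hσ, ?_⟩
    intro k hk
    simp at hk
    rcases hk with rfl | rfl <;> assumption

lemma apex_two (c : Cfg) {j : Fin 2} (h : c.u j ∈ c.K) : 2 ≤ c.cD j + c.cE := by
  rw [← count4]
  obtain ⟨-, -, σ, hσ, hs⟩ := c.mem_K.1 h
  have h0 : c.v 0 ∈ σ := hs (by simp)
  have h1 : c.v 1 ∈ σ := hs (by simp)
  have h2 : c.u j ∈ σ := hs (by simp)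
  have hc : (σ \ {c.v 0, c.v 1, c.u j}).Nonempty := by
    apply Finset.card_pos.1
    rw [Finset.card_sdiff_of_subset hs, (c.tet σ hσ).1]
    have := Finset.card_le_three (a := c.v 0) (b := c.v 1) (c := c.u j)
    omega
  obtain ⟨b, hb⟩ := hc
  rw [Finset.mem_sdiff] at hb
  obtain ⟨τ, hτ, t1, t2⟩ := c.triangle hσ (i := 0) (j := j) (a := c.v 1) (b := b)
    (by intro k hk; apply hs; simp at hk ⊢; tauto) (by have := hb.2; simp at this ⊢; tauto)
  apply Finset.one_lt_card.2
  refine ⟨σ, Finset.mem_filter.2 ⟨hσ, h0, h1, h2⟩, τ,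
    Finset.mem_filter.2 ⟨hτ, t1 (by simp), t1 (by simp), t1 (by simp)⟩, ?_⟩
  rintro rfl
  exact t2 hb.1

lemma apex_zero (c : Cfg) {j : Fin 2} (h : c.u j ∉ c.K) : c.cD j = 0 ∧ c.cE = 0 := by
  have := c.count4 j
  rw [Finset.filter_false_of_mem] at this
  · simp at this; omega
  · rintro σ hσ ⟨h0, h1, h2⟩
    apply h
    rw [mem_K]
    refine ⟨(c.vu_ne 0 j).symm, (c.vu_ne 1 j).symm, σ, hσ, ?_⟩
    intro k hk
    simp at hk
    rcases hk with rfl | rfl | rfl <;> assumption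

lemma apex_edge (c : Cfg) {j : Fin 2} (h : c.u j ∈ c.K) (i : Fin 2) : c.Face {c.v i, c.u j} := by
  obtain ⟨-, -, hF⟩ := c.mem_K.1 h
  apply hF.mono
  intro k hk
  simp at hk ⊢
  rcases hk with rfl | rfl
  · fin_cases i <;> simp
  · simp

lemma K_card (c : Cfg) : c.K.card = (c.Q.filter (· ∈ c.K)).card +
    ((if c.u 0 ∈ c.K then 1 else 0) + (if c.u 1 ∈ c.K then 1 else 0)) := by
  have h1 := Finset.card_filter_add_card_filter_not (s := c.K) (· ∈ c.Q)
  have h2 : c.K.filter (¬ · ∈ c.Q) = ({c.u 0, c.u 1} : Finset Pt3).filter (· ∈ c.K) := by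
    ext k
    simp only [Finset.mem_filter, Finset.mem_insert, Finset.mem_singleton]
    constructor
    · rintro ⟨h, h'⟩
      refine ⟨?_, h⟩
      rcases c.K_vert h with h3 | ⟨j, rfl⟩
      · exact (h' h3).elim
      · fin_cases j <;> simp
    · rintro ⟨h, h'⟩
      refine ⟨h', fun hq => ?_⟩
      rcases h with h | h
      · exact c.uq_ne 0 hq h
      · exact c.uq_ne 1 hq h
  have h3 : c.K.filter (· ∈ c.Q) = c.Q.filter (· ∈ c.K) := by
    ext k; simp only [Finset.mem_filter]; tauto
  rw [h2, h3, Finset.card_filter (fun x => x ∈ c.K) {c.u 0, c.u 1}, Finset.sum_pair c.hu] at h1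
  omega

lemma K_empty (c : Cfg) (h : ¬ c.K.Nonempty) : c.cB = 0 := by
  have := c.count2
  rw [Finset.filter_false_of_mem] at this
  · simp at this; omega
  · rintro σ hσ ⟨h0, h1⟩
    obtain ⟨a, b, hab, ha1, ha2, hb1, hb2, hs⟩ := four_of_two (c.tet σ hσ).1 h0 h1 c.hv
    apply h
    refine ⟨a, c.mem_K.2 ⟨ha1, ha2, σ, hσ, ?_⟩⟩
    rw [hs]
    intro k; simp; tauto

lemma no_cycle (c : Cfg) {a b k : Pt3} (ha : a ∈ c.K) (hb : b ∈ c.K) (hk : k ∈ c.K) (hab : a ≠ b)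
    (hak : a ≠ k) (hbk : b ≠ k) (h1 : c.Face {c.v 0, c.v 1, a, b})
    (h2 : c.Face {c.v 0, c.v 1, a, k}) (h3 : c.Face {c.v 0, c.v 1, b, k}) : False := by
  have sw : ∀ {a b : Pt3}, c.Face {c.v 0, c.v 1, a, b} → c.Face {c.v 0, c.v 1, b, a} := by
    intro a b h
    apply h.mono
    intro k; simp; tauto
  have n1 : c.f a ≠ c.f b := fun h => hab (c.L1 ha hb h)
  have n2 : c.f a ≠ c.f k := fun h => hak (c.L1 ha hk h)
  have n3 : c.f b ≠ c.f k := fun h => hbk (c.L1 hb hk h)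
  rcases lt_or_gt_of_ne n1 with m1 | m1 <;> rcases lt_or_gt_of_ne n2 with m2 | m2 <;>
    rcases lt_or_gt_of_ne n3 with m3 | m3
  · exact c.L3 ha hk hb h2 m1 m3
  · exact c.L3 ha hb hk h1 m2 m3
  · linarith
  · exact c.L3 hk hb ha (sw h3) m2 m1
  · exact c.L3 hb hk ha h3 m1 m2
  · linarith
  · exact c.L3 hb ha hk (sw h1) m3 m2
  · exact c.L3 hk ha hb (sw h2) m3 m1

lemma cE_le (c : Cfg) : c.cE ≤ 1 := by
  unfold cE
  rw [Finset.card_le_one]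
  intro σ hσ τ hτ
  rw [Finset.mem_filter] at hσ hτ
  have key : ∀ σ : Finset Pt3, σ ∈ c.T → c.nv σ = 2 ∧ c.nu σ = 2 →
      σ = {c.v 0, c.v 1, c.u 0, c.u 1} := by
    intro σ hσ h
    symm
    apply Finset.eq_of_subset_of_card_le
    · intro k hk
      simp at hk
      rcases hk with rfl | rfl | rfl | rfl
      · exact nv2 h.1 0
      · exact nv2 h.1 1
      · exact nu2 h.2 0
      · exact nu2 h.2 1
    · rw [(c.tet σ hσ).1, Finset.card_insert_of_notMem, Finset.card_insert_of_notMem,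
        Finset.card_pair c.hu]
      · simp [c.vu_ne]
      · simp [c.vu_ne, c.hv]
  rw [key σ hσ.1 hσ.2, key τ hτ.1 hτ.2]

/-- every tetrahedron with two upper and one lower apex -/
lemma D_shape (c : Cfg) {j : Fin 2} {σ : Finset Pt3} (hσ : σ ∈ c.T) (h1 : c.nv σ = 2)
    (h2 : c.nu σ = 1) (h3 : c.u j ∈ σ) :
    ∃ q ∈ c.Q, q ∈ σ ∧ (∀ q' ∈ σ, q' ∈ c.Q → q' = q) ∧ {c.v 0, c.v 1, c.u j, q} ⊆ σ := by
  have hc := c.card_split hσ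
  obtain ⟨q, hq⟩ := Finset.card_eq_one.1 (by omega : (σ.filter (· ∈ c.Q)).card = 1)
  have hm : q ∈ σ.filter (· ∈ c.Q) := by rw [hq]; simp
  rw [Finset.mem_filter] at hm
  refine ⟨q, hm.2, hm.1, ?_, ?_⟩
  · intro q' h4 h5
    have : q' ∈ σ.filter (· ∈ c.Q) := Finset.mem_filter.2 ⟨h4, h5⟩
    rw [hq] at this
    simpa using this
  · intro k hk
    simp at hk
    rcases hk with rfl | rfl | rfl | rfl
    · exact nv2 h1 0
    · exact nv2 h1 1
    · exact h3
    · exact hm.1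

lemma E_case (c : Cfg) (hE : 1 ≤ c.cE) (i : Fin 2) (h0 : c.cD 0 = 1) (h1 : c.cD 1 = 1)
    (hi : c.swap.cD i = 1) : 1 ≤ c.cC i 0 + c.cC i 1 := by
  by_contra hcon
  have hC : ∀ j, c.cC i j = 0 := by intro j; fin_cases j <;> simp <;> omega
  have hD : ∀ j, c.cD j = 1 := by intro j; fin_cases j <;> assumption
  have huK : ∀ j, c.u j ∈ c.K := by
    intro j
    by_contra h
    have := (c.apex_zero h).2
    omega
  obtain ⟨σE, hσE⟩ := Finset.card_pos.1 (by unfold cE at hE; exact hE)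
  rw [Finset.mem_filter] at hσE
  -- for each j a base vertex
  have step : ∀ j, ∃ q ∈ c.Q, c.Face {c.v 0, c.v 1, c.u j, q} ∧
      ∃ τ ∈ c.T, c.nu τ = 2 ∧ c.nv τ = 1 ∧ c.v i ∈ τ ∧ q ∈ τ := by
    intro j
    have hDj := hD j
    obtain ⟨σ, hσ⟩ := Finset.card_pos.1 (by unfold cD at hDj; rw [hDj]; exact one_pos)
    rw [Finset.mem_filter] at hσ
    obtain ⟨hσ, s1, s2, s3⟩ := hσ
    obtain ⟨q, hq, hqσ, -, hsub⟩ := c.D_shape hσ s1 s2 s3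
    refine ⟨q, hq, ⟨σ, hσ, hsub⟩, ?_⟩
    obtain ⟨i', hi', hi''⟩ : ∃ i' : Fin 2, i' ≠ i ∧ ∀ k, k = i ∨ k = i' := by
      fin_cases i
      · exact ⟨1, by simp, by decide⟩
      · exact ⟨0, by simp, by decide⟩
    obtain ⟨τ, hτ, t1, t2⟩ := c.triangle hσ (i := i) (j := j) (a := q) (b := c.v i')
      (by
        intro k hk
        simp at hk
        rcases hk with rfl | rfl | rfl
        · exact nv2 s1 i
        · exact s3
        · exact hqσ)
      (by
        simp only [Finset.mem_insert, Finset.mem_singleton, not_or]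
        exact ⟨fun h => hi' (c.v_inj h), c.vu_ne _ _, (c.vq_ne i' hq).symm⟩)
    have hvi : c.v i ∈ τ := t1 (by simp)
    have huj : c.u j ∈ τ := t1 (by simp)
    have n1 : c.nv τ = 1 := by
      have hle := c.nv_le τ
      have g0 : c.nv τ ≠ 0 := fun h => nv0 h i hvi
      have g2 : c.nv τ ≠ 2 := fun h => t2 (nv2 h i')
      omega
    have n2 : c.nu τ = 2 := by
      have hle := c.nu_le τ
      have g0 : c.nu τ ≠ 0 := fun h => nu0 h j huj
      have g1 : c.nu τ ≠ 1 := by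
        intro h
        have h2 := hC j
        unfold cC at h2
        rw [Finset.card_eq_zero] at h2
        have : τ ∈ (∅ : Finset (Finset Pt3)) := by
          rw [← h2]; exact Finset.mem_filter.2 ⟨hτ, hvi, huj, n1, h⟩
        simp at this
      omega
    exact ⟨τ, hτ, n2, n1, hvi, t1 (by simp)⟩
  obtain ⟨q0, hq0, F0, τ0, hτ0, a1, a2, a3, a4⟩ := step 0
  obtain ⟨q1, hq1, F1, τ1, hτ1, b1, b2, b3, b4⟩ := step 1
  have hττ : τ0 = τ1 := by
    unfold cD at hi
    exact (Finset.card_le_one.1 hi.le) τ0 (Finset.mem_filter.2 ⟨hτ0, a1, a2, a3⟩) τ1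
      (Finset.mem_filter.2 ⟨hτ1, b1, b2, b3⟩)
  subst hττ
  obtain ⟨q, -, -, hu, -⟩ := c.swap.D_shape hτ0 a1 a2 a3
  have e0 := hu q0 a4 hq0
  have e1 := hu q1 b4 hq1
  rw [e0] at F0 hq0
  rw [e1] at F1
  have hqK : q ∈ c.K := by
    rw [mem_K]
    refine ⟨c.vq_ne 0 hq0, c.vq_ne 1 hq0, F0.mono ?_⟩
    intro k; simp; tauto
  have FE : c.Face {c.v 0, c.v 1, c.u 0, c.u 1} := by
    refine ⟨σE, hσE.1, ?_⟩
    intro k hk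
    simp at hk
    rcases hk with rfl | rfl | rfl | rfl
    · exact nv2 hσE.2.1 0
    · exact nv2 hσE.2.1 1
    · exact nu2 hσE.2.2 0
    · exact nu2 hσE.2.2 1
  exact c.no_cycle (huK 0) (huK 1) hqK c.hu (c.uq_ne 0 hq0).symm (c.uq_ne 1 hq0).symm FE F0 F1

lemma XX_eq (c : Cfg) : c.XX = ((if c.Face {c.v 0, c.u 0} then 1 else 0) +
    (if c.Face {c.v 0, c.u 1} then 1 else 0)) + ((if c.Face {c.v 1, c.u 0} then 1 else 0) +
    (if c.Face {c.v 1, c.u 1} then 1 else 0)) := by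
  unfold XX
  rw [Finset.card_filter, Fintype.sum_prod_type]
  simp only [Fin.sum_univ_two]

lemma swap_XX (c : Cfg) : c.swap.XX = c.XX := by
  have hF : ∀ i j, c.swap.Face {c.swap.v i, c.swap.u j} = c.Face {c.v j, c.u i} := by
    intro i j
    have : ({c.swap.v i, c.swap.u j} : Finset Pt3) = {c.v j, c.u i} := Finset.pair_comm _ _
    rw [this]; rfl
  rw [XX_eq, XX_eq]
  simp only [hF]
  ring

lemma bound (c : Cfg) (hQ : 2 ≤ c.Q.card) : 2 * c.T.card ≤ 7 * c.Q.card + 2 := by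
  have s1 := c.sweep hQ
  have s2 := c.swap.sweep hQ
  have hQs : c.swap.Q = c.Q := rfl
  have hTs : c.swap.T = c.T := rfl
  rw [swap_XX, hQs, hTs] at s2
  have c1 := c.count1
  have k1 := c.count2
  have k2 := c.swap.count2
  rw [swap_cE] at k2
  have K1 := c.K_card
  have K2 := c.swap.K_card
  have l1 := c.link_count
  have l2 := c.swap.link_count
  have m1 := c.K_empty
  have m2 := c.swap.K_empty
  obtain ⟨p1, p2⟩ := c.planar
  have fs : ∀ i, c.swap.u i = c.v i := fun _ => rfl
  rw [hQs, fs, fs] at K2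
  rw [k1] at l1
  rw [k2] at l2
  have N1 : (c.Q.filter (· ∈ c.K)).card ≤ c.Q.card := Finset.card_filter_le _ _
  have N2 : (c.Q.filter (· ∈ c.swap.K)).card ≤ c.Q.card := Finset.card_filter_le _ _
  generalize (c.Q.filter (· ∈ c.K)).card = n1 at *
  generalize (c.Q.filter (· ∈ c.swap.K)).card = n2 at *
  have q1 : ¬ c.K.Nonempty → c.K.card = 0 := fun h => by
    rw [Finset.not_nonempty_iff_eq_empty] at h; rw [h]; simp
  have q2 : ¬ c.swap.K.Nonempty → c.swap.K.card = 0 := fun h => by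
    rw [Finset.not_nonempty_iff_eq_empty] at h; rw [h]; simp
  have E1 := c.cE_le
  have aK : ∀ j, c.u j ∈ c.K → 2 ≤ c.cD j + c.cE ∧ c.Face {c.v 0, c.u j} ∧ c.Face {c.v 1, c.u j} :=
    fun j h => ⟨c.apex_two h, c.apex_edge h 0, c.apex_edge h 1⟩
  have aK' : ∀ i, c.v i ∈ c.swap.K →
      2 ≤ c.swap.cD i + c.cE ∧ c.Face {c.v i, c.u 0} ∧ c.Face {c.v i, c.u 1} := by
    intro i h
    refine ⟨?_, ?_, ?_⟩
    · have := c.swap.apex_two h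
      rwa [swap_cE] at this
    · have := c.swap.apex_edge h 0
      rw [Finset.pair_comm] at this
      exact this
    · have := c.swap.apex_edge h 1
      rw [Finset.pair_comm] at this
      exact this
  have zK : ∀ j, c.u j ∉ c.K → c.cD j = 0 ∧ c.cE = 0 := fun j h => c.apex_zero h
  have zK' : ∀ i, c.v i ∉ c.swap.K → c.swap.cD i = 0 ∧ c.cE = 0 := by
    intro i h
    have := c.swap.apex_zero h
    rwa [swap_cE] at this
  have ee : ∀ i j, 3 * (if c.Face {c.v i, c.u j} then 1 else 0) ≤
      c.cC i j + c.cD j + c.swap.cD i + c.cE := by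
    intro i j
    split_ifs with h
    · exact c.edge_three h
    · simp
  have hX := c.XX_eq
  have e00 := ee 0 0
  have e01 := ee 0 1
  have e10 := ee 1 0
  have e11 := ee 1 1
  have aK0 := aK 0
  have aK1 := aK 1
  have aK0' := aK' 0
  have aK1' := aK' 1
  have zK0 := zK 0
  have zK1 := zK 1
  have zK0' := zK' 0
  have zK1' := zK' 1
  have hEc : 1 ≤ c.cE → c.cD 0 = 1 → c.cD 1 = 1 → c.swap.cD 0 = 1 → c.swap.cD 1 = 1 →
      2 ≤ c.cC 0 0 + c.cC 0 1 + c.cC 1 0 + c.cC 1 1 := by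
    intro h h0 h1 h2 h3
    have := c.E_case h 0 h0 h1 h2
    have := c.E_case h 1 h0 h1 h3
    omega
  have p2a : c.u 0 ∉ c.K → c.u 1 ∉ c.K → 2 * (n1 + n2) ≤ 3 * c.Q.card + 2 := by
    intro h0 h1
    apply p2
    left
    intro j; fin_cases j <;> assumption
  have p2b : c.v 0 ∉ c.swap.K → c.v 1 ∉ c.swap.K → 2 * (n1 + n2) ≤ 3 * c.Q.card + 2 := by
    intro h0 h1
    apply p2
    right
    intro j; fin_cases j <;> assumption
  have ite01 : ∀ p : Prop, (if p then 1 else 0 : ℕ) ≤ 1 := by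
    intro p; split_ifs <;> simp
  have b00 := ite01 (c.Face {c.v 0, c.u 0})
  have b01 := ite01 (c.Face {c.v 0, c.u 1})
  have b10 := ite01 (c.Face {c.v 1, c.u 0})
  have b11 := ite01 (c.Face {c.v 1, c.u 1})
  have i00 : c.Face {c.v 0, c.u 0} → (if c.Face {c.v 0, c.u 0} then 1 else 0 : ℕ) = 1 := fun h => if_pos h
  have i01 : c.Face {c.v 0, c.u 1} → (if c.Face {c.v 0, c.u 1} then 1 else 0 : ℕ) = 1 := fun h => if_pos h
  have i10 : c.Face {c.v 1, c.u 0} → (if c.Face {c.v 1, c.u 0} then 1 else 0 : ℕ) = 1 := fun h => if_pos h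
  have i11 : c.Face {c.v 1, c.u 1} → (if c.Face {c.v 1, c.u 1} then 1 else 0 : ℕ) = 1 := fun h => if_pos h
  clear p2 aK aK' zK zK' ee ite01 fs hTs hQs s1 s2
  have s1 := c.sweep hQ
  have s2 : ∑ σ ∈ c.T, c.swap.wt σ + 2 ≤ c.Q.card + 2 * c.XX := by
    have := c.swap.sweep hQ
    rw [swap_XX] at this
    exact this
  generalize (if c.Face {c.v 0, c.u 0} then 1 else 0 : ℕ) = f00 at *
  generalize (if c.Face {c.v 0, c.u 1} then 1 else 0 : ℕ) = f01 at *
  generalize (if c.Face {c.v 1, c.u 0} then 1 else 0 : ℕ) = f10 at *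
  generalize (if c.Face {c.v 1, c.u 1} then 1 else 0 : ℕ) = f11 at *
  generalize c.Face {c.v 0, c.u 0} = F00 at *
  generalize c.Face {c.v 0, c.u 1} = F01 at *
  generalize c.Face {c.v 1, c.u 0} = F10 at *
  generalize c.Face {c.v 1, c.u 1} = F11 at *
  generalize ∑ σ ∈ c.T, c.wt σ = W at *
  generalize ∑ σ ∈ c.T, c.swap.wt σ = W' at *
  generalize c.cC 0 0 = C00 at *
  generalize c.cC 0 1 = C01 at *
  generalize c.cC 1 0 = C10 at *
  generalize c.cC 1 1 = C11 at *
  generalize c.cD 0 = D0 at *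
  generalize c.cD 1 = D1 at *
  generalize c.swap.cD 0 = D0' at *
  generalize c.swap.cD 1 = D1' at *
  generalize c.cE = E at *
  generalize c.cB = B at *
  generalize c.swap.cB = B' at *
  generalize c.K.card = k at *
  generalize c.swap.K.card = k' at *
  generalize c.XX = X at *
  generalize c.Q.card = m at *
  generalize c.T.card = t at *
  have l1' : B = 0 ∧ k = 0 ∨ B + D0 + D1 + E + 1 ≤ k := by
    by_cases h : c.K.Nonempty
    · exact Or.inr (l1 h)
    · exact Or.inl ⟨m1 h, q1 h⟩
  have l2' : B' = 0 ∧ k' = 0 ∨ B' + D0' + D1' + E + 1 ≤ k' := by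
    by_cases h : c.swap.K.Nonempty
    · exact Or.inr (l2 h)
    · exact Or.inl ⟨m2 h, q2 h⟩
  clear l1 l2 m1 m2 q1 q2 k1 k2
  have hE01 : E = 0 ∨ E = 1 := by omega
  by_cases u0 : c.u 0 ∈ c.K <;> by_cases u1 : c.u 1 ∈ c.K <;> by_cases v0 : c.v 0 ∈ c.swap.K <;>
    by_cases v1 : c.v 1 ∈ c.swap.K <;>
    simp only [u0, u1, v0, v1, if_true, if_false, forall_true_left, not_true_eq_false,
      not_false_eq_true, true_implies, false_implies] at * <;>
    rcases l1' with l1' | l1' <;> rcases l2' with l2' | l2' <;>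
    rcases hE01 with hE01 | hE01 <;> simp only [hE01] at * <;> grind

end Cfg


/-- vertex of the regular polygon with integer index -/
def rp (m : ℕ) (k : ℤ) : Pt3 :=
  ![Real.cos (2 * Real.pi * k / m), Real.sin (2 * Real.pi * k / m), 0]

lemma rp_add_mul (m : ℕ) (hm : 0 < m) (k l : ℤ) : rp m (k + m * l) = rp m k := by
  have hm' : (m : ℝ) ≠ 0 := by positivity
  have e : 2 * Real.pi * ((k + m * l : ℤ) : ℝ) / m = 2 * Real.pi * k / m + l * (2 * Real.pi) := by
    push_cast; field_simp
  unfold rp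
  rw [e, Real.cos_add_int_mul_two_pi, Real.sin_add_int_mul_two_pi]

lemma rp_mem (m : ℕ) (hm : 0 < m) (k : ℤ) : rp m k ∈ regPoly m := by
  have h1 : k = k % m + m * (k / m) := (Int.emod_add_mul_ediv k m).symm
  have h0 : 0 ≤ k % (m : ℤ) := Int.emod_nonneg _ (by positivity)
  have h2 : k % (m : ℤ) < m := Int.emod_lt_of_pos _ (by positivity)
  rw [h1, rp_add_mul m hm]
  obtain ⟨n, hn⟩ := Int.eq_ofNat_of_zero_le h0
  rw [hn] at h2 ⊢
  unfold regPoly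
  rw [Finset.mem_image]
  refine ⟨⟨n, by exact_mod_cast h2⟩, Finset.mem_univ _, ?_⟩
  simp [rp]

lemma mem_rp (m : ℕ) (q : Pt3) (hq : q ∈ regPoly m) : ∃ k : ℤ, q = rp m k := by
  unfold regPoly at hq
  rw [Finset.mem_image] at hq
  obtain ⟨k, -, rfl⟩ := hq
  exact ⟨(k.1 : ℤ), by simp [rp]⟩

lemma card_regPoly (m : ℕ) : (regPoly m).card = m := by
  unfold regPoly
  rw [Finset.card_image_of_injective, Finset.card_univ, Fintype.card_fin]
  intro k l hkl
  have h0 := congrFun hkl 0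
  have h1 := congrFun hkl 1
  simp only [Matrix.cons_val_zero, Matrix.cons_val_one] at h0 h1
  have h2 := Real.Angle.cos_sin_inj h0 h1
  rw [Real.Angle.angle_eq_iff_two_pi_dvd_sub] at h2
  obtain ⟨n, hn⟩ := h2
  have hm : (0 : ℝ) < m := by exact_mod_cast k.pos
  have h3 : (k.1 : ℝ) - l.1 = m * n := by
    have hp := Real.pi_pos
    field_simp at hn
    linarith
  have h4 : (k.1 : ℤ) - l.1 = m * n := by exact_mod_cast h3
  have hk := k.2
  have hl := l.2
  have h5 : n = 0 := by
    by_contra hne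
    rcases lt_or_gt_of_ne hne with hlt | hgt
    · have : (m : ℤ) * n ≤ m * (-1) := by
        apply mul_le_mul_of_nonneg_left <;> omega
      omega
    · have : (m : ℤ) * 1 ≤ m * n := by
        apply mul_le_mul_of_nonneg_left <;> omega
      omega
  rw [h5] at h4
  apply Fin.ext
  omega

lemma rp_circ (m : ℕ) (k : ℤ) : rp m k 0 ^ 2 + rp m k 1 ^ 2 = 1 := by
  simp [rp]

lemma rp_z (m : ℕ) (k : ℤ) : rp m k 2 = 0 := by
  simp [rp]

lemma rp_neg (m n : ℕ) (hm : 0 < m) (hn : m = n + n) (k : ℤ) : -rp m k = rp m (k + n) := by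
  have hm' : (m : ℝ) ≠ 0 := by positivity
  have hr : (m : ℝ) = 2 * n := by rw [hn]; push_cast; ring
  have e : 2 * Real.pi * ((k + n : ℤ) : ℝ) / m = 2 * Real.pi * k / m + Real.pi := by
    push_cast; field_simp; rw [hr]; ring
  unfold rp
  rw [e, Real.cos_add_pi, Real.sin_add_pi]
  ext i; fin_cases i <;> simp

lemma rp_add0 (m : ℕ) (k l : ℤ) :
    rp m (k + l) 0 = rp m k 0 * rp m l 0 - rp m k 1 * rp m l 1 := by
  have e : 2 * Real.pi * ((k + l : ℤ) : ℝ) / m = 2 * Real.pi * k / m + 2 * Real.pi * l / m := by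
    push_cast; ring
  simp only [rp, Matrix.cons_val_zero, Matrix.cons_val_one]
  rw [e, Real.cos_add]

lemma rp_add1 (m : ℕ) (k l : ℤ) :
    rp m (k + l) 1 = rp m k 0 * rp m l 1 + rp m k 1 * rp m l 0 := by
  have e : 2 * Real.pi * ((k + l : ℤ) : ℝ) / m = 2 * Real.pi * k / m + 2 * Real.pi * l / m := by
    push_cast; ring
  simp only [rp, Matrix.cons_val_zero, Matrix.cons_val_one]
  rw [e, Real.sin_add]; ring

lemma reg_coset (m : ℕ) (hm : 0 < m) (a b c : Pt3) (ha : a ∈ regPoly m) (hb : b ∈ regPoly m)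
    (hc : c ∈ regPoly m) : ∃ d ∈ regPoly m, c 0 * d 0 - c 1 * d 1 = a 0 * b 0 - a 1 * b 1 ∧
      c 0 * d 1 + c 1 * d 0 = a 0 * b 1 + a 1 * b 0 := by
  obtain ⟨i, rfl⟩ := mem_rp m a ha
  obtain ⟨j, rfl⟩ := mem_rp m b hb
  obtain ⟨k, rfl⟩ := mem_rp m c hc
  refine ⟨rp m (i + j - k), rp_mem m hm _, ?_, ?_⟩
  · rw [← rp_add0, ← rp_add0]; rw [show k + (i + j - k) = i + j by ring]
  · rw [← rp_add1, ← rp_add1]; rw [show k + (i + j - k) = i + j by ring]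

/-- horizontal vectors are directions of the plane of the polygon -/
lemma horiz_dir (m : ℕ) (hm : 3 ≤ m) (he : Even m) (d : Pt3) (hd : d 2 = 0) :
    d ∈ (affineSpan ℝ (convexHull ℝ (regPoly m : Set Pt3))).direction := by
  have hm0 : 0 < m := by omega
  obtain ⟨n, hn⟩ := he
  have key : ∀ k l : ℤ, rp m k - rp m l ∈
      (affineSpan ℝ (convexHull ℝ (regPoly m : Set Pt3))).direction := by
    intro k l
    rw [affineSpan_convexHull]
    exact AffineSubspace.vsub_mem_direction
      (subset_affineSpan ℝ _ (by exact_mod_cast rp_mem m hm0 k))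
      (subset_affineSpan ℝ _ (by exact_mod_cast rp_mem m hm0 l))
  have k1 := key 0 (0 + n)
  rw [← rp_neg m n hm0 hn 0] at k1
  have k2 := key 1 0
  have hs : 0 < Real.sin (2 * Real.pi / m) := by
    have hp := Real.pi_pos
    have : (3 : ℝ) ≤ m := by exact_mod_cast hm
    apply Real.sin_pos_of_pos_of_lt_pi
    · positivity
    · rw [div_lt_iff₀ (by linarith)]; nlinarith
  set s := Real.sin (2 * Real.pi / m) with hsd
  set cc := Real.cos (2 * Real.pi / m) with hcd
  have e : d = ((d 0 - d 1 / s * (cc - 1)) / 2) • (rp m 0 - -rp m 0)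
      + (d 1 / s) • (rp m 1 - rp m 0) := by
    ext i
    fin_cases i
    · simp [rp, ← hsd, ← hcd]; ring
    · simp [rp, ← hsd, ← hcd]; field_simp
    · simp [rp, hd]
  rw [e]
  exact Submodule.add_mem _ (Submodule.smul_mem _ _ k1) (Submodule.smul_mem _ _ k2)

lemma intr_event (S : Set Pt3) (o d : Pt3) (ho : o ∈ intrinsicInterior ℝ S)
    (hd : d ∈ (affineSpan ℝ S).direction) :
    ∀ᶠ ε in nhdsWithin (0 : ℝ) (Ioi 0), o + ε • d ∈ S := by
  rw [mem_intrinsicInterior] at ho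
  obtain ⟨w, hw, rfl⟩ := ho
  have hmem : ∀ ε : ℝ, (w : Pt3) + ε • d ∈ affineSpan ℝ S := by
    intro ε
    rw [add_comm]
    exact AffineSubspace.vadd_mem_of_mem_direction (Submodule.smul_mem _ _ hd) w.2
  let f : ℝ → affineSpan ℝ S := fun ε => ⟨(w : Pt3) + ε • d, hmem ε⟩
  have hf : Continuous f := by
    apply Continuous.subtype_mk
    fun_prop
  have h0 : f 0 = w := by
    apply Subtype.ext; simp [f]
  have hn : interior ((↑) ⁻¹' S : Set (affineSpan ℝ S)) ∈ nhds (f 0) := by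
    rw [h0]; exact isOpen_interior.mem_nhds hw
  have := hf.continuousAt.preimage_mem_nhds hn
  have h3 : ∀ᶠ ε in nhds (0 : ℝ), (w : Pt3) + ε • d ∈ S := by
    filter_upwards [this] with ε hε
    have h5 : f ε ∈ ((↑) ⁻¹' S : Set (affineSpan ℝ S)) := interior_subset hε
    exact h5
  exact h3.filter_mono nhdsWithin_le_nhds

lemma event_scale (P : Set Pt3) (o d : Pt3) (s : ℝ) (hs : 0 < s)
    (h : ∀ᶠ ε in nhdsWithin (0 : ℝ) (Ioi 0), o + ε • d ∈ P) :
    ∀ᶠ ε in nhdsWithin (0 : ℝ) (Ioi 0), o + ε • (s • d) ∈ P := by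
  have ht : Filter.Tendsto (fun ε : ℝ => ε * s) (nhdsWithin (0 : ℝ) (Ioi 0))
      (nhdsWithin (0 : ℝ) (Ioi 0)) := by
    apply tendsto_nhdsWithin_of_tendsto_nhds_of_eventually_within
    · have : Filter.Tendsto (fun ε : ℝ => ε * s) (nhds 0) (nhds (0 * s)) :=
        (continuous_id.mul continuous_const).tendsto 0
      rw [zero_mul] at this
      exact this.mono_left nhdsWithin_le_nhds
    · filter_upwards [self_mem_nhdsWithin] with ε hε
      exact mul_pos hε hs
  filter_upwards [ht.eventually h] with ε hε
  rwa [smul_smul]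

lemma event_add (P : Set Pt3) (hP : Convex ℝ P) (o d e : Pt3)
    (h : ∀ᶠ ε in nhdsWithin (0 : ℝ) (Ioi 0), o + ε • d ∈ P)
    (h' : ∀ᶠ ε in nhdsWithin (0 : ℝ) (Ioi 0), o + ε • e ∈ P) :
    ∀ᶠ ε in nhdsWithin (0 : ℝ) (Ioi 0), o + ε • (d + e) ∈ P := by
  filter_upwards [event_scale P o d 2 two_pos h, event_scale P o e 2 two_pos h'] with ε h1 h2
  have := hP h1 h2 (by norm_num : (0 : ℝ) ≤ 1 / 2) (by norm_num : (0 : ℝ) ≤ 1 / 2) (by norm_num)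
  convert this using 1
  module

lemma event_to (P : Set Pt3) (hP : Convex ℝ P) (o v : Pt3) (ho : o ∈ P) (hv : v ∈ P) (s : ℝ)
    (hs : 0 ≤ s) : ∀ᶠ ε in nhdsWithin (0 : ℝ) (Ioi 0), o + ε • (s • (v - o)) ∈ P := by
  rcases hs.eq_or_lt with rfl | hs
  · simp [ho]
  · apply event_scale P o _ s hs
    have : Ioo (0 : ℝ) 1 ∈ nhdsWithin (0 : ℝ) (Ioi 0) := Ioo_mem_nhdsGT one_pos
    filter_upwards [this] with ε hε
    have := hP ho hv (by linarith [hε.2] : 0 ≤ 1 - ε) hε.1.le (by ring)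
    convert this using 1
    module

/-- linear functional by three coefficients -/
def lin3 (a b c : ℝ) : Pt3 →ₗ[ℝ] ℝ where
  toFun w := a * w 0 + b * w 1 + c * w 2
  map_add' v w := by simp; ring
  map_smul' t w := by simp; ring

lemma lin3_apply (a b c : ℝ) (w : Pt3) : lin3 a b c w = a * w 0 + b * w 1 + c * w 2 := rfl

lemma cross_point (S : Set Pt3) (hS : ∀ w ∈ S, w 2 = 0) (v u : Pt3) (h h' : ℝ) (hp : 0 < h)
    (hp' : 0 < h') (hv : v 2 = h) (hu : u 2 = -h') (hne : (openSegment ℝ v u ∩ S).Nonempty) :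
    (h' / (h + h')) • v + (h / (h + h')) • u ∈ S := by
  obtain ⟨w, ⟨a, b, ha, hb, hab, rfl⟩, hw⟩ := hne
  have h2 := hS _ hw
  simp [hv, hu] at h2
  have hsum : h + h' ≠ 0 := by positivity
  have ea : a = h' / (h + h') := by
    rw [eq_div_iff hsum]
    have : b = 1 - a := by linarith
    subst this; linarith
  have eb : b = h / (h + h') := by
    rw [eq_div_iff hsum]
    have : a = 1 - b := by linarith
    subst this; linarith
  rw [← ea, ← eb]; exact hw

lemma hull_z (m : ℕ) (w : Pt3) (hw : w ∈ convexHull ℝ (regPoly m : Set Pt3)) : w 2 = 0 := by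
  have hc : Convex ℝ {w : Pt3 | w 2 = 0} := by
    intro a ha b hb s t _ _ _
    simp only [mem_ofPred_eq] at ha hb ⊢
    simp [ha, hb]
  refine convexHull_min ?_ hc hw
  intro q hq
  obtain ⟨k, rfl⟩ := mem_rp m q (by exact_mod_cast hq)
  exact rp_z m k

lemma final_bound (m : ℕ) (v₁ v₂ u₁ u₂ : Pt3)
    (h : PmSetup m v₁ v₂ u₁ u₂) (T : Finset (Finset Pt3))
    (hT : IsTriangulation (regPoly m ∪ {v₁, v₂, u₁, u₂}) T) :
    2 * T.card ≤ 7 * m + 2 := by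
  obtain ⟨hev, hm3, hvne, hune, hvz, hvpos, huz, huneg, horth, hcross, hpar⟩ := h
  obtain ⟨⟨htet, -, hcov⟩, hmeet⟩ := hT
  have hm0 : 0 < m := by omega
  obtain ⟨a, ha⟩ : ∃ a, a = v₂ 0 - v₁ 0 := ⟨_, rfl⟩
  obtain ⟨b, hb⟩ : ∃ b, b = v₂ 1 - v₁ 1 := ⟨_, rfl⟩
  obtain ⟨p, hp⟩ : ∃ p, p = u₂ 0 - u₁ 0 := ⟨_, rfl⟩
  obtain ⟨q, hq⟩ : ∃ q, q = u₂ 1 - u₁ 1 := ⟨_, rfl⟩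
  rw [← ha, ← hb, ← hp, ← hq] at horth
  have hr2 : 0 < a ^ 2 + b ^ 2 := by
    rcases eq_or_ne a 0 with h0 | h0
    · rcases eq_or_ne b 0 with h1 | h1
      · exfalso; apply hvne
        ext i; fin_cases i
        · simp; linarith
        · simp; linarith
        · exact hvz
      · positivity
    · positivity
  have hpq : ¬ (p = 0 ∧ q = 0) := by
    rintro ⟨h0, h1⟩
    apply hune
    ext i; fin_cases i
    · simp; linarith
    · simp; linarith
    · exact huz
  obtain ⟨r, hr⟩ : ∃ r, r = Real.sqrt (a ^ 2 + b ^ 2) := ⟨_, rfl⟩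
  have hrpos : 0 < r := by rw [hr]; exact Real.sqrt_pos.2 hr2
  have hrr : r ^ 2 = a ^ 2 + b ^ 2 := by rw [hr]; exact Real.sq_sqrt hr2.le
  obtain ⟨A, hA⟩ : ∃ A, A = a / r := ⟨_, rfl⟩
  obtain ⟨B, hB⟩ : ∃ B, B = b / r := ⟨_, rfl⟩
  have haA : a = r * A := by rw [hA]; field_simp
  have hbB : b = r * B := by rw [hB]; field_simp
  have hAB : A ^ 2 + B ^ 2 = 1 := by
    rw [hA, hB]; field_simp; linarith
  have horth' : A * p + B * q = 0 := by
    have : r * (A * p + B * q) = 0 := by rw [← horth, haA, hbB]; ring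
    rcases mul_eq_zero.1 this with h0 | h0
    · linarith
    · exact h0
  -- shear coefficients
  obtain ⟨s, hs⟩ : ∃ s, -B * v₁ 0 + A * v₁ 1 + s * v₁ 2 = 0 :=
    ⟨-(-B * v₁ 0 + A * v₁ 1) / v₁ 2, by field_simp; ring⟩
  obtain ⟨t, ht⟩ : ∃ t, A * u₁ 0 + B * u₁ 1 + t * u₁ 2 = 0 :=
    ⟨-(A * u₁ 0 + B * u₁ 1) / u₁ 2, by field_simp [huneg.ne]; ring⟩
  have hs2 : -B * v₂ 0 + A * v₂ 1 + s * v₂ 2 = 0 := by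
    have e0 : v₂ 0 = v₁ 0 + r * A := by linarith
    have e1 : v₂ 1 = v₁ 1 + r * B := by linarith
    rw [← hvz, e0, e1]; linarith
  have ht2 : A * u₂ 0 + B * u₂ 1 + t * u₂ 2 = 0 := by
    have e0 : u₂ 0 = u₁ 0 + p := by linarith
    have e1 : u₂ 1 = u₁ 1 + q := by linarith
    rw [← huz, e0, e1]; linarith
  have hzQ : ∀ w ∈ regPoly m, w 2 = 0 := by
    intro w hw
    obtain ⟨k, rfl⟩ := mem_rp m w hw
    exact rp_z m k
  have hO : ∀ i j : Fin 2, ((-u₁ 2) / (v₁ 2 + -u₁ 2)) • (![v₁, v₂] i)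
      + (v₁ 2 / (v₁ 2 + -u₁ 2)) • (![u₁, u₂] j) ∈
        intrinsicInterior ℝ (convexHull ℝ (regPoly m : Set Pt3)) := by
    intro i j
    apply cross_point _ (fun w hw => hull_z m w (intrinsicInterior_subset hw)) _ _ _ _ hvpos
      (by linarith)
    · fin_cases i
      · rfl
      · exact hvz.symm
    · fin_cases j
      · simp
      · simp [huz]
    · apply hcross
      · fin_cases i <;> simp
      · fin_cases j <;> simp
  let P : Set Pt3 := convexHull ℝ ((regPoly m ∪ {v₁, v₂, u₁, u₂} : Finset Pt3) : Set Pt3)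
  have hPc : Convex ℝ P := convex_convexHull ℝ _
  have hsub : ∀ w ∈ (regPoly m ∪ {v₁, v₂, u₁, u₂} : Finset Pt3), w ∈ P := fun w hw =>
    subset_convexHull ℝ _ (by exact_mod_cast hw)
  have hvP : ∀ i : Fin 2, ![v₁, v₂] i ∈ P := by
    intro i; apply hsub; fin_cases i <;> simp
  have huP : ∀ i : Fin 2, ![u₁, u₂] i ∈ P := by
    intro i; apply hsub; fin_cases i <;> simp
  have hQP : convexHull ℝ (regPoly m : Set Pt3) ⊆ P :=
    convexHull_mono (by intro w hw; simp at hw ⊢; tauto)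
  have hvz' : ∀ i : Fin 2, (![v₁, v₂] i) 2 = v₁ 2 := by
    intro i; fin_cases i
    · rfl
    · exact hvz.symm
  have huz' : ∀ i : Fin 2, (![u₁, u₂] i) 2 = u₁ 2 := by
    intro i; fin_cases i
    · rfl
    · exact huz.symm
  let c : Cfg :=
    { x := lin3 (-B) A s
      y := lin3 A B t
      z := lin3 0 0 1
      inj := by
        intro w w' h1 h2 h3
        simp only [lin3_apply] at h1 h2 h3
        have e2 : w 2 = w' 2 := by linarith
        rw [e2] at h1 h2
        have f1 : -B * (w 0 - w' 0) + A * (w 1 - w' 1) = 0 := by linarith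
        have f2 : A * (w 0 - w' 0) + B * (w 1 - w' 1) = 0 := by linarith
        have g0 : w 0 - w' 0 = 0 := by linear_combination (-B) * f1 + A * f2 - (w 0 - w' 0) * hAB
        have g1 : w 1 - w' 1 = 0 := by linear_combination A * f1 + B * f2 - (w 1 - w' 1) * hAB
        ext i; fin_cases i
        · simp; linarith
        · simp; linarith
        · exact e2
      Q := regPoly m
      v := ![v₁, v₂]
      u := ![u₁, u₂]
      hv := hvne
      hu := hune
      h := v₁ 2
      h' := -u₁ 2
      hpos := hvpos
      hpos' := by linarith
      zv := by intro i; simp only [lin3_apply]; rw [hvz' i]; ring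
      xv := by
        intro i; simp only [lin3_apply]; fin_cases i
        · exact hs
        · exact hs2
      zu := by intro i; simp only [lin3_apply]; rw [huz' i]; ring
      yu := by
        intro i; simp only [lin3_apply]; fin_cases i
        · exact ht
        · exact ht2
      zQ := by intro w hw; simp only [lin3_apply]; rw [hzQ w hw]; ring
      circ := by
        intro w hw; simp only [lin3_apply]; rw [hzQ w hw]
        obtain ⟨k, rfl⟩ := mem_rp m w hw
        have := rp_circ m k
        linear_combination (A ^ 2 + B ^ 2) * this + hAB
      negQ := by
        intro w hw
        obtain ⟨k, rfl⟩ := mem_rp m w hw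
        obtain ⟨n, hn⟩ := hev
        rw [rp_neg m n hm0 hn]
        exact rp_mem m hm0 _
      xinj := by
        intro w hw w' hw' hx
        simp only [lin3_apply] at hx
        have z1 := hzQ w hw
        have z2 := hzQ w' hw'
        rw [z1, z2] at hx
        by_contra hne
        set e0 := w' 0 - w 0 with he0
        set e1 := w' 1 - w 1 with he1
        have f1 : -B * e0 + A * e1 = 0 := by rw [he0, he1]; linarith
        set l := A * e0 + B * e1 with hl
        have g0 : e0 = l * A := by rw [hl]; linear_combination (-e0) * hAB - B * f1
        have g1 : e1 = l * B := by rw [hl]; linear_combination (-e1) * hAB + A * f1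
        have hl0 : l ≠ 0 := by
          intro h0
          rw [h0] at g0 g1
          apply hne
          ext i; fin_cases i
          · simp; linarith
          · simp; linarith
          · simp [z1, z2]
        apply (hpar w hw w' hw' hne (r / l)).1
        ext i; fin_cases i
        · simp; rw [← he0, ← ha, haA, g0]; field_simp
        · simp; rw [← he1, ← hb, hbB, g1]; field_simp
        · simp [z1, z2, hvz]
      yinj := by
        intro w hw w' hw' hx
        simp only [lin3_apply] at hx
        have z1 := hzQ w hw
        have z2 := hzQ w' hw'
        rw [z1, z2] at hx
        by_contra hne
        set e0 := w' 0 - w 0 with he0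
        set e1 := w' 1 - w 1 with he1
        have f1 : A * e0 + B * e1 = 0 := by rw [he0, he1]; linarith
        set l := -B * e0 + A * e1 with hl
        have g0 : e0 = l * (-B) := by rw [hl]; linear_combination (-e0) * hAB + A * f1
        have g1 : e1 = l * A := by rw [hl]; linear_combination (-e1) * hAB + B * f1
        have hl0 : l ≠ 0 := by
          intro h0
          rw [h0] at g0 g1
          apply hne
          ext i; fin_cases i
          · simp; linarith
          · simp; linarith
          · simp [z1, z2]
        obtain ⟨k, hk⟩ : ∃ k, k = -B * p + A * q := ⟨_, rfl⟩
        have k0 : p = k * (-B) := by rw [hk]; linear_combination (-p) * hAB + A * horth'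
        have k1 : q = k * A := by rw [hk]; linear_combination (-q) * hAB + B * horth'
        apply (hpar w hw w' hw' hne (k / l)).2
        ext i; fin_cases i
        · simp; rw [← he0, ← hp, k0, g0]; field_simp
        · simp; rw [← he1, ← hq, k1, g1]; field_simp
        · simp [z1, z2, huz]
      coset := by
        intro w1 h1 w2 h2 w3 h3
        obtain ⟨w4, h4, f1, f2⟩ := reg_coset m hm0 w1 w2 w3 h1 h2 h3
        refine ⟨w4, h4, ?_, ?_⟩ <;> simp only [lin3_apply] <;>
          rw [hzQ w1 h1, hzQ w2 h2, hzQ w3 h3, hzQ w4 h4]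
        · linear_combination (B ^ 2 - A ^ 2) * f1 - 2 * A * B * f2
        · linear_combination (-2 * A * B) * f1 + (A ^ 2 - B ^ 2) * f2
      T := T
      P := P
      Pconv := hPc
      vP := hvP
      uP := huP
      QP := fun w hw => hsub w (Finset.mem_union_left _ hw)
      OQ := fun i j => intrinsicInterior_subset (hO i j)
      cover := by
        intro w hw
        have : w ∈ ⋃ σ ∈ T, convexHull ℝ (σ : Set Pt3) := by rw [hcov]; exact hw
        simpa using this
      int := by
        intro i j d
        have ho := hO i j
        set o := ((-u₁ 2) / (v₁ 2 + -u₁ 2)) • (![v₁, v₂] i)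
          + (v₁ 2 / (v₁ 2 + -u₁ 2)) • (![u₁, u₂] j) with hod
        have hoP : o ∈ P := hQP (intrinsicInterior_subset ho)
        have hoz : o 2 = 0 := hull_z m o (intrinsicInterior_subset ho)
        have hh : ∀ e : Pt3, e 2 = 0 → ∀ᶠ ε in nhdsWithin (0 : ℝ) (Ioi 0), o + ε • e ∈ P := by
          intro e he
          filter_upwards [intr_event _ o e ho (horiz_dir m hm3 hev e he)] with ε hε
          exact hQP hε
        have main : ∀ w ∈ P, ∀ s : ℝ, 0 ≤ s → d 2 = s * w 2 →
            ∀ᶠ ε in nhdsWithin (0 : ℝ) (Ioi 0), o + ε • d ∈ P := by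
          intro w hw s hs hd
          have := event_add P hPc o (s • (w - o)) (d - s • (w - o))
            (event_to P hPc o w hoP hw s hs) (hh _ (by simp [hoz, hd]))
          simpa using this
        rcases le_total 0 (d 2) with hd | hd
        · exact main v₁ (hvP 0) (d 2 / v₁ 2) (div_nonneg hd hvpos.le) (by field_simp)
        · exact main u₁ (huP 0) (d 2 / u₁ 2) (div_nonneg_of_nonpos hd huneg.le)
            (by field_simp [huneg.ne])
      tet := fun σ hσ => (htet σ hσ).1
      vert := by
        intro σ hσ k hk
        have := (htet σ hσ).2 (by exact_mod_cast hk)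
        simp at this
        rcases this with h1 | h1 | h1 | h1 | h1
        · exact Or.inr (Or.inl ⟨0, h1⟩)
        · exact Or.inr (Or.inl ⟨1, h1⟩)
        · exact Or.inr (Or.inr ⟨0, h1⟩)
        · exact Or.inr (Or.inr ⟨1, h1⟩)
        · exact Or.inl h1
      meet := hmeet }
  have hb := c.bound (by show 2 ≤ (regPoly m).card; rw [card_regPoly]; omega)
  have e : c.Q.card = m := card_regPoly m
  rw [e] at hb
  exact hb

/-- No triangulation of the polytope `P_m` (with `Q_m` a regular
`m`-gon, `m` even) has more than `7m/2 + 1` tetrahedra. -/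
theorem Pm_triangulation_upper_bound (m : ℕ) (v₁ v₂ u₁ u₂ : Pt3)
    (h : PmSetup m v₁ v₂ u₁ u₂)
    (T : Finset (Finset Pt3))
    (hT : IsTriangulation (regPoly m ∪ {v₁, v₂, u₁, u₂}) T) :
    2 * T.card ≤ 7 * m + 2 := by
  exact final_bound m v₁ v₂ u₁ u₂ h T hT
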